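/- Boundary Harnack principle in C^{α,β} Hölder domains with α>1/2, β>1/3 (Theorem 1.2): Let α>1/2, β>1/3 (α,β ≤ 1) and K>0. There exists a constant C>0 depending only on n, λ, Λ, α, β and K such that the following holds. Assume [g]_{C^{α,β}} ≤ K, and let u and v be positive solutions of u_t = Lu and v_t = Lv respectively in 𝒞₁, with u vanishing continuously on Γ. Then for every (x,t) ∈ 𝒞_{1/2} one has u(x,t)/v(x,t) ≤ C · u(Ē)/v(E̲). -/

import Mathlib

noncomputable section
open scoped BigOperators
open Classical

abbrev Spc (m : ℕ) := EuclideanSpace ℝ (Fin (m + 1))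
abbrev Spc' (m : ℕ) := EuclideanSpace ℝ (Fin m)

/-- The horizontal coordinates `x' ∈ ℝ^{n-1}` of a point `x ∈ ℝⁿ`. -/
def xprime {m : ℕ} (x : Spc m) : Spc' m :=
  (WithLp.equiv 2 _).symm fun i => x i.castSucc

/-- The last (vertical) coordinate `x_n` of a point `x ∈ ℝⁿ`. -/
def xlast {m : ℕ} (x : Spc m) : ℝ := x (Fin.last m)

/-- Build a point of `ℝⁿ` from `x' ∈ ℝ^{n-1}` and the vertical coordinate. -/
def mkPt {m : ℕ} (x' : Spc' m) (xn : ℝ) : Spc m :=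
  (WithLp.equiv 2 _).symm fun i => if h : i = Fin.last m then xn else x' (i.castPred h)

/-- The `i`-th standard basis vector. -/
def eVec (m : ℕ) (i : Fin (m + 1)) : Spc m := EuclideanSpace.single i 1

/-- The entry `∂²u/∂xᵢ∂xⱼ` of the spatial Hessian of `u(x,t)` at `p = (x,t)`. -/
def sHess {m : ℕ} (u : Spc m × ℝ → ℝ) (p : Spc m × ℝ) (i j : Fin (m + 1)) : ℝ :=
  fderiv ℝ (fun y => fderiv ℝ (fun z => u (z, p.2)) y (eVec m j)) p.1 (eVec m i)

/-- The operator `Lu = tr(A(x) D²ₓu)` at the point `p = (x,t)`. -/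
def Lop {m : ℕ} (A : Spc m → Matrix (Fin (m + 1)) (Fin (m + 1)) ℝ)
    (u : Spc m × ℝ → ℝ) (p : Spc m × ℝ) : ℝ :=
  ∑ i, ∑ j, A p.1 i j * sHess u p j i

/-- Uniform ellipticity with symmetric coefficients: `λ|ξ|² ≤ ξ·A(x)ξ ≤ Λ|ξ|²`. -/
def IsElliptic {m : ℕ} (lam Lam : ℝ)
    (A : Spc m → Matrix (Fin (m + 1)) (Fin (m + 1)) ℝ) : Prop :=
  (∀ x, (A x).IsSymm) ∧
  ∀ (x ξ : Spc m),
    lam * ‖ξ‖ ^ 2 ≤ ∑ i, ∑ j, ξ i * A x i j * ξ j ∧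
      ∑ i, ∑ j, ξ i * A x i j * ξ j ≤ Lam * ‖ξ‖ ^ 2

/-- `u` is (pointwise) a solution of `u_t = Lu` on `Ω`: twice continuously
differentiable in `x`, differentiable in `t`, with `∂ₜu = tr(A(x)D²ₓu)`. -/
def SolvesL {m : ℕ} (A : Spc m → Matrix (Fin (m + 1)) (Fin (m + 1)) ℝ)
    (u : Spc m × ℝ → ℝ) (Ω : Set (Spc m × ℝ)) : Prop :=
  ∀ p ∈ Ω, ContDiffAt ℝ 2 (fun y => u (y, p.2)) p.1 ∧
    HasDerivAt (fun s => u (p.1, s)) (Lop A u p) p.2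

/-- `u` is a pointwise subsolution: `u_t ≤ Lu` on `Ω`. -/
def SubSolvesL {m : ℕ} (A : Spc m → Matrix (Fin (m + 1)) (Fin (m + 1)) ℝ)
    (u : Spc m × ℝ → ℝ) (Ω : Set (Spc m × ℝ)) : Prop :=
  ∀ p ∈ Ω, ContDiffAt ℝ 2 (fun y => u (y, p.2)) p.1 ∧
    DifferentiableAt ℝ (fun s => u (p.1, s)) p.2 ∧
    deriv (fun s => u (p.1, s)) p.2 ≤ Lop A u p

/-- `u` solves the heat equation `∂ₜu = Δu` on `Ω`. -/
def SolvesHeat {m : ℕ} (u : Spc m × ℝ → ℝ) (Ω : Set (Spc m × ℝ)) : Prop :=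
  ∀ p ∈ Ω, ContDiffAt ℝ 2 (fun y => u (y, p.2)) p.1 ∧
    HasDerivAt (fun s => u (p.1, s)) (∑ i, sHess u p i i) p.2

/-- The graph `Γ = {x_n = g(x',t)}`. -/
def graphSet {m : ℕ} (g : Spc' m → ℝ → ℝ) : Set (Spc m × ℝ) :=
  {p | xlast p.1 = g (xprime p.1) p.2}

/-- The cylinder `𝒞_r` of size `r` on top of the graph of `g`. -/
def Cyl {m : ℕ} (g : Spc' m → ℝ → ℝ) (r : ℝ) : Set (Spc m × ℝ) :=
  {p | ‖xprime p.1‖ < r ∧ -r ^ 2 < p.2 ∧ p.2 < r ^ 2 ∧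
    g (xprime p.1) p.2 < xlast p.1 ∧ xlast p.1 < g (xprime p.1) p.2 + r}

/-- The point `Ē = ((0', g(0',1/2) + 1/2), 1/2)`. -/
def Ebar {m : ℕ} (g : Spc' m → ℝ → ℝ) : Spc m × ℝ := (mkPt 0 (g 0 (1 / 2) + 1 / 2), 1 / 2)

/-- The point `E̲ = ((0', g(0',−1/2) + 1/2), −1/2)`. -/
def Eund {m : ℕ} (g : Spc' m → ℝ → ℝ) : Spc m × ℝ := (mkPt 0 (g 0 (-(1 / 2)) + 1 / 2), -(1 / 2))

/-- `u` vanishes continuously on `Γ`: `u(Q) → 0` as `Q → P` within `Ω`,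
for every `P ∈ Γ` in the closure of `Ω`. -/
def VanishesOn {m : ℕ} (u : Spc m × ℝ → ℝ) (Ω Γ : Set (Spc m × ℝ)) : Prop :=
  ∀ P ∈ Γ ∩ closure Ω, Filter.Tendsto u (nhdsWithin P Ω) (nhds 0)

/-- `[g]_{C^{α,β}} ≤ K`. -/
def HolderSemi {m : ℕ} (α β K : ℝ) (g : Spc' m → ℝ → ℝ) : Prop :=
  ∀ x' y' t s, |g x' t - g y' s| ≤ K * (‖x' - y'‖ ^ α + |t - s| ^ β)

/-- The backward-in-time cylinder `𝒞_r^−` (Lipschitz setting, parabolic scaling). -/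
def CylB {m : ℕ} (g : Spc' m → ℝ → ℝ) (r : ℝ) : Set (Spc m × ℝ) :=
  {p | (∀ i : Fin m, -r < xprime p.1 i ∧ xprime p.1 i < r) ∧ -r ^ 2 < p.2 ∧ p.2 ≤ 0 ∧
    g (xprime p.1) p.2 < xlast p.1 ∧ xlast p.1 < g (xprime p.1) p.2 + r}

/-- The set `𝒜_r` of points of `𝒞_r^−` at height at least `δr` above `Γ`. -/
def ASet {m : ℕ} (g : Spc' m → ℝ → ℝ) (δ r : ℝ) : Set (Spc m × ℝ) :=
  {p ∈ CylB g r | g (xprime p.1) p.2 + δ * r ≤ xlast p.1}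

/-- The backward-in-time cylinder `𝒞_r^−` (Hölder setting, time interval `(−r,0]`). -/
def CylBH {m : ℕ} (g : Spc' m → ℝ → ℝ) (r : ℝ) : Set (Spc m × ℝ) :=
  {p | (∀ i : Fin m, -r < xprime p.1 i ∧ xprime p.1 i < r) ∧ -r < p.2 ∧ p.2 ≤ 0 ∧
    g (xprime p.1) p.2 < xlast p.1 ∧ xlast p.1 < g (xprime p.1) p.2 + r}

/-- The set `𝒜_r` of points of the Hölder cylinder `𝒞_r^−` at height at least `r^β` above `Γ`. -/
def ASetH {m : ℕ} (g : Spc' m → ℝ → ℝ) (β r : ℝ) : Set (Spc m × ℝ) :=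
  {p ∈ CylBH g r | g (xprime p.1) p.2 + r ^ β ≤ xlast p.1}

/-- The height `h_Γ(x,t) = x_n − g(x',t)` above the graph. -/
def hGamma {m : ℕ} (g : Spc' m → ℝ → ℝ) (p : Spc m × ℝ) : ℝ :=
  xlast p.1 - g (xprime p.1) p.2

open Filter Topology Set in
theorem ContDiffAt.eventually_differentiableAt_two {E : Type*} [NormedAddCommGroup E]
    [NormedSpace ℝ E] {f : E → ℝ} {x : E} (hf : ContDiffAt ℝ 2 f x) :
    ∀ᶠ y in 𝓝 x, DifferentiableAt ℝ f y := by
  filter_upwards [hf.eventually (by simp)] with y hy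
  exact hy.differentiableAt (by norm_num)

theorem ContDiffAt.differentiableAt_fderiv_two {E : Type*} [NormedAddCommGroup E]
    [NormedSpace ℝ E] {f : E → ℝ} {x : E} (hf : ContDiffAt ℝ 2 f x) :
    DifferentiableAt ℝ (fderiv ℝ f) x :=
  (hf.fderiv_right (m := 1) (by norm_num)).differentiableAt (by norm_num)

/-- Second derivative matrix of a function of the space variable. -/
def hs {m : ℕ} (f : Spc m → ℝ) (x : Spc m) (i j : Fin (m + 1)) : ℝ :=
  fderiv ℝ (fun y => fderiv ℝ f y (eVec m j)) x (eVec m i)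

/-- The elliptic operator acting on a function of the space variable. -/
def LL {m : ℕ} (A : Spc m → Matrix (Fin (m + 1)) (Fin (m + 1)) ℝ)
    (f : Spc m → ℝ) (x : Spc m) : ℝ :=
  ∑ i, ∑ j, A x i j * hs f x j i

section Calculus

open Filter Topology Set

variable {m : ℕ} {A : Spc m → Matrix (Fin (m + 1)) (Fin (m + 1)) ℝ} {lam Lam : ℝ}

theorem hs_congr {f g : Spc m → ℝ} {x : Spc m} (h : f =ᶠ[𝓝 x] g) : hs f x = hs g x := by
  funext i j
  unfold hs
  have : (fun y => fderiv ℝ f y (eVec m j)) =ᶠ[𝓝 x] (fun y => fderiv ℝ g y (eVec m j)) := by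
    filter_upwards [h.fderiv (𝕜 := ℝ)] with y hy
    rw [hy]
  rw [this.fderiv_eq]

theorem LL_congr {f g : Spc m → ℝ} {x : Spc m} (h : f =ᶠ[𝓝 x] g) : LL A f x = LL A g x := by
  unfold LL
  rw [hs_congr h]

theorem hs_eq {f : Spc m → ℝ} {x : Spc m} (hf : ContDiffAt ℝ 2 f x) (i j : Fin (m + 1)) :
    hs f x i j = fderiv ℝ (fderiv ℝ f) x (eVec m i) (eVec m j) := by
  unfold hs
  rw [fderiv_clm_apply hf.differentiableAt_fderiv_two (differentiableAt_const _)]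
  simp

theorem hs_symm {f : Spc m → ℝ} {x : Spc m} (hf : ContDiffAt ℝ 2 f x) (i j : Fin (m + 1)) :
    hs f x i j = hs f x j i := by
  rw [hs_eq hf, hs_eq hf]
  exact (hf.isSymmSndFDerivAt (by simp)).eq _ _

theorem hs_add {f g : Spc m → ℝ} {x : Spc m} (hf : ContDiffAt ℝ 2 f x) (hg : ContDiffAt ℝ 2 g x)
    (i j : Fin (m + 1)) : hs (fun y => f y + g y) x i j = hs f x i j + hs g x i j := by
  have hfg : ContDiffAt ℝ 2 (fun y => f y + g y) x := hf.add hg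
  rw [hs_eq hfg, hs_eq hf, hs_eq hg]
  have : fderiv ℝ (fun y => f y + g y) =ᶠ[𝓝 x] fun y => fderiv ℝ f y + fderiv ℝ g y := by
    filter_upwards [hf.eventually_differentiableAt_two, hg.eventually_differentiableAt_two]
      with y h1 h2
    exact fderiv_fun_add h1 h2
  rw [this.fderiv_eq, fderiv_fun_add hf.differentiableAt_fderiv_two hg.differentiableAt_fderiv_two]
  rfl

theorem hs_const_mul {f : Spc m → ℝ} {x : Spc m} (hf : ContDiffAt ℝ 2 f x) (c : ℝ)
    (i j : Fin (m + 1)) : hs (fun y => c * f y) x i j = c * hs f x i j := by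
  have hcf : ContDiffAt ℝ 2 (fun y => c * f y) x := contDiffAt_const.mul hf
  rw [hs_eq hcf, hs_eq hf]
  have : fderiv ℝ (fun y => c * f y) =ᶠ[𝓝 x] fun y => c • fderiv ℝ f y := by
    filter_upwards [hf.eventually_differentiableAt_two] with y h1
    exact fderiv_const_mul h1 c
  rw [this.fderiv_eq, fderiv_fun_const_smul hf.differentiableAt_fderiv_two]
  rfl

theorem hs_const (c : ℝ) (x : Spc m) (i j : Fin (m + 1)) :
    hs (fun _ : Spc m => c) x i j = 0 := by
  simp [hs]

theorem LL_add {f g : Spc m → ℝ} {x : Spc m} (hf : ContDiffAt ℝ 2 f x) (hg : ContDiffAt ℝ 2 g x) :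
    LL A (fun y => f y + g y) x = LL A f x + LL A g x := by
  simp only [LL, hs_add hf hg, mul_add, Finset.sum_add_distrib]

theorem LL_const_mul {f : Spc m → ℝ} {x : Spc m} (hf : ContDiffAt ℝ 2 f x) (c : ℝ) :
    LL A (fun y => c * f y) x = c * LL A f x := by
  simp only [LL, hs_const_mul hf, Finset.mul_sum]
  refine Finset.sum_congr rfl fun i _ => Finset.sum_congr rfl fun j _ => by ring

theorem LL_const (c : ℝ) (x : Spc m) : LL A (fun _ => c) x = 0 := by
  simp [LL, hs_const]

theorem hs_rescale {f : Spc m → ℝ} {x0 y : Spc m} {r : ℝ} (hf : ContDiffAt ℝ 2 f (x0 + r • y))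
    (i j : Fin (m + 1)) :
    hs (fun y => f (x0 + r • y)) y i j = r ^ 2 * hs f (x0 + r • y) i j := by
  have hφ : ∀ y : Spc m, HasFDerivAt (fun y : Spc m => x0 + r • y)
      (r • ContinuousLinearMap.id ℝ (Spc m)) y := fun y =>
    (((hasFDerivAt_id y).const_smul r).const_add x0)
  have hc : ContinuousAt (fun y : Spc m => x0 + r • y) y := (hφ y).continuousAt
  have e1 : (fun z => fderiv ℝ (fun y => f (x0 + r • y)) z (eVec m j)) =ᶠ[𝓝 y]
      fun z => r * (fderiv ℝ f (x0 + r • z) (eVec m j)) := by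
    filter_upwards [hc.eventually hf.eventually_differentiableAt_two] with z hz
    have := (hz.hasFDerivAt.comp z (hφ z)).fderiv
    have h2 : fderiv ℝ (fun y => f (x0 + r • y)) z = _ := this
    rw [h2]
    simp
  unfold hs
  rw [e1.fderiv_eq]
  have hd : DifferentiableAt ℝ (fun z => fderiv ℝ f z (eVec m j)) (x0 + r • y) :=
    hf.differentiableAt_fderiv_two.clm_apply (differentiableAt_const _)
  have h3 := hd.hasFDerivAt.comp (g := fun z => fderiv ℝ f z (eVec m j))
    (f := fun y => x0 + r • y) y (hφ y)
  rw [show ((fun z => fderiv ℝ f z (eVec m j)) ∘ fun y => x0 + r • y)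
    = fun z => fderiv ℝ f (x0 + r • z) (eVec m j) from rfl] at h3
  have h4 := (h3.const_mul r).fderiv
  rw [h4]
  simp
  ring

theorem hs_psd_of_isLocalMin {f : Spc m → ℝ} {x : Spc m} (hf : ContDiffAt ℝ 2 f x)
    (hmin : IsLocalMin f x) (ξ : Fin (m + 1) → ℝ) :
    0 ≤ ∑ i, ∑ j, ξ i * ξ j * hs f x j i := by
  set v : Spc m := ∑ i, ξ i • eVec m i with hv
  have key : ∑ i, ∑ j, ξ i * ξ j * hs f x j i = fderiv ℝ (fderiv ℝ f) x v v := by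
    simp only [hv, map_sum, map_smul, sum_apply, smul_apply,
      hs_eq hf, smul_eq_mul, Finset.mul_sum]
    refine Finset.sum_congr rfl fun i _ => Finset.sum_congr rfl fun j _ => by ring
  rw [key]
  by_contra hneg
  push Not at hneg
  set φ : ℝ → Spc m := fun s => x + s • v
  have hφ : ∀ s, HasDerivAt φ v s := fun s => by
    simpa [φ] using ((hasDerivAt_id s).smul_const v).const_add x
  have hφ0 : φ 0 = x := by simp [φ]
  have hc : Tendsto φ (𝓝 0) (𝓝 x) := by
    have := (hφ 0).continuousAt.tendsto
    rwa [hφ0] at this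
  have hd1 : ∀ᶠ s in 𝓝 (0 : ℝ), HasDerivAt (fun s => f (φ s)) (fderiv ℝ f (φ s) v) s := by
    filter_upwards [hc.eventually hf.eventually_differentiableAt_two] with s hs
    exact hs.hasFDerivAt.comp_hasDerivAt s (hφ s)
  have hd2 : HasDerivAt (fun s => fderiv ℝ f (φ s) v) (fderiv ℝ (fderiv ℝ f) x v v) 0 := by
    have h1 : HasFDerivAt (fderiv ℝ f) (fderiv ℝ (fderiv ℝ f) x) (φ 0) := by
      rw [hφ0]; exact hf.differentiableAt_fderiv_two.hasFDerivAt
    have h2 := h1.comp_hasDerivAt (0 : ℝ) (hφ 0)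
    have h3 := h2.clm_apply (hasDerivAt_const (0 : ℝ) v)
    simpa using h3
  have hder : deriv (fun s => f (φ s)) =ᶠ[𝓝 0] fun s => fderiv ℝ f (φ s) v := by
    filter_upwards [hd1] with s hs using hs.deriv
  have hmin' : IsLocalMin (fun s => f (φ s)) 0 := by
    have := hc.eventually hmin
    filter_upwards [this] with s hs
    rw [hφ0]; exact hs
  have h0 : fderiv ℝ f x v = 0 := by
    rw [hmin.fderiv_eq_zero]; rfl
  have hmax : IsLocalMin (fun s => -f (φ s)) 0 := by
    apply isLocalMin_of_deriv_deriv_pos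
    · have : deriv (fun s => -f (φ s)) =ᶠ[𝓝 0] fun s => -fderiv ℝ f (φ s) v := by
        filter_upwards [hd1] with s hs using hs.fun_neg.deriv
      rw [this.deriv_eq, hd2.fun_neg.deriv]
      linarith
    · have := hd1.self_of_nhds.fun_neg.deriv
      rw [this, hφ0, h0, neg_zero]
    · exact hd1.self_of_nhds.neg.continuousAt
  have hconst : (fun s => f (φ s)) =ᶠ[𝓝 0] fun _ => f x := by
    filter_upwards [hmax, hmin'] with s h1 h2
    simp only [hφ0] at h1 h2
    linarith
  have h5 : deriv (fun s => f (φ s)) =ᶠ[𝓝 0] fun _ => 0 := by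
    filter_upwards [hconst.deriv] with s hs
    rw [hs]; simp
  have h6 := (hder.symm.trans h5).deriv_eq
  rw [hd2.deriv] at h6
  simp at h6
  linarith

theorem IsElliptic.posSemidef (hA : IsElliptic lam Lam A) (x : Spc m) :
    (A x - lam • (1 : Matrix (Fin (m + 1)) (Fin (m + 1)) ℝ)).PosSemidef := by
  refine Matrix.PosSemidef.of_dotProduct_mulVec_nonneg ?_ ?_
  · refine Matrix.IsHermitian.sub ?_ ?_
    · have := hA.1 x
      unfold Matrix.IsHermitian
      rw [Matrix.conjTranspose_eq_transpose_of_trivial]; exact this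
    · unfold Matrix.IsHermitian
      simp
  · intro ξ
    have h := (hA.2 x (WithLp.toLp 2 ξ)).1
    simp only [EuclideanSpace.norm_sq_eq] at h
    simp only [star_trivial, Matrix.sub_mulVec, dotProduct_sub]
    have e1 : dotProduct ξ ((A x).mulVec ξ) = ∑ i, ∑ j, ξ i * A x i j * ξ j := by
      simp [dotProduct, Matrix.mulVec, Finset.mul_sum, mul_assoc]
    have e2 : dotProduct ξ ((lam • (1 : Matrix (Fin (m + 1)) (Fin (m + 1)) ℝ)).mulVec ξ)
        = lam * ∑ i, ‖ξ i‖ ^ 2 := by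
      simp [dotProduct, Finset.mul_sum, Matrix.smul_mulVec]
      refine Finset.sum_congr rfl fun i _ => by ring
    rw [e1, e2]
    simpa using h

open scoped MatrixOrder Matrix.Norms.L2Operator in
theorem IsElliptic.lam_trace_le (hA : IsElliptic lam Lam A) (x : Spc m)
    {H : Fin (m + 1) → Fin (m + 1) → ℝ}
    (hH : ∀ ξ : Fin (m + 1) → ℝ, 0 ≤ ∑ i, ∑ j, ξ i * ξ j * H j i) :
    lam * ∑ i, H i i ≤ ∑ i, ∑ j, A x i j * H j i := by
  obtain ⟨B, hB⟩ := CStarAlgebra.nonneg_iff_eq_star_mul_self.mp (hA.posSemidef x).nonneg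
  have h1 : ∀ i j, A x i j - lam * (if i = j then 1 else 0) = ∑ k, B k i * B k j := by
    intro i j
    have := congrFun (congrFun hB i) j
    simpa [Matrix.mul_apply, Matrix.one_apply, Matrix.star_apply] using this
  have h2 : ∑ i, ∑ j, A x i j * H j i - lam * ∑ i, H i i
      = ∑ k, ∑ i, ∑ j, B k i * B k j * H j i := by
    have e : ∑ i, ∑ j, (A x i j - lam * (if i = j then 1 else 0)) * H j i
        = ∑ i, ∑ j, A x i j * H j i - lam * ∑ i, H i i := by
      simp [sub_mul, Finset.sum_sub_distrib, Finset.mul_sum]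
    rw [← e]
    simp only [h1, Finset.sum_mul]
    rw [Finset.sum_comm' (t' := Finset.univ) (s' := fun _ => Finset.univ) (by simp)]
    rw [Finset.sum_comm]
    conv_rhs => rw [Finset.sum_comm]
    refine Finset.sum_congr rfl fun i _ => ?_
    rw [Finset.sum_comm]
  have h3 : 0 ≤ ∑ k, ∑ i, ∑ j, B k i * B k j * H j i :=
    Finset.sum_nonneg fun k _ => hH (fun i => B k i)
  linarith

theorem LL_ge_of_isLocalMin (hA : IsElliptic lam Lam A) {f : Spc m → ℝ} {x : Spc m}
    (hf : ContDiffAt ℝ 2 f x) (hmin : IsLocalMin f x) :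
    lam * ∑ i, hs f x i i ≤ LL A f x :=
  hA.lam_trace_le x (hs_psd_of_isLocalMin hf hmin)

theorem hs_diag_nonneg {f : Spc m → ℝ} {x : Spc m} (hf : ContDiffAt ℝ 2 f x)
    (hmin : IsLocalMin f x) (i : Fin (m + 1)) : 0 ≤ hs f x i i := by
  have := hs_psd_of_isLocalMin hf hmin (fun k => if k = i then 1 else 0)
  simpa using this

theorem LL_nonneg_of_isLocalMin (hlam : 0 < lam) (hA : IsElliptic lam Lam A) {f : Spc m → ℝ}
    {x : Spc m} (hf : ContDiffAt ℝ 2 f x) (hmin : IsLocalMin f x) : 0 ≤ LL A f x :=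
  le_trans (mul_nonneg hlam.le (Finset.sum_nonneg fun i _ => hs_diag_nonneg hf hmin i))
    (LL_ge_of_isLocalMin hA hf hmin)

theorem abs_hs_le_of_isLocalMin {f : Spc m → ℝ} {x : Spc m} (hf : ContDiffAt ℝ 2 f x)
    (hmin : IsLocalMin f x) (i j : Fin (m + 1)) : |hs f x i j| ≤ ∑ k, hs f x k k := by
  have hle : ∀ i, hs f x i i ≤ ∑ k, hs f x k k := fun i =>
    Finset.single_le_sum (f := fun k => hs f x k k) (fun k _ => hs_diag_nonneg hf hmin k)
      (Finset.mem_univ i)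
  by_cases hij : i = j
  · subst hij
    rw [abs_of_nonneg (hs_diag_nonneg hf hmin i)]
    exact hle i
  have e : ∀ s : ℝ, 0 ≤ hs f x i i + s * hs f x j i + s * hs f x i j + s * s * hs f x j j := by
    intro s
    have := hs_psd_of_isLocalMin hf hmin
      (fun k => (if k = i then 1 else 0) + s * (if k = j then 1 else 0))
    simp only [add_mul, mul_add, Finset.sum_add_distrib, ite_mul, mul_ite, mul_one, mul_zero,
      zero_mul, one_mul, Finset.sum_ite_eq', Finset.mem_univ, if_true] at this
    linarith
  have h1 := e 1
  have h2 := e (-1)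
  rw [hs_symm hf j i] at h1 h2
  have := hle i
  have := hle j
  rw [abs_le]
  constructor <;> linarith

theorem hs_normSq (x : Spc m) (i j : Fin (m + 1)) :
    hs (fun y : Spc m => ‖y‖ ^ 2) x i j = if i = j then 2 else 0 := by
  have e1 : (fun y : Spc m => fderiv ℝ (fun y : Spc m => ‖y‖ ^ 2) y (eVec m j))
      = fun y => 2 * EuclideanSpace.proj (𝕜 := ℝ) j y := by
    funext y
    rw [(HasStrictFDerivAt.hasFDerivAt (hasStrictFDerivAt_norm_sq y)).fderiv]
    simp [eVec]
    try rw [EuclideanSpace.inner_single_right]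
    try simp
  unfold hs
  rw [e1]
  rw [((EuclideanSpace.proj (𝕜 := ℝ) j).hasFDerivAt.const_mul 2).fderiv]
  simp [eVec, eq_comm]

theorem hs_barrier (c : ℝ) (x : Spc m) (i j : Fin (m + 1)) :
    hs (fun y : Spc m => (c - ‖y‖ ^ 2) ^ 2) x i j
      = 8 * (x i * x j) - 4 * (c - ‖x‖ ^ 2) * (if i = j then 1 else 0) := by
  have hN : ∀ y : Spc m, HasFDerivAt (fun y : Spc m => ‖y‖ ^ 2) (2 • innerSL ℝ y) y := fun y =>
    HasStrictFDerivAt.hasFDerivAt (hasStrictFDerivAt_norm_sq y)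
  have hin : ∀ y : Spc m, inner ℝ y (eVec m j) = EuclideanSpace.proj (𝕜 := ℝ) j y := by
    intro y
    simp [eVec, EuclideanSpace.inner_single_right]
  have e1 : (fun y : Spc m => fderiv ℝ (fun y : Spc m => (c - ‖y‖ ^ 2) ^ 2) y (eVec m j))
      = fun y => (-4) * ((c - ‖y‖ ^ 2) * EuclideanSpace.proj (𝕜 := ℝ) j y) := by
    funext y
    rw [(((hN y).const_sub c).pow 2).fderiv]
    have := hin y
    simp at this
    simp [this]
    ring
  unfold hs
  rw [e1]
  have h2 := ((((hN x).const_sub c).fun_mul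
    (EuclideanSpace.proj (𝕜 := ℝ) j).hasFDerivAt).const_mul (-4)).fderiv
  rw [h2]
  have hini : inner ℝ x (eVec m i) = x i := by
    simp [eVec, EuclideanSpace.inner_single_right]
  simp [hini]
  simp [eVec, eq_comm]
  by_cases h : i = j
  · simp [h]; ring
  · simp [h]; ring

theorem IsElliptic.diag_bounds (hA : IsElliptic lam Lam A) (x : Spc m) (i : Fin (m + 1)) :
    lam ≤ A x i i ∧ A x i i ≤ Lam := by
  have h := hA.2 x (eVec m i)
  have e1 : ‖eVec m i‖ = 1 := by simp [eVec]
  have e2 : ∑ k, ∑ j, (eVec m i) k * A x k j * (eVec m i) j = A x i i := by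
    simp [eVec]
  rw [e1, e2] at h
  simpa using h

theorem IsElliptic.trace_bounds (hA : IsElliptic lam Lam A) (x : Spc m) :
    (m + 1) * lam ≤ ∑ i, A x i i ∧ ∑ i, A x i i ≤ (m + 1) * Lam := by
  constructor
  · have := Finset.sum_le_sum fun i (_ : i ∈ Finset.univ) => (hA.diag_bounds x i).1
    simpa using this
  · have := Finset.sum_le_sum fun i (_ : i ∈ Finset.univ) => (hA.diag_bounds x i).2
    simpa using this

theorem LL_normSq_le (hA : IsElliptic lam Lam A) (x : Spc m) :
    LL A (fun y : Spc m => ‖y‖ ^ 2) x ≤ 2 * (m + 1) * Lam := by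
  have h := (hA.trace_bounds x).2
  have : LL A (fun y : Spc m => ‖y‖ ^ 2) x = 2 * ∑ i, A x i i := by
    simp [LL, hs_normSq, Finset.mul_sum, mul_comm]
  rw [this]; linarith

theorem LL_barrier_ge (hA : IsElliptic lam Lam A) (c : ℝ) (x : Spc m) (hc : 0 ≤ c - ‖x‖ ^ 2) :
    8 * lam * ‖x‖ ^ 2 - 4 * (m + 1) * Lam * (c - ‖x‖ ^ 2)
      ≤ LL A (fun y : Spc m => (c - ‖y‖ ^ 2) ^ 2) x := by
  have h1 := (hA.trace_bounds x).2
  have h2 := (hA.2 x x).1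
  have : LL A (fun y : Spc m => (c - ‖y‖ ^ 2) ^ 2) x
      = 8 * (∑ i, ∑ j, x i * A x i j * x j) - 4 * (c - ‖x‖ ^ 2) * ∑ i, A x i i := by
    simp only [LL, hs_barrier, mul_sub, Finset.sum_sub_distrib, Finset.mul_sum]
    congr 1
    · refine Finset.sum_congr rfl fun i _ => Finset.sum_congr rfl fun j _ => by ring
    · refine Finset.sum_congr rfl fun i _ => ?_
      simp [mul_comm]
  rw [this]
  nlinarith

end Calculus

/-- `z` is twice differentiable in space, differentiable in time and a subsolution at `p`. -/
def SubAt {m : ℕ} (A : Spc m → Matrix (Fin (m + 1)) (Fin (m + 1)) ℝ)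
    (z : Spc m × ℝ → ℝ) (p : Spc m × ℝ) : Prop :=
  ContDiffAt ℝ 2 (fun y => z (y, p.2)) p.1 ∧
    ∃ d, HasDerivAt (fun s => z (p.1, s)) d p.2 ∧ d ≤ LL A (fun y => z (y, p.2)) p.1

/-- `u` solves the equation at the single point `p`. -/
def SolAt {m : ℕ} (A : Spc m → Matrix (Fin (m + 1)) (Fin (m + 1)) ℝ)
    (u : Spc m × ℝ → ℝ) (p : Spc m × ℝ) : Prop :=
  ContDiffAt ℝ 2 (fun y => u (y, p.2)) p.1 ∧
    HasDerivAt (fun s => u (p.1, s)) (LL A (fun y => u (y, p.2)) p.1) p.2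

section Basic

open Filter Topology Set

variable {m : ℕ} {A : Spc m → Matrix (Fin (m + 1)) (Fin (m + 1)) ℝ} {lam Lam : ℝ}

theorem SolAt.subAt {u : Spc m × ℝ → ℝ} {p : Spc m × ℝ} (h : SolAt A u p) : SubAt A u p :=
  ⟨h.1, _, h.2, le_rfl⟩

theorem SubAt.congr {z w : Spc m × ℝ → ℝ} {p : Spc m × ℝ} (h : SubAt A z p)
    (h1 : (fun y => w (y, p.2)) =ᶠ[𝓝 p.1] fun y => z (y, p.2))
    (h2 : (fun s => w (p.1, s)) =ᶠ[𝓝 p.2] fun s => z (p.1, s)) : SubAt A w p := by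
  obtain ⟨hc, d, hd, hle⟩ := h
  exact ⟨hc.congr_of_eventuallyEq h1, d, hd.congr_of_eventuallyEq h2, by rwa [LL_congr h1]⟩

theorem SubAt.congr_nhds {z w : Spc m × ℝ → ℝ} {p : Spc m × ℝ} (h : SubAt A z p)
    (h1 : w =ᶠ[𝓝 p] z) : SubAt A w p := by
  refine h.congr ?_ ?_
  · exact (Continuous.prodMk continuous_id continuous_const).continuousAt.tendsto.eventually
      (p := fun q => w q = z q) h1
  · exact (Continuous.prodMk continuous_const continuous_id).continuousAt.tendsto.eventually
      (p := fun q => w q = z q) h1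

theorem SolAt.comb {u v : Spc m × ℝ → ℝ} {p : Spc m × ℝ} (hu : SolAt A u p) (hv : SolAt A v p)
    (a b c : ℝ) : SolAt A (fun q => a * u q + b * v q + c) p := by
  have h1 : ContDiffAt ℝ 2 (fun y => a * u (y, p.2)) p.1 := contDiffAt_const.mul hu.1
  have h2 : ContDiffAt ℝ 2 (fun y => b * v (y, p.2)) p.1 := contDiffAt_const.mul hv.1
  refine ⟨(h1.add h2).add contDiffAt_const, ?_⟩
  rw [LL_add (h1.add h2) contDiffAt_const, LL_add h1 h2, LL_const, LL_const_mul hu.1,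
    LL_const_mul hv.1, add_zero]
  exact ((hu.2.const_mul a).add (hv.2.const_mul b)).add_const c

theorem SolAt.affine {u : Spc m × ℝ → ℝ} {p : Spc m × ℝ} (hu : SolAt A u p)
    (a c : ℝ) : SolAt A (fun q => a * u q + c) p := by
  simpa using hu.comb hu a 0 c

/-- The parabolic rescaling of space-time. -/
def pscale {m : ℕ} (x0 : Spc m) (t0 r : ℝ) (p : Spc m × ℝ) : Spc m × ℝ :=
  (x0 + r • p.1, t0 + r ^ 2 * p.2)

theorem IsElliptic.rescale (hA : IsElliptic lam Lam A) (x0 : Spc m) (r : ℝ) :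
    IsElliptic lam Lam (fun y => A (x0 + r • y)) :=
  ⟨fun _ => hA.1 _, fun _ ξ => hA.2 _ ξ⟩

theorem LL_rescale {f : Spc m → ℝ} {x0 y : Spc m} {r : ℝ} (hf : ContDiffAt ℝ 2 f (x0 + r • y)) :
    LL (fun y => A (x0 + r • y)) (fun y => f (x0 + r • y)) y = r ^ 2 * LL A f (x0 + r • y) := by
  simp only [LL, hs_rescale hf, Finset.mul_sum]
  refine Finset.sum_congr rfl fun i _ => Finset.sum_congr rfl fun j _ => by ring

theorem contDiffAt_rescale {f : Spc m → ℝ} {x0 y : Spc m} {r : ℝ}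
    (hf : ContDiffAt ℝ 2 f (x0 + r • y)) : ContDiffAt ℝ 2 (fun y => f (x0 + r • y)) y :=
  ContDiffAt.comp y hf (by fun_prop)

theorem hasDerivAt_rescale {f : ℝ → ℝ} {t0 s r d : ℝ} (hf : HasDerivAt f d (t0 + r ^ 2 * s)) :
    HasDerivAt (fun s => f (t0 + r ^ 2 * s)) (r ^ 2 * d) s := by
  have h : HasDerivAt (fun s => t0 + r ^ 2 * s) (r ^ 2) s := by
    simpa using ((hasDerivAt_id s).const_mul (r ^ 2)).const_add t0
  have h2 := hf.comp s h
  rw [mul_comm] at h2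
  exact h2

theorem SubAt.rescale {z : Spc m × ℝ → ℝ} {x0 : Spc m} {t0 r : ℝ} {p : Spc m × ℝ}
    (h : SubAt A z (pscale x0 t0 r p)) :
    SubAt (fun y => A (x0 + r • y)) (fun q => z (pscale x0 t0 r q)) p := by
  obtain ⟨hc, d, hd, hle⟩ := h
  refine ⟨contDiffAt_rescale (f := fun y => z (y, t0 + r ^ 2 * p.2)) hc, r ^ 2 * d,
    hasDerivAt_rescale (f := fun s => z (x0 + r • p.1, s)) hd, ?_⟩
  have := LL_rescale (A := A) (f := fun y => z (y, t0 + r ^ 2 * p.2)) hc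
  refine le_trans ?_ (le_of_eq this.symm)
  exact mul_le_mul_of_nonneg_left hle (sq_nonneg r)

theorem SolAt.rescale {z : Spc m × ℝ → ℝ} {x0 : Spc m} {t0 r : ℝ} {p : Spc m × ℝ}
    (h : SolAt A z (pscale x0 t0 r p)) :
    SolAt (fun y => A (x0 + r • y)) (fun q => z (pscale x0 t0 r q)) p := by
  obtain ⟨hc, hd⟩ := h
  refine ⟨contDiffAt_rescale (f := fun y => z (y, t0 + r ^ 2 * p.2)) hc, ?_⟩
  have := LL_rescale (A := A) (f := fun y => z (y, t0 + r ^ 2 * p.2)) hc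
  have h2 := hasDerivAt_rescale (f := fun s => z (x0 + r • p.1, s)) hd
  exact this ▸ h2

theorem continuous_pscale (x0 : Spc m) (t0 r : ℝ) : Continuous (pscale x0 t0 r) := by
  unfold pscale; fun_prop

end Basic

section OneDim

open Filter Topology Set MeasureTheory

theorem volume_contact_times_ge {M : ℝ → ℝ} (hM : Continuous M)
    (hmono : MonotoneOn M (Icc (-1) 0)) {a b L : ℝ} (hL : 0 < L)
    (h1 : M (-1) ≤ a) (h0 : b < M 0) {S : Set ℝ} (hS : S ⊆ Ioo (-1) 0)
    (hit : ∀ t ∈ Ioo (-1 : ℝ) 0, a < M t → (∀ s ∈ Ico (-1) t, M s < M t) → t ∈ S)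
    (slope : ∀ t ∈ S, a < M t → ∀ σ ∈ Ico (-1 : ℝ) t, ∃ s ∈ Ico σ t, M t - M s < L * (t - s)) :
    ENNReal.ofReal ((b - a) / L) ≤ volume S := by
  have lip : ∀ s t : ℝ, -1 ≤ s → s ≤ t → t < 0 → a ≤ M s → M t - M s ≤ L * (t - s) := by
    intro s t hs hst ht has
    by_contra hcon
    push Not at hcon
    obtain ⟨τ, hτ, hmax⟩ := isCompact_Icc.exists_isMaxOn (nonempty_Icc.2 hst)
      (show ContinuousOn (fun x => M x - L * x) (Icc s t) by fun_prop)
    rw [isMaxOn_iff] at hmax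
    have hτt := hmax t (right_mem_Icc.2 hst)
    have hne : s < τ := by
      rcases eq_or_lt_of_le hτ.1 with h | h
      · rw [← h] at hτt; linarith
      · exact h
    have hMτ : M s < M τ := by nlinarith
    have hstrict : ∀ σ ∈ Ico (-1) τ, M σ < M τ := by
      intro σ hσ
      rcases le_or_gt s σ with h | h
      · have := hmax σ (show σ ∈ Icc s t from ⟨h, hσ.2.le.trans hτ.2⟩)
        nlinarith [hσ.2]
      · refine lt_of_le_of_lt (hmono ⟨hσ.1, by linarith⟩ ⟨hs, by linarith⟩ h.le) hMτ
    have hτS : τ ∈ S := hit τ ⟨by linarith, lt_of_le_of_lt hτ.2 ht⟩ (by linarith) hstrict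
    obtain ⟨σ, hσ, hlt⟩ := slope τ hτS (by linarith) s ⟨hs, hne⟩
    have := hmax σ (show σ ∈ Icc s t from ⟨hσ.1, hσ.2.le.trans hτ.2⟩)
    nlinarith
  set T := {t ∈ S | a < M t}
  have hlip : LipschitzOnWith (Real.toNNReal L) M T := by
    refine LipschitzOnWith.of_dist_le_mul fun x hx y hy => ?_
    rw [Real.coe_toNNReal _ hL.le, Real.dist_eq, Real.dist_eq]
    rcases le_total x y with h | h
    · have e1 := lip x y (hS hx.1).1.le h (hS hy.1).2 hx.2.le
      have e2 := hmono ⟨(hS hx.1).1.le, (hS hx.1).2.le⟩ ⟨(hS hy.1).1.le, (hS hy.1).2.le⟩ h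
      rw [abs_of_nonpos (by linarith), abs_of_nonpos (by linarith)]; linarith
    · have e1 := lip y x (hS hy.1).1.le h (hS hx.1).2 hy.2.le
      have e2 := hmono ⟨(hS hy.1).1.le, (hS hy.1).2.le⟩ ⟨(hS hx.1).1.le, (hS hx.1).2.le⟩ h
      rw [abs_of_nonneg (by linarith), abs_of_nonneg (by linarith)]; linarith
  have himg : Ioo a b ⊆ M '' T := by
    intro h hh
    have hK : IsCompact (Icc (-1 : ℝ) 0 ∩ M ⁻¹' Ici h) :=
      isCompact_Icc.inter_right (isClosed_Ici.preimage hM)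
    obtain ⟨t, ⟨htI, htM⟩, htmin⟩ := hK.exists_isLeast
      ⟨0, ⟨by norm_num, le_rfl⟩, by simpa using (hh.2.trans h0).le⟩
    have htM' : h ≤ M t := htM
    have hlt : ∀ s ∈ Ico (-1) t, M s < h := by
      intro s hs
      by_contra hcon
      push Not at hcon
      exact absurd (htmin ⟨⟨hs.1, hs.2.le.trans htI.2⟩, hcon⟩) (not_le.2 hs.2)
    have ht1 : -1 < t := by
      rcases eq_or_lt_of_le htI.1 with h' | h'
      · rw [← h'] at htM'; linarith [hh.1]
      · exact h'
    have hMt : M t = h := by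
      refine le_antisymm ?_ htM'
      have hcl : t ∈ closure (Ico (-1) t) := by
        rw [closure_Ico ht1.ne]; exact right_mem_Icc.2 ht1.le
      exact closure_minimal (fun s hs => (hlt s hs).le) (isClosed_Iic.preimage hM) hcl
    have ht0 : t < 0 := by
      rcases eq_or_lt_of_le htI.2 with h' | h'
      · rw [h'] at hMt; linarith [hh.2]
      · exact h'
    exact ⟨t, ⟨hit t ⟨ht1, ht0⟩ (by rw [hMt]; exact hh.1) (by rw [hMt]; exact hlt),
      by rw [hMt]; exact hh.1⟩, hMt⟩
  have hvol := hlip.hausdorffMeasure_image_le (d := 1) zero_le_one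
  rw [hausdorffMeasure_real] at hvol
  have h2 : ENNReal.ofReal (b - a) ≤ ENNReal.ofReal L * volume S := by
    calc ENNReal.ofReal (b - a) = volume (Ioo a b) := (Real.volume_Ioo).symm
      _ ≤ volume (M '' T) := measure_mono himg
      _ ≤ _ := hvol
      _ ≤ _ := by
        simp only [ENNReal.rpow_one]
        exact mul_le_mul' le_rfl (measure_mono fun t ht => ht.1)
  rw [ENNReal.ofReal_div_of_pos hL]
  refine ENNReal.div_le_of_le_mul ?_
  rwa [mul_comm]

end OneDim

section ABP

open Filter Topology Set MeasureTheory Metric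

variable {m : ℕ} {A : Spc m → Matrix (Fin (m + 1)) (Fin (m + 1)) ℝ} {lam Lam : ℝ}

def abpG (z : Spc m × ℝ → ℝ) (p : Spc m × ℝ) : ℝ := z p - ‖p.1‖ ^ 2 + p.2

def abpSlice (z : Spc m × ℝ → ℝ) (p : Spc m × ℝ) : ℝ :=
  sSup ((fun x => abpG z (x, p.2) - inner ℝ p.1 x) '' closedBall 0 1)

def abpRun (z : Spc m × ℝ → ℝ) (p : Spc m × ℝ) : ℝ :=
  sSup ((fun q : Spc m × ℝ => abpG z (q.1, min q.2 p.2) - inner ℝ p.1 q.1) ''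
    (closedBall 0 1 ×ˢ Icc (-1) 0))

theorem continuous_abpG {z : Spc m × ℝ → ℝ} (hz : Continuous z) : Continuous (abpG z) := by
  unfold abpG; fun_prop

theorem continuous_abpSlice {z : Spc m × ℝ → ℝ} (hz : Continuous z) : Continuous (abpSlice z) := by
  have hG := continuous_abpG hz
  refine IsCompact.continuous_sSup (f := fun (p : Spc m × ℝ) x => abpG z (x, p.2) - inner ℝ p.1 x)
    (isCompact_closedBall _ _) ?_
  simp only [Function.HasUncurry.uncurry]
  fun_prop

theorem continuous_abpRun {z : Spc m × ℝ → ℝ} (hz : Continuous z) : Continuous (abpRun z) := by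
  have hG := continuous_abpG hz
  refine IsCompact.continuous_sSup
    (f := fun (p q : Spc m × ℝ) => abpG z (q.1, min q.2 p.2) - inner ℝ p.1 q.1)
    ((isCompact_closedBall _ _).prod isCompact_Icc) ?_
  simp only [Function.HasUncurry.uncurry]
  fun_prop

theorem abpSlice_spec {z : Spc m × ℝ → ℝ} (hz : Continuous z) (p : Spc m × ℝ) :
    (∃ x ∈ closedBall (0 : Spc m) 1, abpSlice z p = abpG z (x, p.2) - inner ℝ p.1 x) ∧
    ∀ x ∈ closedBall (0 : Spc m) 1, abpG z (x, p.2) - inner ℝ p.1 x ≤ abpSlice z p := by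
  have hG := continuous_abpG hz
  have hK := (isCompact_closedBall (0 : Spc m) 1).image
    (f := fun x => abpG z (x, p.2) - inner ℝ p.1 x) (by fun_prop)
  have hne : ((fun x => abpG z (x, p.2) - inner ℝ p.1 x) '' closedBall 0 1).Nonempty :=
    ⟨_, 0, mem_closedBall_self zero_le_one, rfl⟩
  constructor
  · obtain ⟨x, hx, h⟩ := hK.sSup_mem hne
    exact ⟨x, hx, h.symm⟩
  · intro x hx
    exact le_csSup hK.bddAbove ⟨x, hx, rfl⟩

theorem abpRun_spec {z : Spc m × ℝ → ℝ} (hz : Continuous z) (y : Spc m) {t : ℝ}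
    (ht : t ∈ Icc (-1 : ℝ) 0) :
    (∃ s ∈ Icc (-1) t, abpRun z (y, t) = abpSlice z (y, s)) ∧
    ∀ s ∈ Icc (-1) t, abpSlice z (y, s) ≤ abpRun z (y, t) := by
  have hG := continuous_abpG hz
  have hK := ((isCompact_closedBall (0 : Spc m) 1).prod (isCompact_Icc (a := (-1 : ℝ)) (b := 0))).image
    (f := fun q : Spc m × ℝ => abpG z (q.1, min q.2 t) - inner ℝ y q.1) (by fun_prop)
  have hne : ((fun q : Spc m × ℝ => abpG z (q.1, min q.2 t) - inner ℝ y q.1) ''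
    (closedBall 0 1 ×ˢ Icc (-1) 0)).Nonempty :=
    ⟨_, (0, 0), ⟨mem_closedBall_self zero_le_one, by norm_num, le_rfl⟩, rfl⟩
  have hub : ∀ s ∈ Icc (-1) t, abpSlice z (y, s) ≤ abpRun z (y, t) := by
    intro s hs
    obtain ⟨x, hx, h⟩ := (abpSlice_spec hz (y, s)).1
    rw [h]
    refine le_csSup hK.bddAbove ⟨(x, s), ⟨hx, hs.1, hs.2.trans ht.2⟩, ?_⟩
    simp [min_eq_left hs.2]
  refine ⟨?_, hub⟩
  obtain ⟨q, hq, h⟩ := hK.sSup_mem hne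
  have hs : min q.2 t ∈ Icc (-1) t := ⟨le_min hq.2.1 ht.1, min_le_right _ _⟩
  refine ⟨min q.2 t, hs, le_antisymm ?_ (hub _ hs)⟩
  have := (abpSlice_spec hz (y, min q.2 t)).2 q.1 hq.1
  exact le_trans (le_of_eq h.symm) this

theorem abpRun_mono {z : Spc m × ℝ → ℝ} (hz : Continuous z) (y : Spc m) :
    MonotoneOn (fun t => abpRun z (y, t)) (Icc (-1) 0) := by
  intro s hs t ht hst
  obtain ⟨r, hr, h⟩ := (abpRun_spec hz y hs).1
  simp only [h]
  exact (abpRun_spec hz y ht).2 r ⟨hr.1, hr.2.trans hst⟩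

theorem hs_linear (y : Spc m) (x : Spc m) (i j : Fin (m + 1)) :
    hs (fun x : Spc m => inner ℝ y x) x i j = 0 := by
  unfold hs
  have h : (fun x' => fderiv ℝ (fun x : Spc m => inner ℝ y x) x' (eVec m j))
      = fun _ => innerSL ℝ y (eVec m j) := by
    funext x'
    exact congrArg (fun L => L (eVec m j)) (innerSL ℝ y).fderiv
  rw [h]
  simp

/-- Properties of a contact point in the parabolic ABP argument. -/
theorem abp_contact (hlam : 0 < lam) (hA : IsElliptic lam Lam A) (hLam : 0 ≤ Lam)
    {z : Spc m × ℝ → ℝ}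
    (hz : Continuous z) (hz1 : ∀ p ∈ closedBall (0 : Spc m) 1 ×ˢ Icc (-1 : ℝ) 0, z p ≤ 1)
    (hsub : ∀ p ∈ ball (0 : Spc m) 1 ×ˢ Ioo (-1 : ℝ) 0, 0 < z p → SubAt A z p)
    {y : Spc m} {t : ℝ} (hy : ‖y‖ < 1 / 8) (ht : t ∈ Ioo (-1 : ℝ) 0)
    (hm : abpSlice z (y, t) = abpRun z (y, t)) (hpos : 1 / 8 < abpSlice z (y, t)) :
    ∃ x ∈ ball (0 : Spc m) 1, 0 < z (x, t) ∧
      abpSlice z (y, t) = abpG z (x, t) - inner ℝ y x ∧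
      (∀ v, fderiv ℝ (fun x => z (x, t) - ‖x‖ ^ 2) x v = inner ℝ y v) ∧
      (∀ i j, |hs (fun x => z (x, t) - ‖x‖ ^ 2) x i j| ≤ (1 + 2 * (m + 1) * Lam) / lam) ∧
      ∃ d, HasDerivAt (fun s => abpG z (x, s)) d t ∧ d ≤ 1 + 2 * (m + 1) * Lam := by
  obtain ⟨⟨x, hx, hxm⟩, hle⟩ := abpSlice_spec hz (y, t)
  have hx1 : ‖x‖ ≤ 1 := by simpa using hx
  have hin : |inner ℝ y x| ≤ 1 / 8 := by
    refine (abs_real_inner_le_norm y x).trans ?_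
    nlinarith [norm_nonneg y, norm_nonneg x]
  have hin' := abs_le.1 hin
  have hG : 0 < abpG z (x, t) := by simp only at hxm; linarith
  have hzp : ‖x‖ ^ 2 - t < z (x, t) := by unfold abpG at hG; simp only at hG; linarith
  have hz0 : 0 < z (x, t) := by nlinarith [ht.2, sq_nonneg ‖x‖]
  have hxb : x ∈ ball (0 : Spc m) 1 := by
    rw [mem_ball_zero_iff]
    rcases eq_or_lt_of_le hx1 with h | h
    · have := hz1 (x, t) ⟨hx, ht.1.le, ht.2.le⟩
      rw [h] at hzp
      linarith [ht.2]
    · exact h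
  obtain ⟨hc, d, hd, hdle⟩ := hsub (x, t) ⟨hxb, ht⟩ hz0
  simp only at hc hd hdle
  set f0 : Spc m → ℝ := fun x => z (x, t) - ‖x‖ ^ 2 with hf0
  have hcN : ∀ x : Spc m, ContDiffAt ℝ 2 (fun x : Spc m => ‖x‖ ^ 2) x := fun x =>
    (contDiff_norm_sq ℝ).contDiffAt
  have hcin : ContDiffAt ℝ 2 (fun x : Spc m => inner ℝ y x) x := (innerSL ℝ y).contDiff.contDiffAt
  have hcf0 : ContDiffAt ℝ 2 f0 x := hc.sub (hcN x)
  set F : Spc m → ℝ := fun x => (-1) * f0 x + inner ℝ y x with hF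
  have hcF : ContDiffAt ℝ 2 F x := (contDiffAt_const.mul hcf0).add hcin
  have hmin : IsLocalMin F x := by
    filter_upwards [isOpen_ball.mem_nhds hxb] with x' hx'
    have := hle x' (ball_subset_closedBall hx')
    rw [hxm] at this
    simp only [abpG] at this
    simp only [hF, hf0]
    linarith
  have hsF : ∀ i j, hs F x i j = - hs f0 x i j := by
    intro i j
    rw [hF, hs_add (contDiffAt_const.mul hcf0) hcin, hs_const_mul hcf0, hs_linear]
    ring
  have hsum : ∑ i, hs F x i i ≤ (1 + 2 * (m + 1) * Lam) / lam ∧ d ≤ 2 * (m + 1) * Lam := by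
    have h1 := LL_ge_of_isLocalMin hA hcF hmin
    have h1' := LL_nonneg_of_isLocalMin hlam hA hcF hmin
    have h2 : LL A F x = LL A (fun x : Spc m => ‖x‖ ^ 2) x - LL A (fun x => z (x, t)) x := by
      have e : ∀ i j, hs F x i j = hs (fun x : Spc m => ‖x‖ ^ 2) x i j - hs (fun x => z (x, t)) x i j := by
        intro i j
        rw [hsF]
        have e0 : f0 = fun x => z (x, t) + (-1) * ‖x‖ ^ 2 := by funext x; simp only [hf0]; ring
        rw [e0, hs_add hc (contDiffAt_const.mul (hcN x)), hs_const_mul (hcN x)]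
        ring
      simp only [LL, e, mul_sub, Finset.sum_sub_distrib]
    have h3 := LL_normSq_le hA x
    have hd0 : -1 ≤ d := by
      have hG' : HasDerivAt (fun s => abpG z (x, s)) (d + 1) t := by
        exact (hd.sub_const (‖x‖ ^ 2)).add (hasDerivAt_id t)
      by_contra hcon
      push Not at hcon
      have hdn : d + 1 < 0 := by linarith
      have hev : ∀ᶠ s in 𝓝[<] t, abpG z (x, t) < abpG z (x, s) := by
        have h5 := (hasDerivAt_iff_tendsto_slope_left_right.1 hG').1.eventually (gt_mem_nhds hdn)
        filter_upwards [h5, self_mem_nhdsWithin] with s hs1 hs2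
        have hs2' : s < t := hs2
        rw [slope_def_field, div_lt_iff_of_neg (by linarith)] at hs1
        linarith
      have hev2 : ∀ᶠ s in 𝓝[<] t, s ∈ Ioo (-1) t := Ioo_mem_nhdsLT ht.1
      obtain ⟨s, hs1, hs2⟩ := (hev.and hev2).exists
      have h6 := (abpSlice_spec hz (y, s)).2 x hx
      have h7 := (abpRun_spec hz y ⟨ht.1.le, ht.2.le⟩).2 s ⟨hs2.1.le, hs2.2.le⟩
      rw [← hm, hxm] at h7
      simp only at h6 h7
      linarith
    constructor
    · rw [le_div_iff₀ hlam]
      linarith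
    · linarith
  refine ⟨x, hxb, hz0, hxm, ?_, ?_, ?_⟩
  · intro v
    have h0 := hmin.fderiv_eq_zero
    have hdf0 : HasFDerivAt f0 (fderiv ℝ f0 x) x := (hcf0.differentiableAt (by norm_num)).hasFDerivAt
    have h1 := (hdf0.const_mul (-1)).add (innerSL ℝ y).hasFDerivAt
    have h2 : fderiv ℝ F x = _ := h1.fderiv
    rw [h2] at h0
    have h3 := congrArg (fun L => L v) h0
    simp at h3
    linarith
  · intro i j
    have := abs_hs_le_of_isLocalMin hcF hmin i j
    rw [hsF, abs_neg] at this
    exact this.trans hsum.1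
  · refine ⟨d + 1, ?_, by linarith [hsum.2]⟩
    exact (hd.sub_const (‖x‖ ^ 2)).add (hasDerivAt_id t)

theorem det_gradient_bound {f : Spc m → ℝ} {x : Spc m} (hf : ContDiffAt ℝ 2 f x) {b : ℝ}
    (hb : ∀ i j, |hs f x i j| ≤ b)
    {Φ : Spc m →L[ℝ] Spc m} (hΦ : ∀ v w, inner ℝ (Φ v) w = fderiv ℝ (fderiv ℝ f) x v w) :
    |Φ.det| ≤ (m + 1).factorial * b ^ (m + 1) := by
  set B := (EuclideanSpace.basisFun (Fin (m + 1)) ℝ).toBasis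
  have h1 : Φ.det = (LinearMap.toMatrix B B (Φ : Spc m →ₗ[ℝ] Spc m)).det := by
    rw [LinearMap.det_toMatrix]
  have h2 : ∀ i j, LinearMap.toMatrix B B (Φ : Spc m →ₗ[ℝ] Spc m) i j = hs f x j i := by
    intro i j
    rw [hs_eq hf, ← hΦ, LinearMap.toMatrix_apply]
    simp [B, eVec, EuclideanSpace.inner_single_right]
  rw [h1]
  have := Matrix.det_le (A := LinearMap.toMatrix B B (Φ : Spc m →ₗ[ℝ] Spc m))
    (abv := AbsoluteValue.abs) (x := b) (fun i j => by rw [h2]; exact hb j i)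
  simpa using this

end ABP

section ABP

open Filter Topology Set MeasureTheory Metric

variable {m : ℕ} {A : Spc m → Matrix (Fin (m + 1)) (Fin (m + 1)) ℝ} {lam Lam : ℝ}

/-- The inverse Riesz map, as a real-linear continuous map. -/
def rieszInv (m : ℕ) : StrongDual ℝ (Spc m) →L[ℝ] Spc m :=
  LinearMap.toContinuousLinearMap
    { toFun := (InnerProductSpace.toDual ℝ (Spc m)).symm
      map_add' := map_add _
      map_smul' := fun c L => by simp }

theorem inner_rieszInv {m : ℕ} (L : StrongDual ℝ (Spc m)) (w : Spc m) :
    inner ℝ (rieszInv m L) w = L w :=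
  InnerProductSpace.toDual_symm_apply

def abpSet (z : Spc m × ℝ → ℝ) : Set (Spc m × ℝ) :=
  {p | p ∈ ball (0 : Spc m) (1 / 8) ×ˢ Ioo (-1 : ℝ) 0 ∧ abpSlice z p = abpRun z p ∧
    1 / 8 < abpSlice z p}

theorem measurableSet_abpSet {z : Spc m × ℝ → ℝ} (hz : Continuous z) :
    MeasurableSet (abpSet z) := by
  have h1 := continuous_abpSlice hz
  have h2 := continuous_abpRun hz
  exact ((isOpen_ball.prod isOpen_Ioo).measurableSet).inter
    ((isClosed_eq h1 h2).measurableSet.inter (isOpen_lt continuous_const h1).measurableSet)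

theorem abp_slice_measure (hlam : 0 < lam) (hA : IsElliptic lam Lam A) (hLam : 0 ≤ Lam)
    {z : Spc m × ℝ → ℝ}
    (hz : Continuous z) (hz1 : ∀ p ∈ closedBall (0 : Spc m) 1 ×ˢ Icc (-1 : ℝ) 0, z p ≤ 1)
    (hsub : ∀ p ∈ ball (0 : Spc m) 1 ×ˢ Ioo (-1 : ℝ) 0, 0 < z p → SubAt A z p) (t : ℝ) :
    volume {y | (y, t) ∈ abpSet z} ≤
      ENNReal.ofReal ((m + 1).factorial * ((1 + 2 * (m + 1) * Lam) / lam) ^ (m + 1) + 1) *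
        volume {x | (x, t) ∈ {p ∈ ball (0 : Spc m) 1 ×ˢ Ioo (-1 : ℝ) 0 | 0 < z p}} := by
  by_cases ht : t ∈ Ioo (-1 : ℝ) 0
  swap
  · have : {y | (y, t) ∈ abpSet z} = ∅ := by
      ext y; simp only [mem_ofPred_eq, mem_empty_iff_false, iff_false]
      exact fun h => ht h.1.2
    rw [this]; simp
  set D : ℝ := (m + 1).factorial * ((1 + 2 * (m + 1) * Lam) / lam) ^ (m + 1) with hD
  set f0 : Spc m → ℝ := fun x => z (x, t) - ‖x‖ ^ 2 with hf0
  set J : StrongDual ℝ (Spc m) →L[ℝ] Spc m := rieszInv m with hJ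
  have hJi : ∀ (L : StrongDual ℝ (Spc m)) (w : Spc m), inner ℝ (J L) w = L w :=
    inner_rieszInv
  set Φ : Spc m → Spc m := fun x => J (fderiv ℝ f0 x) with hΦ
  set Φ' : Spc m → Spc m →L[ℝ] Spc m := fun x => J.comp (fderiv ℝ (fderiv ℝ f0) x) with hΦ'
  set U : Set (Spc m) := {x | (x, t) ∈ {p ∈ ball (0 : Spc m) 1 ×ˢ Ioo (-1 : ℝ) 0 | 0 < z p}} with hU
  have hUo : IsOpen U := by
    have h1 : IsOpen {p ∈ ball (0 : Spc m) 1 ×ˢ Ioo (-1 : ℝ) 0 | 0 < z p} :=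
      (isOpen_ball.prod isOpen_Ioo).inter (isOpen_lt continuous_const hz)
    exact h1.preimage (by fun_prop : Continuous fun x : Spc m => (x, t))
  have hC2 : ∀ x ∈ U, ContDiffAt ℝ 2 f0 x := by
    intro x hx
    exact (hsub (x, t) hx.1 hx.2).1.sub (contDiff_norm_sq ℝ).contDiffAt
  have hder : ∀ x ∈ U, HasFDerivAt Φ (Φ' x) x := fun x hx =>
    J.hasFDerivAt.comp x (hC2 x hx).differentiableAt_fderiv_two.hasFDerivAt
  have hcont : ContinuousOn (fun x => |(Φ' x).det|) U := by
    intro x hx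
    have h1 : ContinuousAt (fderiv ℝ (fderiv ℝ f0)) x :=
      ((((hC2 x hx).fderiv_right (m := 1) (by norm_num)).fderiv_right (m := 0)
        (by norm_num))).continuousAt
    have h2 : ContinuousAt Φ' x := (continuous_const.clm_comp continuous_id).continuousAt.comp h1
    exact ((ContinuousLinearMap.continuous_det.continuousAt.comp h2).abs).continuousWithinAt
  set V : Set (Spc m) := U ∩ {x | |(Φ' x).det| < D + 1} with hV
  have hVo : IsOpen V := hcont.isOpen_inter_preimage hUo isOpen_Iio
  have hsubset : {y | (y, t) ∈ abpSet z} ⊆ Φ '' V := by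
    intro y hy
    obtain ⟨hy1, hy2, hy3⟩ := hy
    have hyn : ‖y‖ < 1 / 8 := by simpa using hy1.1
    obtain ⟨x, hxb, hz0, -, hgrad, hH, -⟩ :=
      abp_contact hlam hA hLam hz hz1 hsub hyn ht hy2 hy3
    have hxU : x ∈ U := ⟨⟨hxb, ht⟩, hz0⟩
    refine ⟨x, ⟨hxU, ?_⟩, ?_⟩
    · have := det_gradient_bound (hC2 x hxU) hH (Φ := Φ' x) (fun v w => hJi _ _)
      exact lt_of_le_of_lt this (by simp [hD])
    · refine ext_inner_right ℝ fun w => ?_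
      rw [hJi]; exact hgrad w
  calc volume {y | (y, t) ∈ abpSet z} ≤ volume (Φ '' V) := measure_mono hsubset
    _ ≤ ∫⁻ x in V, ENNReal.ofReal |(Φ' x).det| :=
      addHaar_image_le_lintegral_abs_det_fderiv _ hVo.measurableSet
        fun x hx => (hder x hx.1).hasFDerivWithinAt
    _ ≤ ∫⁻ x in V, ENNReal.ofReal (D + 1) := by
      refine setLIntegral_mono measurable_const fun x hx => ?_
      exact ENNReal.ofReal_le_ofReal hx.2.le
    _ = ENNReal.ofReal (D + 1) * volume V := by simp
    _ ≤ _ := mul_le_mul' le_rfl (measure_mono inter_subset_left)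

theorem abp_time_measure (hlam : 0 < lam) (hA : IsElliptic lam Lam A) (hLam : 0 ≤ Lam)
    {z : Spc m × ℝ → ℝ}
    (hz : Continuous z) (hz1 : ∀ p ∈ closedBall (0 : Spc m) 1 ×ˢ Icc (-1 : ℝ) 0, z p ≤ 1)
    (hsub : ∀ p ∈ ball (0 : Spc m) 1 ×ˢ Ioo (-1 : ℝ) 0, 0 < z p → SubAt A z p)
    (h0 : 1 / 2 < z (0, 0)) {y : Spc m} (hy : y ∈ ball (0 : Spc m) (1 / 8)) :
    ENNReal.ofReal ((1 / 2 - 1 / 8) / (2 + 2 * (m + 1) * Lam)) ≤ volume {t | (y, t) ∈ abpSet z} := by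
  have hyn : ‖y‖ < 1 / 8 := by simpa using hy
  have hpos : 0 ≤ 2 * ((m : ℝ) + 1) * Lam := by positivity
  have hM0 := abpRun_mono hz y
  have hcr := continuous_abpRun hz
  refine volume_contact_times_ge (M := fun t => abpRun z (y, t)) (by fun_prop) hM0 (by linarith)
    ?_ ?_ (fun t ht => ht.1.2) ?_ ?_
  · obtain ⟨s, hs, h⟩ := (abpRun_spec hz y (t := -1) (by norm_num)).1
    have hs1 : s = -1 := le_antisymm hs.2 hs.1
    simp only [h]
    obtain ⟨x, hx, hx2⟩ := (abpSlice_spec hz (y, s)).1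
    rw [hx2, hs1]
    have h3 := hz1 (x, -1) ⟨hx, by norm_num⟩
    have hx1 : ‖x‖ ≤ 1 := by simpa using hx
    have hin : |inner ℝ y x| ≤ 1 / 8 := by
      refine (abs_real_inner_le_norm y x).trans ?_
      nlinarith [norm_nonneg y, norm_nonneg x]
    have := (abs_le.1 hin).1
    simp only [abpG]
    nlinarith [sq_nonneg ‖x‖]
  · have h1 := (abpRun_spec hz y (t := 0) (by norm_num)).2 0 (by norm_num)
    have h2 := (abpSlice_spec hz (y, 0)).2 0 (mem_closedBall_self zero_le_one)
    simp [abpG] at h2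
    have : (1 : ℝ) / 2 = 2⁻¹ := by norm_num
    linarith
  · intro t ht hgt hlt
    obtain ⟨s, hs, h⟩ := (abpRun_spec hz y ⟨ht.1.le, ht.2.le⟩).1
    have hst : s = t := by
      rcases eq_or_lt_of_le hs.2 with h' | h'
      · exact h'
      · have h1 := hlt s ⟨hs.1, h'⟩
        have h2 := (abpRun_spec hz y (t := s) ⟨hs.1, hs.2.trans ht.2.le⟩).2 s ⟨hs.1, le_rfl⟩
        simp only [h] at h1
        linarith
    rw [hst] at h
    exact ⟨⟨hy, ht⟩, h.symm, by rw [← h]; exact hgt⟩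
  · intro t ht hgt σ hσ
    obtain ⟨x, hxb, hz0, hval, -, -, d, hd, hdle⟩ :=
      abp_contact hlam hA hLam hz hz1 hsub hyn ht.1.2 ht.2.1 ht.2.2
    have h5 := (hasDerivAt_iff_tendsto_slope_left_right.1 hd).1.eventually
      (gt_mem_nhds (show d < 2 + 2 * (m + 1) * Lam by linarith))
    have hev2 : ∀ᶠ s in 𝓝[<] t, s ∈ Ioo σ t := Ioo_mem_nhdsLT hσ.2
    obtain ⟨s, hs1, hs2⟩ := (h5.and hev2).exists
    refine ⟨s, ⟨hs2.1.le, hs2.2⟩, ?_⟩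
    rw [slope_def_field, div_lt_iff_of_neg (by linarith [hs2.2])] at hs1
    have h6 := (abpSlice_spec hz (y, s)).2 x (ball_subset_closedBall hxb)
    have hsI : s ∈ Icc (-1 : ℝ) 0 := ⟨hσ.1.trans hs2.1.le, hs2.2.le.trans ht.1.2.2.le⟩
    have h7 := (abpRun_spec hz y hsI).2 s ⟨hsI.1, le_rfl⟩
    rw [← ht.2.1, hval]
    simp only at h6 h7
    linarith

/-- The parabolic Alexandrov–Bakelman–Pucci–Krylov measure estimate on the unit cylinder. -/
theorem abp_unit (m : ℕ) {lam Lam : ℝ} (hlam : 0 < lam) (hLam : 0 ≤ Lam) :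
    ∃ ε > 0, ∀ A : Spc m → Matrix (Fin (m + 1)) (Fin (m + 1)) ℝ, IsElliptic lam Lam A →
    ∀ z : Spc m × ℝ → ℝ, Continuous z →
    (∀ p ∈ closedBall (0 : Spc m) 1 ×ˢ Icc (-1 : ℝ) 0, z p ≤ 1) →
    (∀ p ∈ ball (0 : Spc m) 1 ×ˢ Ioo (-1 : ℝ) 0, 0 < z p → SubAt A z p) → 1 / 2 < z (0, 0) →
    ENNReal.ofReal ε ≤ volume {p ∈ ball (0 : Spc m) 1 ×ˢ Ioo (-1 : ℝ) 0 | 0 < z p} := by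
  set c : ℝ := (1 / 2 - 1 / 8) / (2 + 2 * (m + 1) * Lam) with hc
  set D : ℝ := (m + 1).factorial * ((1 + 2 * (m + 1) * Lam) / lam) ^ (m + 1) + 1 with hD
  have hcpos : 0 < c := by
    have : 0 ≤ 2 * ((m : ℝ) + 1) * Lam := by positivity
    rw [hc]; apply div_pos <;> linarith
  have hDpos : 0 < D := by positivity
  set b := (volume (ball (0 : Spc m) (1 / 8))).toReal with hb
  have hb0 : 0 < b := ENNReal.toReal_pos (measure_ball_pos _ _ (by norm_num)).ne'
    measure_ball_lt_top.ne
  refine ⟨c * b / D, by positivity, ?_⟩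
  intro A hA z hz hz1 hsub h0
  set P := {p ∈ ball (0 : Spc m) 1 ×ˢ Ioo (-1 : ℝ) 0 | 0 < z p} with hP
  have hPm : MeasurableSet P :=
    ((isOpen_ball.prod isOpen_Ioo).inter (isOpen_lt continuous_const hz)).measurableSet
  have hSm := measurableSet_abpSet hz
  have hlow : ENNReal.ofReal (c * b) ≤ volume (abpSet z) := by
    rw [Measure.volume_eq_prod, Measure.prod_apply hSm]
    calc ENNReal.ofReal (c * b)
        = ∫⁻ _ in ball (0 : Spc m) (1 / 8), ENNReal.ofReal c := by
          rw [setLIntegral_const, ENNReal.ofReal_mul hcpos.le, hb,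
            ENNReal.ofReal_toReal measure_ball_lt_top.ne]
      _ ≤ ∫⁻ y in ball (0 : Spc m) (1 / 8), volume (Prod.mk y ⁻¹' abpSet z) :=
          setLIntegral_mono' measurableSet_ball fun y hy =>
            abp_time_measure hlam hA hLam hz hz1 hsub h0 hy
      _ ≤ _ := setLIntegral_le_lintegral _ _
  have hup : volume (abpSet z) ≤ ENNReal.ofReal D * volume P := by
    rw [Measure.volume_eq_prod, Measure.prod_apply_symm hSm, Measure.prod_apply_symm hPm,
      ← lintegral_const_mul' _ _ ENNReal.ofReal_ne_top]
    exact lintegral_mono fun t => abp_slice_measure hlam hA hLam hz hz1 hsub t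
  rw [ENNReal.ofReal_div_of_pos hDpos]
  refine ENNReal.div_le_of_le_mul ?_
  exact (hlow.trans hup).trans_eq (mul_comm _ _)

theorem volume_preimage_pscale (x0 : Spc m) (t0 : ℝ) {r : ℝ} (hr : 0 < r) (s : Set (Spc m × ℝ))
    (hs : MeasurableSet s) :
    volume s = ENNReal.ofReal (r ^ (m + 3)) * volume (pscale x0 t0 r ⁻¹' s) := by
  have hm : Measurable (pscale x0 t0 r) := (continuous_pscale x0 t0 r).measurable
  have h1 : ∀ (t : Set (Spc m)), volume ((fun y : Spc m => x0 + r • y) ⁻¹' t)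
      = ENNReal.ofReal ((r ^ (m + 1))⁻¹) * volume t := by
    intro t
    have : (fun y : Spc m => x0 + r • y) ⁻¹' t
        = (fun y : Spc m => r • y) ⁻¹' ((fun y => x0 + y) ⁻¹' t) := rfl
    rw [this, Measure.addHaar_preimage_smul _ hr.ne', measure_preimage_add]
    simp [abs_of_pos hr]
  have h2 : ∀ (t : Set ℝ), volume ((fun y : ℝ => t0 + r ^ 2 * y) ⁻¹' t)
      = ENNReal.ofReal ((r ^ 2)⁻¹) * volume t := by
    intro t
    have : (fun y : ℝ => t0 + r ^ 2 * y) ⁻¹' t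
        = (fun y : ℝ => r ^ 2 • y) ⁻¹' ((fun y => t0 + y) ⁻¹' t) := rfl
    rw [this, Measure.addHaar_preimage_smul _ (by positivity), measure_preimage_add]
    simp
  have h3 : volume (pscale x0 t0 r ⁻¹' s) =
      ENNReal.ofReal ((r ^ (m + 1))⁻¹) * (ENNReal.ofReal ((r ^ 2)⁻¹) * volume s) := by
    have e1 : volume (pscale x0 t0 r ⁻¹' s)
        = ∫⁻ x, ENNReal.ofReal ((r ^ 2)⁻¹) * volume (Prod.mk (x0 + r • x) ⁻¹' s) := by
      rw [Measure.volume_eq_prod, Measure.prod_apply (hm hs)]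
      refine lintegral_congr fun x => ?_
      rw [← h2]; rfl
    rw [e1, lintegral_const_mul' _ _ ENNReal.ofReal_ne_top]
    have e2 : ∫⁻ x, volume (Prod.mk (x0 + r • x) ⁻¹' s)
        = ENNReal.ofReal ((r ^ (m + 1))⁻¹) * ∫⁻ x, volume (Prod.mk x ⁻¹' s) := by
      have hmeas : Measure.map (fun y : Spc m => x0 + r • y) volume
          = ENNReal.ofReal ((r ^ (m + 1))⁻¹) • (volume : Measure (Spc m)) := by
        ext t ht
        rw [Measure.map_apply (by fun_prop) ht, h1]; rfl
      have hmf : Measurable fun x => volume (Prod.mk x ⁻¹' s) := measurable_measure_prodMk_left hs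
      rw [← lintegral_map (f := fun x => volume (Prod.mk x ⁻¹' s)) hmf (by fun_prop), hmeas,
        lintegral_smul_measure]
      rfl
    rw [e2, Measure.volume_eq_prod, Measure.prod_apply hs]
    ring
  rw [h3, ← mul_assoc, ← mul_assoc, ← ENNReal.ofReal_mul (by positivity),
    ← ENNReal.ofReal_mul (by positivity)]
  have : r ^ (m + 3) * (r ^ (m + 1))⁻¹ * (r ^ 2)⁻¹ = 1 := by
    field_simp
    try ring
  rw [this]; simp

/-- Open backward parabolic cylinder. -/
def pcyl (x : Spc m) (t r : ℝ) : Set (Spc m × ℝ) := ball x r ×ˢ Ioo (t - r ^ 2) t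

/-- Closed backward parabolic cylinder. -/
def pcylc (x : Spc m) (t r : ℝ) : Set (Spc m × ℝ) := closedBall x r ×ˢ Icc (t - r ^ 2) t

theorem isOpen_pcyl (x : Spc m) (t r : ℝ) : IsOpen (pcyl x t r) := isOpen_ball.prod isOpen_Ioo

theorem isCompact_pcylc (x : Spc m) (t r : ℝ) : IsCompact (pcylc x t r) :=
  (isCompact_closedBall _ _).prod isCompact_Icc

theorem pcyl_subset_pcylc (x : Spc m) (t r : ℝ) : pcyl x t r ⊆ pcylc x t r :=
  prod_mono ball_subset_closedBall Ioo_subset_Icc_self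

theorem pscale_mem_pcyl {x : Spc m} {t r : ℝ} (hr : 0 < r) (p : Spc m × ℝ) :
    pscale x t r p ∈ pcyl x t r ↔ p ∈ ball (0 : Spc m) 1 ×ˢ Ioo (-1 : ℝ) 0 := by
  have h2 : 0 < r ^ 2 := by positivity
  simp only [pscale, pcyl, mem_prod, mem_ball, dist_self_add_left, norm_smul, Real.norm_eq_abs,
    abs_of_pos hr, dist_zero_right, mem_Ioo]
  constructor
  · rintro ⟨h, h3, h4⟩
    exact ⟨by nlinarith [norm_nonneg p.1], by nlinarith, by nlinarith⟩
  · rintro ⟨h, h3, h4⟩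
    exact ⟨by nlinarith, by nlinarith, by nlinarith⟩

theorem pscale_mem_pcylc {x : Spc m} {t r : ℝ} (hr : 0 < r) (p : Spc m × ℝ) :
    pscale x t r p ∈ pcylc x t r ↔ p ∈ closedBall (0 : Spc m) 1 ×ˢ Icc (-1 : ℝ) 0 := by
  have h2 : 0 < r ^ 2 := by positivity
  simp only [pscale, pcylc, mem_prod, mem_closedBall, dist_self_add_left, norm_smul,
    Real.norm_eq_abs, abs_of_pos hr, dist_zero_right, mem_Icc]
  constructor
  · rintro ⟨h, h3, h4⟩
    exact ⟨by nlinarith [norm_nonneg p.1], by nlinarith, by nlinarith⟩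
  · rintro ⟨h, h3, h4⟩
    exact ⟨by nlinarith, by nlinarith, by nlinarith⟩

/-- Constant of the measure estimate. -/
theorem abp_estimate (m : ℕ) {lam Lam : ℝ} (hlam : 0 < lam) (hLam : 0 ≤ Lam) :
    ∃ ε > 0, ∀ A : Spc m → Matrix (Fin (m + 1)) (Fin (m + 1)) ℝ, IsElliptic lam Lam A →
    ∀ (z : Spc m × ℝ → ℝ) (x : Spc m) (t r M : ℝ), 0 < r → 0 < M → ContinuousOn z (pcylc x t r) →
    (∀ p ∈ pcylc x t r, z p ≤ M) →
    (∀ p ∈ pcyl x t r, 0 < z p → SubAt A z p) → M / 2 < z (x, t) →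
    ENNReal.ofReal (ε * r ^ (m + 3)) ≤ volume {p ∈ pcyl x t r | 0 < z p} := by
  obtain ⟨ε, hε, H⟩ := abp_unit m hlam hLam
  refine ⟨ε, hε, ?_⟩
  intro A hA z x t r M hr hM hz hzM hsub hzx
  obtain ⟨F, hF⟩ := ContinuousMap.exists_restrict_eq (isCompact_pcylc x t r).isClosed
    ⟨(pcylc x t r).domRestrict z, hz.domRestrict⟩
  have hFz : ∀ p ∈ pcylc x t r, F p = z p := fun p hp => by
    exact DFunLike.congr_fun hF ⟨p, hp⟩
  have hxt : (x, t) ∈ pcylc x t r := ⟨mem_closedBall_self hr.le, by constructor <;> nlinarith⟩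
  have hev : ∀ p ∈ pcyl x t r, (F : Spc m × ℝ → ℝ) =ᶠ[𝓝 p] z := fun p hp => by
    filter_upwards [(isOpen_pcyl x t r).mem_nhds hp] with q hq
    exact hFz q (pcyl_subset_pcylc x t r hq)
  have key := H _ (hA.rescale x r) (fun p => M⁻¹ * F (pscale x t r p)) (by
      have := continuous_pscale x t r
      fun_prop) (fun p hp => by
      have h1 := (pscale_mem_pcylc (x := x) (t := t) hr p).2 hp
      change M⁻¹ * F (pscale x t r p) ≤ 1
      rw [hFz _ h1, inv_mul_le_iff₀ hM, mul_one]
      exact hzM _ h1) (fun p hp hpos => by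
      have h1 := (pscale_mem_pcyl (x := x) (t := t) hr p).2 hp
      have h2 : 0 < z (pscale x t r p) := by
        rw [← hFz _ (pcyl_subset_pcylc _ _ _ h1)]
        exact pos_of_mul_pos_right hpos (by positivity)
      have h3 : SubAt A F (pscale x t r p) := (hsub _ h1 h2).congr_nhds (hev _ h1)
      obtain ⟨hc, d, hd, hle⟩ := h3.rescale
      refine ⟨contDiffAt_const.mul hc, M⁻¹ * d, hd.const_mul _, ?_⟩
      rw [LL_const_mul hc]
      exact mul_le_mul_of_nonneg_left hle (by positivity)) (by
      have : pscale x t r (0, 0) = (x, t) := by simp [pscale]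
      simp only [this, hFz _ hxt]
      rw [← div_eq_inv_mul, lt_div_iff₀ hM]
      linarith)
  have hmeas : MeasurableSet {p ∈ pcyl x t r | 0 < F p} :=
    ((isOpen_pcyl x t r).inter (isOpen_lt continuous_const F.continuous)).measurableSet
  have e1 : {p ∈ pcyl x t r | 0 < z p} = {p ∈ pcyl x t r | 0 < F p} := by
    ext p
    simp only [mem_ofPred_eq]
    refine and_congr_right fun hp => ?_
    rw [hFz p (pcyl_subset_pcylc _ _ _ hp)]
  rw [e1, volume_preimage_pscale x t hr _ hmeas, mul_comm, ENNReal.ofReal_mul (by positivity)]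
  refine mul_le_mul' le_rfl (key.trans (measure_mono ?_))
  rintro p ⟨hp1, hp2⟩
  refine ⟨(pscale_mem_pcyl hr p).2 hp1, ?_⟩
  exact pos_of_mul_pos_right hp2 (by positivity)

end ABP

section Barrier

open Filter Topology Set MeasureTheory Metric

variable {m : ℕ} {A : Spc m → Matrix (Fin (m + 1)) (Fin (m + 1)) ℝ} {lam Lam : ℝ}

theorem HasDerivAt.nonpos_of_eventually_left {f : ℝ → ℝ} {d s : ℝ} (hf : HasDerivAt f d s)
    (h : ∀ᶠ τ in 𝓝[<] s, f s ≤ f τ) : d ≤ 0 := by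
  have h1 : Tendsto (slope f s) (𝓝[<] s) (𝓝 d) :=
    (hasDerivAt_iff_tendsto_slope.1 hf).mono_left (nhdsWithin_mono _ fun x hx => ne_of_lt hx)
  refine le_of_tendsto h1 ?_
  filter_upwards [h, self_mem_nhdsWithin] with τ h2 h3
  rw [slope_def_field]
  exact div_nonpos_of_nonneg_of_nonpos (by linarith) (sub_nonpos.2 (le_of_lt h3))

theorem barrier_quadratic_pos {lam κ B q : ℝ} (hlam : 0 < lam) (hκ : B ^ 2 < 32 * lam * κ) :
    0 < κ * q ^ 2 - B * q + 8 * lam := by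
  have hκ0 : 0 < κ := by
    by_contra h
    push Not at h
    nlinarith [sq_nonneg B]
  have : 0 < 4 * κ * (κ * q ^ 2 - B * q + 8 * lam) := by
    nlinarith [sq_nonneg (2 * κ * q - B)]
  exact pos_of_mul_pos_right this (by positivity)

/-- Lower barrier: positivity on the unit ball at time zero spreads into the growing
paraboloid `‖x‖² < 1 + β t`. -/
theorem barrier_unit (hlam : 0 < lam) (hA : IsElliptic lam Lam A)
    {β κ T k : ℝ} (hκ : (2 * β + 4 * (m + 1) * Lam + 8 * lam) ^ 2 < 32 * lam * κ)
    (hβ : 0 ≤ β) (hk : 0 < k)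
    {u : Spc m × ℝ → ℝ}
    (hu : ContinuousOn u {p | 0 ≤ p.2 ∧ p.2 ≤ T ∧ ‖p.1‖ ^ 2 ≤ 1 + β * p.2})
    (hsol : ∀ p : Spc m × ℝ, 0 < p.2 → p.2 ≤ T → ‖p.1‖ ^ 2 ≤ 1 + β * p.2 → SolAt A u p)
    (h0 : ∀ p : Spc m × ℝ, 0 ≤ p.2 → p.2 ≤ T → ‖p.1‖ ^ 2 ≤ 1 + β * p.2 → 0 ≤ u p)
    (hini : ∀ x : Spc m, ‖x‖ ≤ 1 → k ≤ u (x, 0))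
    (p : Spc m × ℝ) (hp0 : 0 ≤ p.2) (hpT : p.2 ≤ T) (hp : ‖p.1‖ ^ 2 ≤ 1 + β * p.2) :
    k * (Real.exp (-κ * p.2) * (1 + β * p.2 - ‖p.1‖ ^ 2) ^ 2) ≤ u p := by
  set S : Set (Spc m × ℝ) := {p | 0 ≤ p.2 ∧ p.2 ≤ T ∧ ‖p.1‖ ^ 2 ≤ 1 + β * p.2} with hS
  have hκ0 : 0 < κ := by
    by_contra h
    push Not at h
    nlinarith [sq_nonneg (2 * β + 4 * (m + 1) * Lam + 8 * lam)]
  have hScl : IsClosed S :=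
    (isClosed_le continuous_const continuous_snd).inter
      ((isClosed_le continuous_snd continuous_const).inter
        (isClosed_le (continuous_fst.norm.pow 2)
          (continuous_const.add (continuous_const.mul continuous_snd))))
  have hSc : IsCompact S := by
    refine ((isCompact_closedBall (0 : Spc m) (1 + β * T)).prod (isCompact_Icc (a := (0 : ℝ))
      (b := T))).of_isClosed_subset hScl ?_
    rintro q ⟨h1, h2, h3⟩
    refine ⟨?_, h1, h2⟩
    rw [mem_closedBall_zero_iff]
    have : β * q.2 ≤ β * T := mul_le_mul_of_nonneg_left h2 hβ
    have h5 : 0 ≤ β * q.2 := mul_nonneg hβ h1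
    nlinarith [norm_nonneg q.1]
  set w : Spc m × ℝ → ℝ := fun q =>
    u q - k * (Real.exp (-κ * q.2) * (1 + β * q.2 - ‖q.1‖ ^ 2) ^ 2) with hw
  have hwc : ContinuousOn w S := hu.sub (by fun_prop)
  obtain ⟨q, hq, hmin⟩ := hSc.exists_isMinOn ⟨p, hp0, hpT, hp⟩ hwc
  have hmin' : ∀ q' ∈ S, w q ≤ w q' := fun q' h => hmin h
  suffices h : 0 ≤ w q by
    have := hmin' p ⟨hp0, hpT, hp⟩
    have h2 : 0 ≤ w p := h.trans this
    simp only [hw] at h2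
    linarith
  by_contra hneg
  push Not at hneg
  obtain ⟨y, s⟩ := q
  obtain ⟨hs0, hsT, hys⟩ := hq
  simp only at hs0 hsT hys
  have hq0 : 0 < 1 + β * s - ‖y‖ ^ 2 := by
    rcases (sub_nonneg.2 hys).eq_or_lt with h | h
    · exfalso
      have := h0 (y, s) hs0 hsT hys
      simp only [hw, ← h] at hneg
      norm_num at hneg
      linarith
    · exact h
  have hspos : 0 < s := by
    rcases hs0.eq_or_lt with h | h
    · exfalso
      subst h
      simp only [mul_zero, add_zero] at hys hq0
      have hy1 : ‖y‖ ≤ 1 := by nlinarith [norm_nonneg y]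
      have := hini y hy1
      simp only [hw, mul_zero, add_zero, Real.exp_zero, one_mul] at hneg
      have h2 : (1 - ‖y‖ ^ 2) ^ 2 ≤ 1 := by nlinarith [sq_nonneg ‖y‖]
      nlinarith
    · exact h
  obtain ⟨hc, hd⟩ := hsol (y, s) hspos hsT hys
  simp only at hc hd
  set e : ℝ := k * Real.exp (-κ * s) with he
  have hepos : 0 < e := by positivity
  have hbar : ContDiff ℝ 2 fun x : Spc m => (1 + β * s - ‖x‖ ^ 2) ^ 2 :=
    (contDiff_const.sub (contDiff_norm_sq ℝ)).pow 2
  have hc2 : ContDiffAt ℝ 2 (fun x => -e * (1 + β * s - ‖x‖ ^ 2) ^ 2) y :=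
    (contDiff_const.mul hbar).contDiffAt
  have hslice : (fun x => w (x, s)) = fun x => u (x, s) + -e * (1 + β * s - ‖x‖ ^ 2) ^ 2 := by
    funext x; simp only [hw, he]; ring
  have hloc : IsLocalMin (fun x => w (x, s)) y := by
    have : ∀ᶠ x in 𝓝 y, 0 < 1 + β * s - ‖x‖ ^ 2 :=
      (continuous_const.sub (continuous_norm.pow 2)).continuousAt.eventually (lt_mem_nhds hq0)
    filter_upwards [this] with x hx
    exact hmin' (x, s) ⟨hspos.le, hsT, by simp only; linarith⟩
  rw [hslice] at hloc
  have hL := LL_nonneg_of_isLocalMin hlam hA (hc.add hc2) hloc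
  rw [LL_add hc hc2, LL_const_mul hbar.contDiffAt] at hL
  have hbge := LL_barrier_ge hA (1 + β * s) y hq0.le
  have hφ : HasDerivAt (fun τ => k * (Real.exp (-κ * τ) * (1 + β * τ - ‖y‖ ^ 2) ^ 2))
      (e * (-κ * (1 + β * s - ‖y‖ ^ 2) ^ 2 + 2 * β * (1 + β * s - ‖y‖ ^ 2))) s := by
    have h1 : HasDerivAt (fun τ => Real.exp (-κ * τ)) (Real.exp (-κ * s) * (-κ)) s := by
      simpa using ((hasDerivAt_id s).const_mul (-κ)).exp
    have h2 : HasDerivAt (fun τ => 1 + β * τ - ‖y‖ ^ 2) β s := by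
      simpa using (((hasDerivAt_id s).const_mul β).const_add 1).sub_const (‖y‖ ^ 2)
    have h3 := (h1.mul (h2.pow 2)).const_mul k
    refine h3.congr_deriv ?_
    simp only [he, Pi.pow_apply]
    ring
  have hle : LL A (fun x => u (x, s)) y -
      e * (-κ * (1 + β * s - ‖y‖ ^ 2) ^ 2 + 2 * β * (1 + β * s - ‖y‖ ^ 2)) ≤ 0 := by
    refine (hd.sub hφ).nonpos_of_eventually_left ?_
    have h1 : ∀ᶠ τ in 𝓝 s, 0 < 1 + β * τ - ‖y‖ ^ 2 :=
      (by fun_prop : Continuous fun τ => 1 + β * τ - ‖y‖ ^ 2).continuousAt.eventually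
        (lt_mem_nhds hq0)
    filter_upwards [nhdsWithin_le_nhds h1, nhdsWithin_le_nhds (lt_mem_nhds hspos),
      self_mem_nhdsWithin] with τ h2 h3 h4
    exact hmin' (y, τ) ⟨h3.le, (le_of_lt h4).trans hsT, by simp only; linarith⟩
  have hquad := barrier_quadratic_pos (q := 1 + β * s - ‖y‖ ^ 2) hlam hκ
  have h8 : e * (8 * lam * ‖y‖ ^ 2 - 4 * (m + 1) * Lam * (1 + β * s - ‖y‖ ^ 2)) ≤
      e * (-κ * (1 + β * s - ‖y‖ ^ 2) ^ 2 + 2 * β * (1 + β * s - ‖y‖ ^ 2)) := by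
    nlinarith
  have h9 := le_of_mul_le_mul_left h8 hepos
  nlinarith [mul_nonneg hβ hs0]

/-- Scaled form of `barrier_unit`. -/
theorem barrier_lower (hlam : 0 < lam) (hA : IsElliptic lam Lam A)
    {β κ T k r t : ℝ} {x : Spc m}
    (hκ : (2 * β + 4 * (m + 1) * Lam + 8 * lam) ^ 2 < 32 * lam * κ)
    (hβ : 0 ≤ β) (hk : 0 < k) (hr : 0 < r)
    {u : Spc m × ℝ → ℝ} {S : Set (Spc m × ℝ)}
    (hS : ∀ y s, 0 ≤ s → s ≤ T → ‖y - x‖ ^ 2 ≤ r ^ 2 + β * s → (y, t + s) ∈ S)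
    (hu : ContinuousOn u S)
    (hsol : ∀ p ∈ S, t < p.2 → SolAt A u p)
    (h0 : ∀ p ∈ S, 0 ≤ u p)
    (hini : ∀ y ∈ closedBall x r, k ≤ u (y, t))
    {y : Spc m} {s : ℝ} (hs0 : 0 ≤ s) (hsT : s ≤ T) (hy : ‖y - x‖ ^ 2 ≤ r ^ 2 + β * s) :
    k * (Real.exp (-κ * (s / r ^ 2)) * ((r ^ 2 + β * s - ‖y - x‖ ^ 2) / r ^ 2) ^ 2) ≤ u (y, t + s) := by
  have hr2 : 0 < r ^ 2 := by positivity
  have hmem : ∀ p : Spc m × ℝ, 0 ≤ p.2 → p.2 ≤ T / r ^ 2 → ‖p.1‖ ^ 2 ≤ 1 + β * p.2 →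
      pscale x t r p ∈ S := by
    intro p h1 h2 h3
    refine hS _ _ (by positivity) (by rw [le_div_iff₀ hr2] at h2; linarith) ?_
    rw [add_sub_cancel_left, norm_smul, Real.norm_eq_abs, mul_pow, sq_abs]
    nlinarith
  have hx : x + r • (r⁻¹ • (y - x)) = y := by
    rw [smul_smul, mul_inv_cancel₀ hr.ne', one_smul, add_sub_cancel]
  have hn : ‖r⁻¹ • (y - x)‖ ^ 2 = ‖y - x‖ ^ 2 / r ^ 2 := by
    rw [norm_smul, Real.norm_eq_abs, mul_pow, sq_abs]; field_simp
  have key := barrier_unit (T := T / r ^ 2) (u := fun p => u (pscale x t r p)) (k := k) hlam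
    (hA.rescale x r) hκ hβ hk
    (hu.comp (continuous_pscale x t r).continuousOn fun p hp => hmem p hp.1 hp.2.1 hp.2.2)
    (fun p h1 h2 h3 => (hsol _ (hmem p h1.le h2 h3) (by
      simp only [pscale]; nlinarith)).rescale)
    (fun p h1 h2 h3 => h0 _ (hmem p h1 h2 h3))
    (fun z hz => by
      have : pscale x t r (z, 0) = (x + r • z, t) := by simp [pscale]
      rw [this]
      refine hini _ ?_
      rw [mem_closedBall, dist_self_add_left, norm_smul, Real.norm_eq_abs, abs_of_pos hr]
      nlinarith)
    (r⁻¹ • (y - x), s / r ^ 2) (by positivity)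
    (div_le_div_of_nonneg_right hsT hr2.le) (by
      simp only [hn]
      rw [div_le_iff₀ hr2]; field_simp; linarith)
  have e1 : pscale x t r (r⁻¹ • (y - x), s / r ^ 2) = (y, t + s) := by
    simp only [pscale, hx]; congr 1; field_simp
  simp only [e1, hn] at key
  refine le_trans (le_of_eq ?_) key
  congr 3
  field_simp

/-- Positive solutions that are large on most of a cylinder are large afterwards. -/
theorem spread (m : ℕ) {lam Lam : ℝ} (hlam : 0 < lam) (hLam : 0 ≤ Lam) :
    ∃ ε > 0, ∃ c > 0, c < 1 ∧ ∀ A : Spc m → Matrix (Fin (m + 1)) (Fin (m + 1)) ℝ,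
    IsElliptic lam Lam A →
    ∀ (Ω : Set (Spc m × ℝ)) (u : Spc m × ℝ → ℝ), ContinuousOn u Ω → (∀ p ∈ Ω, SolAt A u p) →
    (∀ p ∈ Ω, 0 ≤ u p) → ∀ (x : Spc m) (t r k : ℝ), 0 < r → 0 < k →
    closedBall x (5 * r) ×ˢ Icc (t - r ^ 2) (t + 5 * r ^ 2) ⊆ Ω →
    volume {p ∈ pcyl x t r | u p < k} < ENNReal.ofReal (ε * r ^ (m + 3)) →
    (∀ y ∈ closedBall x (r / 2), k / 2 ≤ u (y, t)) ∧
    ∀ y ∈ closedBall x (2 * r), ∀ s ∈ Icc (t + r ^ 2) (t + 5 * r ^ 2), c * k ≤ u (y, s) := by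
  obtain ⟨ε, hε, H⟩ := abp_estimate m hlam hLam
  obtain ⟨κ, hκ⟩ : ∃ κ : ℝ, (2 * 4 + 4 * (m + 1) * Lam + 8 * lam) ^ 2 < 32 * lam * κ := by
    refine ⟨((2 * 4 + 4 * (m + 1) * Lam + 8 * lam) ^ 2 + 1) / (32 * lam), ?_⟩
    field_simp; linarith
  have hκ0 : 0 < κ := by
    by_contra h
    push Not at h
    nlinarith [sq_nonneg (2 * 4 + 4 * (m + 1) * Lam + 8 * lam)]
  refine ⟨ε * (1 / 2) ^ (m + 3), by positivity, 1 / 2 * Real.exp (-κ * 20), by positivity, ?_, ?_⟩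
  · have : Real.exp (-κ * 20) ≤ 1 := Real.exp_le_one_iff.2 (by linarith)
    linarith
  intro A hA Ω u hu hsol h0 x t r k hr hk hΩ hvol
  have hr2 : 0 < r ^ 2 := by positivity
  have hfirst : ∀ y ∈ closedBall x (r / 2), k / 2 ≤ u (y, t) := by
    intro y hy
    by_contra hlt
    push Not at hlt
    have hyx : dist y x ≤ r / 2 := hy
    have hsub : pcylc y t (r / 2) ⊆ Ω := by
      refine Subset.trans ?_ hΩ
      rintro ⟨a, b⟩ ⟨h1, h2, h3⟩
      have h4 : dist a y ≤ r / 2 := h1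
      refine ⟨?_, ?_, ?_⟩
      · exact (dist_triangle a y x).trans (by linarith)
      · simp only at h2 ⊢; nlinarith
      · simp only at h3 ⊢; nlinarith
    have hsub2 : pcyl y t (r / 2) ⊆ pcyl x t r := by
      rintro ⟨a, b⟩ ⟨h1, h2, h3⟩
      have h4 : dist a y < r / 2 := h1
      refine ⟨lt_of_le_of_lt (dist_triangle a y x) (by linarith), ?_, h3⟩
      simp only at h2 ⊢; nlinarith
    have key := H A hA (fun q => -k⁻¹ * u q + 1) y t (r / 2) 1 (by positivity) one_pos
      ((continuousOn_const.mul (hu.mono hsub)).add continuousOn_const)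
      (fun p hp => by
        have := h0 p (hsub hp)
        have h2 : 0 < k⁻¹ := by positivity
        nlinarith)
      (fun p hp _ => ((hsol p (hsub (pcyl_subset_pcylc _ _ _ hp))).affine _ _).subAt)
      (by
        have : k⁻¹ * u (y, t) < 1 / 2 := by
          rw [inv_mul_lt_iff₀ hk]; linarith
        linarith)
    refine absurd (key.trans (measure_mono ?_)) (not_le.2 (lt_of_lt_of_eq hvol ?_))
    · rintro p ⟨hp1, hp2⟩
      refine ⟨hsub2 hp1, ?_⟩
      have : k⁻¹ * u p < 1 := by linarith
      rw [inv_mul_lt_iff₀ hk] at this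
      linarith
    · congr 1
      rw [div_eq_mul_one_div, mul_pow]; ring
  refine ⟨hfirst, ?_⟩
  intro y hy s hs
  have hyx : ‖y - x‖ ≤ 2 * r := by rw [← dist_eq_norm]; exact hy
  have hy2 : ‖y - x‖ ^ 2 ≤ 4 * r ^ 2 := by nlinarith [norm_nonneg (y - x)]
  have key := barrier_lower (T := 5 * r ^ 2) (t := t) (x := x) (r := r / 2) (k := k / 2)
    hlam hA hκ (by norm_num) (by positivity) (by positivity)
    (S := closedBall x (5 * r) ×ˢ Icc (t - r ^ 2) (t + 5 * r ^ 2))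
    (fun y' s' h1 h2 h3 => by
      refine ⟨?_, by constructor <;> simp only <;> linarith⟩
      rw [mem_closedBall, dist_eq_norm]
      refine abs_le_of_sq_le_sq' ?_ (by positivity) |>.2
      nlinarith)
    (hu.mono hΩ) (fun p hp _ => hsol p (hΩ hp)) (fun p hp => h0 p (hΩ hp)) hfirst
    (y := y) (s := s - t) (by linarith [hs.1]) (by linarith [hs.2]) (by nlinarith [hs.1])
  rw [add_sub_cancel] at key
  refine le_trans ?_ key
  have e1 : Real.exp (-κ * 20) ≤ Real.exp (-κ * ((s - t) / (r / 2) ^ 2)) := by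
    refine Real.exp_le_exp.2 ?_
    have : (s - t) / (r / 2) ^ 2 ≤ 20 := by
      rw [div_le_iff₀ (by positivity)]; nlinarith [hs.2]
    nlinarith
  have e2 : 1 ≤ ((r / 2) ^ 2 + 4 * (s - t) - ‖y - x‖ ^ 2) / (r / 2) ^ 2 := by
    rw [le_div_iff₀ (by positivity)]; nlinarith [hs.1]
  have e3 : 1 ≤ (((r / 2) ^ 2 + 4 * (s - t) - ‖y - x‖ ^ 2) / (r / 2) ^ 2) ^ 2 := one_le_pow₀ e2
  have e4 : Real.exp (-κ * 20) ≤ Real.exp (-κ * ((s - t) / (r / 2) ^ 2)) *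
      (((r / 2) ^ 2 + 4 * (s - t) - ‖y - x‖ ^ 2) / (r / 2) ^ 2) ^ 2 := by
    nlinarith [Real.exp_pos (-κ * 20)]
  nlinarith

set_option maxHeartbeats 800000 in
/-- Polynomial lower bound at unit scale from positivity on a small ball. -/
theorem expansion (m : ℕ) {lam Lam : ℝ} (hlam : 0 < lam) :
    ∃ c > 0, ∃ γ : ℕ, ∀ A : Spc m → Matrix (Fin (m + 1)) (Fin (m + 1)) ℝ,
    IsElliptic lam Lam A →
    ∀ (u : Spc m × ℝ → ℝ), ContinuousOn u (ball 0 40 ×ˢ Ioo 0 9) →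
    (∀ p ∈ (ball 0 40 ×ˢ Ioo 0 9 : Set (Spc m × ℝ)), SolAt A u p) →
    (∀ p ∈ (ball 0 40 ×ˢ Ioo 0 9 : Set (Spc m × ℝ)), 0 ≤ u p) →
    ∀ (x : Spc m) (t r k : ℝ), ‖x‖ ≤ 2 → 0 < t → t ≤ 2 → 0 < r → r ≤ 1 → 0 < k →
    (∀ y ∈ closedBall x r, k ≤ u (y, t)) →
    ∀ y s, ‖y‖ ≤ 1 → 4 ≤ s → s ≤ 8 → c * k * r ^ γ ≤ u (y, s) := by
  obtain ⟨κ, hκ⟩ : ∃ κ : ℝ, (2 * 9 + 4 * (m + 1) * |Lam| + 8 * lam) ^ 2 < 32 * lam * κ := by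
    refine ⟨((2 * 9 + 4 * (m + 1) * |Lam| + 8 * lam) ^ 2 + 1) / (32 * lam), ?_⟩
    field_simp; linarith
  have hκ0 : 0 < κ := by
    by_contra h
    push Not at h
    nlinarith [sq_nonneg (2 * 9 + 4 * (m + 1) * |Lam| + 8 * lam)]
  obtain ⟨γ, hγ⟩ := exists_pow_lt_of_lt_one (Real.exp_pos (-κ)) (by norm_num : (1 / 2 : ℝ) < 1)
  refine ⟨Real.exp (-κ * 32), by positivity, γ, ?_⟩
  intro A hA u hu hsol h0 x t r k hx ht0 ht2 hr hr1 hk hini y s hy hs4 hs8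
  have hA' : IsElliptic lam |Lam| A :=
    ⟨hA.1, fun x ξ => ⟨(hA.2 x ξ).1, (hA.2 x ξ).2.trans (by gcongr; exact le_abs_self _)⟩⟩
  have hmem : ∀ (y' : Spc m) (τ : ℝ), ‖y' - x‖ ≤ 9 → 0 < τ → τ < 9 →
      (y', τ) ∈ (ball 0 40 ×ˢ Ioo 0 9 : Set (Spc m × ℝ)) := by
    intro y' τ h1 h2 h3
    refine ⟨?_, h2, h3⟩
    rw [mem_ball_zero_iff]
    calc ‖y'‖ = ‖(y' - x) + x‖ := by rw [sub_add_cancel]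
      _ ≤ ‖y' - x‖ + ‖x‖ := norm_add_le _ _
      _ < 40 := by linarith
  have hiter : ∀ n : ℕ, 2 ^ n * r ≤ 1 → ∀ y' ∈ closedBall x (2 ^ n * r),
      ((1 / 2) ^ n) ^ γ * k ≤ u (y', t + ((2 ^ n * r) ^ 2 - r ^ 2) / 3) := by
    intro n
    induction n with
    | zero =>
      intro _ y' hy'
      simpa using hini y' (by simpa using hy')
    | succ n ih =>
      intro hn y' hy'
      set R := 2 ^ n * r with hR
      have hR0 : 0 < R := by positivity
      have hRr : r ≤ R := le_mul_of_one_le_left hr.le (one_le_pow₀ (by norm_num))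
      have hR1 : 2 ^ (n + 1) * r = 2 * R := by rw [hR]; ring
      rw [hR1] at hn hy' ⊢
      have hy2 : ‖y' - x‖ ≤ 2 * R := by rw [← dist_eq_norm]; exact hy'
      have hy3 : ‖y' - x‖ ^ 2 ≤ 4 * R ^ 2 := by nlinarith [norm_nonneg (y' - x)]
      have key := barrier_lower (T := R ^ 2) (t := t + (R ^ 2 - r ^ 2) / 3) (x := x) (r := R)
        (β := 9) (k := ((1 / 2) ^ n) ^ γ * k) hlam hA' hκ (by norm_num) (by positivity) hR0
        (S := ball 0 40 ×ˢ Ioo 0 9)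
        (fun a b h1 h2 h3 => by
          refine hmem _ _ ?_ (by nlinarith) (by nlinarith)
          refine abs_le_of_sq_le_sq' ?_ (by positivity) |>.2
          nlinarith)
        hu (fun p hp _ => hsol p hp) h0 (ih (by linarith)) (y := y') (s := R ^ 2) (by positivity)
        le_rfl (by nlinarith)
      have e0 : t + (R ^ 2 - r ^ 2) / 3 + R ^ 2 = t + ((2 * R) ^ 2 - r ^ 2) / 3 := by ring
      rw [e0] at key
      refine le_trans ?_ key
      rw [div_self (by positivity), mul_one]
      have e2 : 1 ≤ (R ^ 2 + 9 * R ^ 2 - ‖y' - x‖ ^ 2) / R ^ 2 := by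
        rw [le_div_iff₀ (by positivity)]; nlinarith
      have e3 := one_le_pow₀ e2 (n := 2)
      have e4 : ((1 / 2 : ℝ) ^ (n + 1)) ^ γ = ((1 / 2) ^ n) ^ γ * (1 / 2) ^ γ := by
        rw [pow_succ, mul_pow]
      rw [e4, mul_assoc, mul_comm ((1 / 2 : ℝ) ^ γ), ← mul_assoc]
      refine mul_le_mul_of_nonneg_left ?_ (by positivity)
      nlinarith [Real.exp_pos (-κ)]
  obtain ⟨n, hn1, hn2⟩ := exists_nat_pow_near (x := 1 / r) (y := 2)
    (by rw [le_div_iff₀ hr]; linarith) (by norm_num)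
  rw [le_div_iff₀ hr] at hn1
  rw [div_lt_iff₀ hr, pow_succ] at hn2
  set R := 2 ^ n * r with hR
  have hR0 : 0 < R := by positivity
  have hR1 : 1 / 2 < R := by rw [hR]; linarith
  have hR2 : 1 / 4 < R ^ 2 := by nlinarith
  have hR3 : R ^ 2 ≤ 1 := by nlinarith
  have hRr : r ≤ R := le_mul_of_one_le_left hr.le (one_le_pow₀ (by norm_num))
  have hr2 : 0 < r ^ 2 := by positivity
  have hyx : ‖y - x‖ ≤ 3 := (norm_sub_le _ _).trans (by linarith)
  have hyx2 : ‖y - x‖ ^ 2 ≤ 9 := by nlinarith [norm_nonneg (y - x)]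
  set t' := t + (R ^ 2 - r ^ 2) / 3 with ht'
  have ht'0 : 0 < t' := by rw [ht']; linarith [mul_self_le_mul_self hr.le hRr]
  have ht'3 : t' ≤ 3 := by rw [ht']; nlinarith
  have key := barrier_lower (T := 8 - t') (t := t') (x := x) (r := R)
    (β := 9) (k := ((1 / 2) ^ n) ^ γ * k) hlam hA' hκ (by norm_num) (by positivity) hR0
    (S := ball 0 40 ×ˢ Ioo 0 9)
    (fun a b h1 h2 h3 => by
      refine hmem _ _ ?_ (by linarith) (by linarith)
      refine abs_le_of_sq_le_sq' ?_ (by positivity) |>.2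
      linarith)
    hu (fun p hp _ => hsol p hp) h0 (hiter n hn1) (y := y) (s := s - t') (by linarith)
    (by linarith) (by linarith)
  rw [add_sub_cancel] at key
  refine le_trans ?_ key
  have e1 : Real.exp (-κ * 32) ≤ Real.exp (-κ * ((s - t') / R ^ 2)) := by
    refine Real.exp_le_exp.2 ?_
    have : (s - t') / R ^ 2 ≤ 32 := by
      rw [div_le_iff₀ (by positivity)]; linarith
    nlinarith
  have e2 : 1 ≤ (R ^ 2 + 9 * (s - t') - ‖y - x‖ ^ 2) / R ^ 2 := by
    rw [le_div_iff₀ (by positivity)]; linarith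
  have e3 := one_le_pow₀ e2 (n := 2)
  have e5 : r ^ γ ≤ ((1 / 2 : ℝ) ^ n) ^ γ := by
    refine pow_le_pow_left₀ hr.le ?_ _
    rw [one_div, inv_pow, ← one_div, le_div_iff₀ (by positivity)]
    linarith
  have e6 : Real.exp (-κ * 32) ≤ Real.exp (-κ * ((s - t') / R ^ 2)) *
      ((R ^ 2 + 9 * (s - t') - ‖y - x‖ ^ 2) / R ^ 2) ^ 2 := by
    nlinarith [Real.exp_pos (-κ * 32)]
  calc Real.exp (-κ * 32) * k * r ^ γ = (r ^ γ * k) * Real.exp (-κ * 32) := by ring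
    _ ≤ _ := mul_le_mul (mul_le_mul_of_nonneg_right e5 hk.le) e6 (by positivity) (by positivity)

end Barrier

section WeakHarnack

open Filter Topology Set MeasureTheory Metric

variable {m : ℕ} {A : Spc m → Matrix (Fin (m + 1)) (Fin (m + 1)) ℝ} {lam Lam : ℝ}

theorem volume_pcyl (x : Spc m) (t : ℝ) {r : ℝ} (hr : 0 < r) :
    volume (pcyl x t r) = ENNReal.ofReal (r ^ (m + 3)) *
      volume (ball (0 : Spc m) 1 ×ˢ Ioo (-1 : ℝ) 0) := by
  have h : pscale x t r ⁻¹' pcyl x t r = ball (0 : Spc m) 1 ×ˢ Ioo (-1 : ℝ) 0 := by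
    ext p
    rw [mem_preimage, pscale_mem_pcyl hr]
  exact h ▸ volume_preimage_pscale x t hr _ (isOpen_pcyl x t r).measurableSet

theorem volume_unit_pcyl_ne_top : volume (ball (0 : Spc m) 1 ×ˢ Ioo (-1 : ℝ) 0) ≠ ⊤ := by
  rw [Measure.volume_eq_prod, Measure.prod_prod]
  exact ENNReal.mul_ne_top measure_ball_lt_top.ne (by simp)

/-- A covering lemma: if every point of `E` is near a parabolic cylinder a fixed proportion
of which lies in `F`, then `F` controls the measure of `E`. -/
theorem volume_le_of_cylinders {E F : Set (Spc m × ℝ)} {ε : ℝ} (hε : 0 < ε)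
    (H : ∀ p ∈ E, ∃ (x : Spc m) (t r : ℝ) (G : Set (Spc m × ℝ)), 0 < r ∧ r ≤ 1 ∧
      dist p.1 x < 2 * r ∧ |p.2 - t| ≤ 7 * r ^ 2 ∧ MeasurableSet G ∧ G ⊆ pcyl x t (2 * r) ∧ G ⊆ F ∧
      ENNReal.ofReal (ε * (2 * r) ^ (m + 3)) ≤ volume G) :
    volume E ≤ ENNReal.ofReal (5 ^ (m + 3) / ε) * volume (ball (0 : Spc m) 1 ×ˢ Ioo (-1 : ℝ) 0)
      * volume F := by
  choose! x t r G hr hr1 hdx hdt hGm hGQ hGF hGv using H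
  obtain ⟨U, hUE, hdisj, hcov⟩ := Vitali.exists_disjoint_subfamily_covering_enlargement
    (fun p => pcyl (x p) (t p) (2 * r p)) E r 2 (by norm_num) (fun p hp => (hr p hp).le) 1 hr1
    (fun p hp => ⟨(x p, t p - 2 * (r p) ^ 2), mem_ball_self (by have := hr p hp; positivity), by
      have := hr p hp
      have h2 : 0 < r p ^ 2 := by positivity
      constructor <;> simp only <;> nlinarith⟩)
  have hUc : U.Countable := hdisj.countable_of_isOpen (fun p _ => isOpen_pcyl _ _ _)
    fun p hp => ⟨(x p, t p - 2 * (r p) ^ 2), mem_ball_self (by have := hr p (hUE hp); positivity), by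
      have := hr p (hUE hp)
      have h2 : 0 < r p ^ 2 := by positivity
      constructor <;> simp only <;> nlinarith⟩
  set V := volume (ball (0 : Spc m) 1 ×ˢ Ioo (-1 : ℝ) 0) with hV
  have hsub : E ⊆ ⋃ p ∈ U, pcyl (x p) (t p + 50 * r p ^ 2) (10 * r p) := by
    intro p hp
    obtain ⟨b, hb, ⟨q, hqa, hqb⟩, hab⟩ := hcov p hp
    have ha0 := hr p hp
    have hb0 := hr b (hUE hb)
    have hab2 : r p ^ 2 ≤ 4 * r b ^ 2 := by nlinarith
    obtain ⟨h1, h2, h3⟩ := hqa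
    obtain ⟨h4, h5, h6⟩ := hqb
    rw [mem_iUnion₂]
    have hd := hdx p hp
    have ht := abs_le.1 (hdt p hp)
    refine ⟨b, hb, ?_, ?_, ?_⟩
    · rw [mem_ball] at h1 h4 ⊢
      have := dist_triangle4 p.1 (x p) q.1 (x b)
      rw [dist_comm (x p)] at this
      linarith
    · nlinarith
    · nlinarith
  have hGd : volume (⋃ p ∈ U, G p) = ∑' p : U, volume (G p) :=
    measure_biUnion hUc (fun a ha b hb hab =>
      (hdisj ha hb hab).mono (hGQ a (hUE ha)) (hGQ b (hUE hb))) fun p hp => hGm p (hUE hp)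
  calc volume E ≤ volume (⋃ p ∈ U, pcyl (x p) (t p + 50 * r p ^ 2) (10 * r p)) := measure_mono hsub
    _ ≤ ∑' p : U, volume (pcyl (x p) (t p + 50 * r (p : Spc m × ℝ) ^ 2) (10 * r p)) :=
      measure_biUnion_le _ hUc _
    _ ≤ ∑' p : U, ENNReal.ofReal (5 ^ (m + 3) / ε) * V * volume (G p) := by
      refine ENNReal.tsum_le_tsum fun p => ?_
      have hp := hUE p.2
      have hr0 := hr p hp
      rw [volume_pcyl _ _ (by positivity), mul_right_comm]
      refine mul_le_mul' ?_ le_rfl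
      refine le_trans (le_of_eq ?_) (mul_le_mul' le_rfl (hGv p hp))
      rw [← ENNReal.ofReal_mul (by positivity)]
      congr 1
      field_simp
      rw [← mul_pow]
      ring
    _ = ENNReal.ofReal (5 ^ (m + 3) / ε) * V * volume (⋃ p ∈ U, G p) := by
      rw [ENNReal.tsum_mul_left, hGd]
    _ ≤ _ := mul_le_mul' le_rfl (measure_mono (iUnion₂_subset fun p hp => hGF p (hUE hp)))

set_option maxHeartbeats 1000000 in
/-- Decay of the measure of superlevel sets along powers of a fixed base. -/
theorem weak_harnack_step (m : ℕ) {lam Lam : ℝ} (hlam : 0 < lam) (hLam : 0 ≤ Lam) :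
    ∃ M > 1, ∃ C > 0, ∀ A : Spc m → Matrix (Fin (m + 1)) (Fin (m + 1)) ℝ,
    IsElliptic lam Lam A →
    ∀ (u : Spc m × ℝ → ℝ), ContinuousOn u (ball 0 40 ×ˢ Ioo 0 9) →
    (∀ p ∈ (ball 0 40 ×ˢ Ioo 0 9 : Set (Spc m × ℝ)), SolAt A u p) →
    (∀ p ∈ (ball 0 40 ×ˢ Ioo 0 9 : Set (Spc m × ℝ)), 0 ≤ u p) →
    ∀ y s, ‖y‖ ≤ 1 → 4 ≤ s → s ≤ 8 → u (y, s) ≤ 1 → ∀ j : ℕ,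
    volume {p ∈ (ball 0 (1 + (1 / 2) ^ (j + 1)) ×ˢ Ioo 0 (1 + (1 / 2) ^ (j + 1)) :
        Set (Spc m × ℝ)) | M ^ (j + 1) < u p} ≤ ENNReal.ofReal C *
      volume {p ∈ (ball 0 (1 + (1 / 2) ^ j) ×ˢ Ioo 0 (1 + (1 / 2) ^ j) :
        Set (Spc m × ℝ)) | M ^ j < u p ∧ u p < M ^ (j + 1)} := by
  obtain ⟨ε, hε, c1, hc1, hc11, hspread⟩ := spread m hlam hLam
  obtain ⟨c2, hc2, γ, hexp⟩ := expansion m hlam (Lam := Lam)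
  set V := volume (ball (0 : Spc m) 1 ×ˢ Ioo (-1 : ℝ) 0) with hV
  set D : ℝ := 1 + 2 / c1 + 4 ^ (γ + 1) / c2 with hD
  have hD1 : 1 ≤ D := by
    have : 0 ≤ 2 / c1 + 4 ^ (γ + 1) / c2 := by positivity
    linarith
  set M : ℝ := D * 16 ^ γ + 1 with hM
  have h16 : (1 : ℝ) ≤ 16 ^ γ := one_le_pow₀ (by norm_num)
  have hDM : D * 16 ^ γ ≤ M := by linarith
  have hDM' : D ≤ M := by nlinarith
  have hM1 : 1 < M := by nlinarith
  refine ⟨M, hM1, 5 ^ (m + 3) / ε * V.toReal + 1, by positivity, ?_⟩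
  intro A hA u hu hsol h0 y s hy hs4 hs8 hus j
  set Ω : Set (Spc m × ℝ) := ball 0 40 ×ˢ Ioo 0 9 with hΩ
  have hΩo : IsOpen Ω := isOpen_ball.prod isOpen_Ioo
  set k := M ^ (j + 1) with hk
  have hk0 : 0 < k := by positivity
  set w : ℝ := (1 / 2) ^ (j + 1) with hw
  have hw0 : 0 < w := by positivity
  have hw1 : w ≤ 1 / 2 := by
    rw [hw, pow_succ]
    have : ((1 : ℝ) / 2) ^ j ≤ 1 := pow_le_one₀ (by norm_num) (by norm_num)
    linarith
  set ρ : ℝ := (1 / 16) ^ (j + 1) with hρ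
  have hρ0 : 0 < ρ := by positivity
  have hρ1 : ρ ≤ 1 / 16 := by
    rw [hρ, pow_succ]
    have : ((1 : ℝ) / 16) ^ j ≤ 1 := pow_le_one₀ (by norm_num) (by norm_num)
    linarith
  have hρw : 2 * ρ ≤ w := by
    have : ρ = w * (1 / 8) ^ (j + 1) := by rw [hρ, hw, ← mul_pow]; norm_num
    have h8 : ((1 : ℝ) / 8) ^ (j + 1) ≤ 1 / 2 := by
      rw [pow_succ]
      have : ((1 : ℝ) / 8) ^ j ≤ 1 := pow_le_one₀ (by norm_num) (by norm_num)
      linarith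
    nlinarith
  have hwj : (1 / 2 : ℝ) ^ j = 2 * w := by rw [hw, pow_succ]; ring
  have hkD : D ≤ k * ρ ^ γ := by
    have h1 : (D * 16 ^ γ) ^ (j + 1) ≤ k := pow_le_pow_left₀ (by positivity) hDM _
    have h2 : (D * 16 ^ γ) ^ (j + 1) * ρ ^ γ = D ^ (j + 1) := by
      rw [hρ, mul_pow, ← pow_mul, ← pow_mul, mul_comm γ, mul_assoc, ← mul_pow]; norm_num
    calc D ≤ D ^ (j + 1) := le_self_pow₀ hD1 (by simp)
      _ = (D * 16 ^ γ) ^ (j + 1) * ρ ^ γ := h2.symm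
      _ ≤ _ := by gcongr
  have hdom : ∀ (x : Spc m) (t r : ℝ), ‖x‖ ≤ 2 → t ≤ 2 → 0 < r → r ≤ 1 / 4 → r ^ 2 < t →
      closedBall x (5 * r) ×ˢ Icc (t - r ^ 2) (t + 5 * r ^ 2) ⊆ Ω := by
    rintro x t r hx ht hr0 hr hrt ⟨a, b⟩ ⟨h1, h2, h3⟩
    simp only at h2 h3
    have h4 : dist a x ≤ 5 * r := h1
    have h5 : ‖a‖ ≤ dist a x + ‖x‖ := by
      have := dist_triangle a x 0
      rwa [dist_zero_right, dist_zero_right] at this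
    refine ⟨mem_ball_zero_iff.2 (by simp only; linarith), ?_, ?_⟩
    · simp only; linarith
    · simp only; nlinarith
  have hsmall : ∀ (x : Spc m) (t r : ℝ), ‖x‖ ≤ 2 → t ≤ 2 → 0 < r → r ≤ 1 / 4 → r ^ 2 < t →
      volume {p ∈ pcyl x t r | u p < k} < ENNReal.ofReal (ε * r ^ (m + 3)) → r ≤ ρ / 2 := by
    intro x t r hx ht hr0 hr hrt hvol
    obtain ⟨h1, -⟩ := hspread A hA Ω u hu hsol h0 x t r k hr0 hk0 (hdom x t r hx ht hr0 hr hrt) hvol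
    have h2 := hexp A hA u hu hsol h0 x t (r / 2) (k / 2) hx (by nlinarith) ht (by positivity)
      (by linarith) (by positivity) h1 y s hy hs4 hs8
    by_contra hlt
    push Not at hlt
    have h3 : (ρ / 4) ^ γ ≤ (r / 2) ^ γ := pow_le_pow_left₀ (by positivity) (by linarith) _
    have h4 : c2 * (k / 2) * (ρ / 4) ^ γ ≤ 1 :=
      (mul_le_mul_of_nonneg_left h3 (by positivity)).trans (h2.trans hus)
    rw [div_pow] at h4
    have h5 : c2 * (k * ρ ^ γ) ≤ 2 * 4 ^ γ := by
      have : c2 * (k / 2) * (ρ ^ γ / 4 ^ γ) = c2 * (k * ρ ^ γ) / (2 * 4 ^ γ) := by field_simp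
      rwa [this, div_le_one (by positivity)] at h4
    have h6 : c2 * D ≤ 2 * 4 ^ γ := (mul_le_mul_of_nonneg_left hkD hc2.le).trans h5
    have h7 : 4 ^ (γ + 1) / c2 < D := by
      have : 0 < 2 / c1 := by positivity
      linarith
    rw [div_lt_iff₀ hc2, pow_succ] at h7
    have : (0 : ℝ) < 4 ^ γ := by positivity
    nlinarith
  have hlow : M ^ j < c1 * k := by
    have h1 : 2 / c1 < M := by
      have : 0 < 4 ^ (γ + 1) / c2 := by positivity
      linarith
    rw [div_lt_iff₀ hc1] at h1
    have h2 : 0 < M ^ j := by positivity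
    rw [hk, pow_succ]
    nlinarith
  refine (volume_le_of_cylinders hε ?_).trans (mul_le_mul' ?_ le_rfl)
  swap
  · rw [← ENNReal.ofReal_toReal volume_unit_pcyl_ne_top, ← ENNReal.ofReal_mul (by positivity)]
    exact ENNReal.ofReal_le_ofReal (by linarith)
  rintro ⟨a, b⟩ ⟨⟨hpa, hpb0, hpb⟩, hpu⟩
  simp only at hpb0 hpb
  rw [mem_ball_zero_iff] at hpa
  simp only at hpa
  set R : Set ℝ := {r | 0 < r ∧ r ≤ 1 / 4 ∧ ∃ (x : Spc m) (t : ℝ), r ^ 2 < t ∧ dist a x < 2 * r ∧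
    |b - t| < 2 * r ^ 2 ∧
    volume {p ∈ pcyl x t r | u p < k} < ENNReal.ofReal (ε * r ^ (m + 3))} with hR
  have hloc : ∀ (x : Spc m) (t r : ℝ), 0 < r → r ≤ 1 / 4 → dist a x < 2 * r → |b - t| < 2 * r ^ 2 →
      ‖x‖ ≤ 2 ∧ t ≤ 2 := by
    intro x t r hr0 hr hd ht
    have h5 : ‖x‖ ≤ dist x a + ‖a‖ := by
      have := dist_triangle x a 0
      rwa [dist_zero_right, dist_zero_right] at this
    rw [dist_comm] at h5
    have := abs_lt.1 ht
    have h6 : r ^ 2 ≤ 1 / 16 := by nlinarith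
    constructor <;> linarith
  have hbdd : ∀ r ∈ R, r ≤ ρ / 2 := by
    rintro r ⟨hr0, hr, x, t, hrt, hd, ht, hv⟩
    obtain ⟨hx, ht2⟩ := hloc x t r hr0 hr hd ht
    exact hsmall x t r hx ht2 hr0 hr hrt hv
  have hne : R.Nonempty := by
    have hab : (a, b) ∈ Ω :=
      ⟨mem_ball_zero_iff.2 (by simp only; linarith), hpb0, by simp only; linarith⟩
    have hop : IsOpen (Ω ∩ u ⁻¹' Ioi k) := hu.isOpen_inter_preimage hΩo isOpen_Ioi
    obtain ⟨δ, hδ, hball⟩ := Metric.isOpen_iff.1 hop (a, b) ⟨hab, hpu⟩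
    set r := min (1 / 4) (min (δ / 2) (b / 2)) with hr
    have hr0 : 0 < r := by positivity
    have hr1 : r ≤ 1 / 4 := min_le_left _ _
    have hr2 : r ≤ δ / 2 := (min_le_right _ _).trans (min_le_left _ _)
    have hr3 : r ≤ b / 2 := (min_le_right _ _).trans (min_le_right _ _)
    refine ⟨r, hr0, hr1, a, b, by nlinarith, by simpa using hr0, by simp [hr0], ?_⟩
    have : {p ∈ pcyl a b r | u p < k} = ∅ := by
      ext ⟨y', s'⟩
      simp only [mem_ofPred_eq, mem_empty_iff_false, iff_false, not_and, not_lt]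
      rintro ⟨h1, h2, h3⟩
      simp only at h2 h3
      have h4 : dist y' a < r := h1
      have : (y', s') ∈ ball (a, b) δ := by
        rw [mem_ball, Prod.dist_eq, max_lt_iff]
        refine ⟨by simp only; linarith, ?_⟩
        simp only [Real.dist_eq]
        rw [abs_lt]
        have h6 : r ^ 2 ≤ δ / 2 := by nlinarith
        constructor <;> linarith
      exact le_of_lt (hball this).2
    rw [this, measure_empty]
    exact ENNReal.ofReal_pos.2 (by positivity)
  have hBA : BddAbove R := ⟨ρ / 2, hbdd⟩
  have hσ : 0 < sSup R := by
    obtain ⟨r, hr⟩ := hne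
    exact lt_of_lt_of_le hr.1 (le_csSup hBA hr)
  obtain ⟨r, hrR, hrσ⟩ := exists_lt_of_lt_csSup hne (half_lt_self hσ)
  have hrρ := hbdd r hrR
  obtain ⟨hr0, hr, x, t, hrt, hd, ht, hv⟩ := hrR
  obtain ⟨hx, ht2⟩ := hloc x t r hr0 hr hd ht
  have ht' := abs_lt.1 ht
  have hr20 : 0 < r ^ 2 := by positivity
  have hnot : 2 * r ∉ R := fun h => by
    have := le_csSup hBA h
    linarith
  have hbig : ENNReal.ofReal (ε * (2 * r) ^ (m + 3)) ≤
      volume {p ∈ pcyl x (t + 5 * r ^ 2) (2 * r) | u p < k} := by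
    by_contra hlt
    push Not at hlt
    refine hnot ⟨by positivity, by linarith, x, t + 5 * r ^ 2, by nlinarith, by linarith, ?_, hlt⟩
    rw [abs_lt]
    constructor <;> linarith
  obtain ⟨-, hQ⟩ := hspread A hA Ω u hu hsol h0 x t r k hr0 hk0 (hdom x t r hx ht2 hr0 hr hrt) hv
  have hQΩ : pcyl x (t + 5 * r ^ 2) (2 * r) ⊆ Ω := by
    refine Subset.trans ?_ (hdom x t r hx ht2 hr0 hr hrt)
    rintro ⟨y', s'⟩ ⟨h1, h2, h3⟩
    simp only [mul_pow] at h2 h3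
    refine ⟨ball_subset_closedBall (ball_subset_ball (by linarith) h1), ?_, ?_⟩
    · simp only; linarith
    · simp only; linarith
  have hop : IsOpen (pcyl x (t + 5 * r ^ 2) (2 * r) ∩ u ⁻¹' Iio k) :=
    (hu.mono hQΩ).isOpen_inter_preimage (isOpen_pcyl _ _ _) isOpen_Iio
  refine ⟨x, t + 5 * r ^ 2, r, _, hr0, by linarith, hd, ?_, hop.measurableSet, inter_subset_left,
    ?_, hbig⟩
  · rw [abs_le]
    constructor <;> simp only <;> linarith
  · rintro ⟨y', s'⟩ ⟨⟨h1, h2, h3⟩, h4⟩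
    simp only [mul_pow] at h2 h3
    have h5 : dist y' x < 2 * r := h1
    have h6 : ‖y'‖ ≤ dist y' x + dist x a + ‖a‖ := by
      have := dist_triangle4 y' x a 0
      rwa [dist_zero_right, dist_zero_right] at this
    rw [dist_comm x a] at h6
    have hr3 : r ^ 2 ≤ r * (1 / 4) := by rw [sq]; gcongr
    refine ⟨⟨mem_ball_zero_iff.2 ?_, ?_, ?_⟩, ?_, h4⟩
    · simp only [hwj]; linarith
    · simp only; linarith
    · simp only [hwj]; linarith
    · exact lt_of_lt_of_le hlow (hQ y' h5.le s' ⟨by linarith, by linarith⟩)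

end WeakHarnack

section Harnack

open Filter Topology Set MeasureTheory Metric

variable {m : ℕ} {A : Spc m → Matrix (Fin (m + 1)) (Fin (m + 1)) ℝ} {lam Lam : ℝ}

/-- Continuous nonnegative solutions on `Ω`. -/
def NNSol (A : Spc m → Matrix (Fin (m + 1)) (Fin (m + 1)) ℝ) (u : Spc m × ℝ → ℝ)
    (Ω : Set (Spc m × ℝ)) : Prop :=
  ContinuousOn u Ω ∧ (∀ p ∈ Ω, SolAt A u p) ∧ ∀ p ∈ Ω, 0 ≤ u p

theorem NNSol.mono {u : Spc m × ℝ → ℝ} {Ω Ω' : Set (Spc m × ℝ)} (h : NNSol A u Ω) (hs : Ω' ⊆ Ω) :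
    NNSol A u Ω' :=
  ⟨h.1.mono hs, fun p hp => h.2.1 p (hs hp), fun p hp => h.2.2 p (hs hp)⟩

theorem NNSol.const_mul {u : Spc m × ℝ → ℝ} {Ω : Set (Spc m × ℝ)} (h : NNSol A u Ω) {c : ℝ}
    (hc : 0 ≤ c) : NNSol A (fun p => c * u p) Ω :=
  ⟨continuousOn_const.mul h.1, fun p hp => by simpa using (h.2.1 p hp).affine c 0,
    fun p hp => mul_nonneg hc (h.2.2 p hp)⟩

theorem NNSol.rescale {u : Spc m × ℝ → ℝ} {Ω Ω' : Set (Spc m × ℝ)} (h : NNSol A u Ω) {x0 : Spc m}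
    {t0 r : ℝ} (hs : ∀ p ∈ Ω', pscale x0 t0 r p ∈ Ω) :
    NNSol (fun y => A (x0 + r • y)) (fun p => u (pscale x0 t0 r p)) Ω' :=
  ⟨h.1.comp (continuous_pscale x0 t0 r).continuousOn hs, fun p hp => (h.2.1 _ (hs p hp)).rescale,
    fun p hp => h.2.2 _ (hs p hp)⟩

theorem SubAt.affine {z : Spc m × ℝ → ℝ} {p : Spc m × ℝ} (h : SubAt A z p) {a : ℝ} (ha : 0 ≤ a)
    (c : ℝ) : SubAt A (fun q => a * z q + c) p := by
  obtain ⟨hc, d, hd, hle⟩ := h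
  have h1 : ContDiffAt ℝ 2 (fun y => a * z (y, p.2)) p.1 := contDiffAt_const.mul hc
  refine ⟨h1.add contDiffAt_const, a * d, (hd.const_mul a).add_const c, ?_⟩
  rw [LL_add h1 contDiffAt_const, LL_const, LL_const_mul hc, add_zero]
  exact mul_le_mul_of_nonneg_left hle ha

theorem weak_harnack_geometric (m : ℕ) {lam Lam : ℝ} (hlam : 0 < lam) (hLam : 0 ≤ Lam) :
    ∃ M > 1, ∃ C > 0, ∃ δ > 0, δ < 1 ∧ ∀ A : Spc m → Matrix (Fin (m + 1)) (Fin (m + 1)) ℝ,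
    IsElliptic lam Lam A →
    ∀ (u : Spc m × ℝ → ℝ), NNSol A u (ball 0 40 ×ˢ Ioo 0 9) →
    ∀ y s, ‖y‖ ≤ 1 → 4 ≤ s → s ≤ 8 → u (y, s) ≤ 1 → ∀ j : ℕ,
    volume {p ∈ (ball 0 1 ×ˢ Ioo 0 1 : Set (Spc m × ℝ)) | M ^ j < u p}
      ≤ ENNReal.ofReal (C * δ ^ j) := by
  obtain ⟨M, hM, C, hC, H⟩ := weak_harnack_step m hlam hLam
  set V := volume (ball (0 : Spc m) 2 ×ˢ Ioo (0 : ℝ) 2) with hV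
  have hVt : V ≠ ⊤ := by
    rw [hV, Measure.volume_eq_prod, Measure.prod_prod]
    exact ENNReal.mul_ne_top measure_ball_lt_top.ne (by simp)
  refine ⟨M, hM, V.toReal + 1, by positivity, C / (1 + C), by positivity,
    (div_lt_one (by positivity)).2 (by linarith), ?_⟩
  intro A hA u ⟨hu, hsol, h0⟩ y s hy hs4 hs8 hus
  set W : ℕ → Set (Spc m × ℝ) := fun j =>
    ball 0 (1 + (1 / 2) ^ j) ×ˢ Ioo 0 (1 + (1 / 2) ^ j) with hW
  have hWo : ∀ j, IsOpen (W j) := fun j => isOpen_ball.prod isOpen_Ioo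
  have hp1 : ∀ j : ℕ, ((1 : ℝ) / 2) ^ j ≤ 1 := fun j => pow_le_one₀ (by norm_num) (by norm_num)
  have hWΩ : ∀ j, W j ⊆ ball 0 40 ×ˢ Ioo 0 9 := fun j =>
    prod_mono (ball_subset_ball (by linarith [hp1 j])) (Ioo_subset_Ioo_right (by linarith [hp1 j]))
  set E : ℕ → Set (Spc m × ℝ) := fun j => {p ∈ W j | M ^ j < u p} with hE
  set F : ℕ → Set (Spc m × ℝ) := fun j => {p ∈ W j | M ^ j < u p ∧ u p < M ^ (j + 1)} with hF
  have hstep : ∀ j, volume (E (j + 1)) ≤ ENNReal.ofReal (C / (1 + C)) * volume (E j) := by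
    intro j
    have h1 : volume (E (j + 1)) ≤ ENNReal.ofReal C * volume (F j) :=
      H A hA u hu hsol h0 y s hy hs4 hs8 hus j
    have hEo : IsOpen (E (j + 1)) :=
      (hu.mono (hWΩ (j + 1))).isOpen_inter_preimage (hWo (j + 1)) isOpen_Ioi
    have hdis : Disjoint (F j) (E (j + 1)) := by
      rw [Set.disjoint_left]
      rintro p ⟨-, -, h⟩ ⟨-, h'⟩
      exact lt_asymm h h'
    have hle : volume (F j) + volume (E (j + 1)) ≤ volume (E j) := by
      rw [← measure_union hdis hEo.measurableSet]
      refine measure_mono (union_subset (fun p hp => ⟨hp.1, hp.2.1⟩) ?_)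
      rintro p ⟨hp1', hp2⟩
      have hhalf : ((1 : ℝ) / 2) ^ (j + 1) ≤ (1 / 2) ^ j :=
        pow_le_pow_of_le_one (by norm_num) (by norm_num) (Nat.le_succ j)
      refine ⟨?_, lt_of_le_of_lt (pow_le_pow_right₀ hM.le (Nat.le_succ j)) hp2⟩
      exact prod_mono (ball_subset_ball (by linarith)) (Ioo_subset_Ioo_right (by linarith)) hp1'
    have h2 : ENNReal.ofReal (1 + C) * volume (E (j + 1)) ≤ ENNReal.ofReal C * volume (E j) := by
      calc ENNReal.ofReal (1 + C) * volume (E (j + 1))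
          = volume (E (j + 1)) + ENNReal.ofReal C * volume (E (j + 1)) := by
            rw [ENNReal.ofReal_add zero_le_one hC.le, add_mul, ENNReal.ofReal_one, one_mul]
        _ ≤ ENNReal.ofReal C * volume (F j) + ENNReal.ofReal C * volume (E (j + 1)) :=
            add_le_add_left h1 _
        _ = ENNReal.ofReal C * (volume (F j) + volume (E (j + 1))) := (mul_add _ _ _).symm
        _ ≤ _ := mul_le_mul' le_rfl hle
    have h3 : ENNReal.ofReal (1 + C) ≠ 0 := (ENNReal.ofReal_pos.2 (by positivity)).ne'
    have h4 : ENNReal.ofReal (C / (1 + C)) * volume (E j)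
        = ENNReal.ofReal C * volume (E j) / ENNReal.ofReal (1 + C) := by
      rw [ENNReal.ofReal_div_of_pos (by positivity), div_eq_mul_inv, div_eq_mul_inv, mul_right_comm]
    rw [h4, ENNReal.le_div_iff_mul_le (Or.inl h3) (Or.inl ENNReal.ofReal_ne_top), mul_comm]
    exact h2
  have hdecay : ∀ j, volume (E j) ≤ ENNReal.ofReal ((C / (1 + C)) ^ j) * V := by
    intro j
    induction j with
    | zero =>
      rw [pow_zero, ENNReal.ofReal_one, one_mul]
      refine measure_mono fun p hp => ?_
      exact prod_mono (ball_subset_ball (by norm_num)) (Ioo_subset_Ioo_right (by norm_num)) hp.1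
    | succ j ih =>
      rw [pow_succ, mul_comm ((C / (1 + C)) ^ j), ENNReal.ofReal_mul (by positivity), mul_assoc]
      exact (hstep j).trans (mul_le_mul' le_rfl ih)
  intro j
  have hpos : 0 ≤ ((1 : ℝ) / 2) ^ j := by positivity
  refine (measure_mono (t := E j) ?_).trans ((hdecay j).trans ?_)
  · rintro p ⟨hp1', hp2⟩
    exact ⟨prod_mono (ball_subset_ball (by linarith)) (Ioo_subset_Ioo_right (by linarith)) hp1', hp2⟩
  · rw [mul_comm, ENNReal.ofReal_mul (by positivity)]
    refine mul_le_mul' ?_ le_rfl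
    rw [← ENNReal.ofReal_toReal hVt]
    exact ENNReal.ofReal_le_ofReal (by rw [ENNReal.toReal_ofReal (by positivity)]; linarith)

/-- Weak Harnack inequality up to the initial time. -/
theorem weak_harnack (m : ℕ) {lam Lam : ℝ} (hlam : 0 < lam) (hLam : 0 ≤ Lam) :
    ∃ C > (0 : ℝ), ∃ e > (0 : ℝ), ∀ A : Spc m → Matrix (Fin (m + 1)) (Fin (m + 1)) ℝ,
    IsElliptic lam Lam A →
    ∀ (u : Spc m × ℝ → ℝ), NNSol A u (ball 0 40 ×ˢ Ioo 0 9) →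
    ∀ y s, ‖y‖ ≤ 1 → 4 ≤ s → s ≤ 8 → u (y, s) ≤ 1 → ∀ h : ℝ, 1 ≤ h →
    volume {p ∈ (ball 0 1 ×ˢ Ioo 0 1 : Set (Spc m × ℝ)) | h < u p}
      ≤ ENNReal.ofReal (C * h ^ (-e)) := by
  obtain ⟨M, hM, C, hC, δ, hδ, hδ1, H⟩ := weak_harnack_geometric m hlam hLam
  have hM0 : 0 < M := by linarith
  refine ⟨C / δ, by positivity, -Real.logb M δ, neg_pos.2 (Real.logb_neg hM hδ hδ1), ?_⟩
  intro A hA u hu y s hy hs4 hs8 hus h hh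
  obtain ⟨j, hj1, hj2⟩ := exists_nat_pow_near hh hM
  refine (measure_mono ?_).trans ((H A hA u hu y s hy hs4 hs8 hus j).trans
    (ENNReal.ofReal_le_ofReal ?_))
  · rintro p ⟨h1, h2⟩
    exact ⟨h1, lt_of_le_of_lt hj1 h2⟩
  · have h1 : δ ^ (j + 1) ≤ h ^ (Real.logb M δ) := by
      have : δ ^ (j + 1) = (M ^ (j + 1)) ^ (Real.logb M δ) := by
        rw [← Real.rpow_natCast M, ← Real.rpow_mul hM0.le, mul_comm, Real.rpow_mul hM0.le,
          Real.rpow_logb hM0 hM.ne' hδ, Real.rpow_natCast]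
      rw [this]
      exact Real.rpow_le_rpow_of_nonpos (by linarith) hj2.le (Real.logb_neg hM hδ hδ1).le
    rw [neg_neg, div_mul_eq_mul_div, le_div_iff₀ hδ, mul_assoc, ← pow_succ]
    exact mul_le_mul_of_nonneg_left h1 hC.le

/-- Local boundedness of subsolutions with small superlevel sets. -/
theorem sup_bound (m : ℕ) {lam Lam : ℝ} (hlam : 0 < lam) (hLam : 0 ≤ Lam) {C e : ℝ} (hC : 0 < C)
    (he : 0 < e) :
    ∃ C' > 0, ∀ A : Spc m → Matrix (Fin (m + 1)) (Fin (m + 1)) ℝ, IsElliptic lam Lam A →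
    ∀ (z : Spc m × ℝ → ℝ) (a b : ℝ), ContinuousOn z (ball 0 1 ×ˢ Ioo a b) →
    (∀ p ∈ (ball 0 1 ×ˢ Ioo a b : Set (Spc m × ℝ)), 0 < z p → SubAt A z p) →
    (∀ h : ℝ, 1 ≤ h → volume {p ∈ (ball 0 1 ×ˢ Ioo a b : Set (Spc m × ℝ)) | h < z p}
      ≤ ENNReal.ofReal (C * h ^ (-e))) →
    ∀ x t, ‖x‖ ≤ 1 / 2 → a + 1 / 4 ≤ t → t < b → z (x, t) ≤ C' := by
  obtain ⟨ε, hε, habp⟩ := abp_estimate m hlam hLam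
  set q : ℝ := (5 / 4 : ℝ) ^ (-(e / (m + 3 : ℕ))) with hq
  have hN : (0 : ℝ) < (m + 3 : ℕ) := by positivity
  have hq0 : 0 < q := by positivity
  have hq1 : q < 1 :=
    Real.rpow_lt_one_of_one_lt_of_neg (by norm_num) (neg_neg_of_pos (by positivity))
  have hqN : q ^ (m + 3) = (5 / 4 : ℝ) ^ (-e) := by
    rw [hq, ← Real.rpow_natCast, ← Real.rpow_mul (by norm_num)]
    congr 1
    field_simp
  set ρ : ℝ := (1 - q) / 8 with hρ
  have hρ0 : 0 < ρ := by rw [hρ]; linarith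
  obtain ⟨H0, hH0, hH2⟩ : ∃ H0 : ℝ, C * (H0 / 2) ^ (-e) < ε * ρ ^ (m + 3) ∧ 2 ≤ H0 := by
    have h1 : Tendsto (fun H : ℝ => C * (H / 2) ^ (-e)) atTop (𝓝 (C * 0)) :=
      ((tendsto_rpow_neg_atTop he).comp (tendsto_id.atTop_div_const (by norm_num))).const_mul C
    rw [mul_zero] at h1
    exact ((h1.eventually (gt_mem_nhds (by positivity))).and (eventually_ge_atTop 2)).exists
  refine ⟨H0, by linarith, ?_⟩
  intro A hA z a b hz hsub hvol x t hx hat htb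
  by_contra hlt
  push Not at hlt
  have hqi : ∀ i : ℕ, 0 < q ^ i ∧ q ^ i ≤ 1 := fun i =>
    ⟨by positivity, pow_le_one₀ hq0.le hq1.le⟩
  have hex : ∀ i : ℕ, ∃ p : Spc m × ℝ, ‖p.1‖ ≤ 1 / 2 + (1 - q ^ i) / 8 ∧
      a + 1 / 4 - (1 - q ^ i) / 8 ≤ p.2 ∧ p.2 ≤ t ∧ H0 * (5 / 4) ^ i < z p := by
    intro i
    induction i with
    | zero => exact ⟨(x, t), by simpa using hx, by simpa using hat, le_rfl, by simpa using hlt⟩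
    | succ i ih =>
      obtain ⟨⟨y, s⟩, hy, hs1, hs2, hzp⟩ := ih
      simp only at hy hs1 hs2
      obtain ⟨hi0, hi1⟩ := hqi i
      set r : ℝ := ρ * q ^ i with hr
      have hr0 : 0 < r := by positivity
      have hr1 : r ≤ 1 / 8 := by
        rw [hr, hρ]; nlinarith only [hq0, hi0, hi1]
      have hr2 : r ^ 2 ≤ r := by nlinarith only [hr0, hr1]
      have hrs : (1 - q ^ (i + 1)) / 8 = (1 - q ^ i) / 8 + r := by rw [hr, hρ, pow_succ]; ring
      have hi1' := hqi (i + 1)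
      set Hi : ℝ := H0 * (5 / 4) ^ i with hHi
      have hHi2 : 2 ≤ Hi := hH2.trans (le_mul_of_one_le_right (by linarith)
        (one_le_pow₀ (by norm_num)))
      have hpos : ∀ p ∈ pcylc y s r, ‖p.1‖ ≤ 1 / 2 + (1 - q ^ (i + 1)) / 8 ∧
          a + 1 / 4 - (1 - q ^ (i + 1)) / 8 ≤ p.2 ∧ p.2 ≤ t := by
        rintro ⟨y', s'⟩ ⟨h1, h2, h3⟩
        simp only at h2 h3 ⊢
        have h4 : dist y' y ≤ r := h1
        have h5 : ‖y'‖ ≤ dist y' y + ‖y‖ := by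
          have := dist_triangle y' y 0
          rwa [dist_zero_right, dist_zero_right] at this
        rw [hrs]
        exact ⟨by linarith, by linarith, by linarith⟩
      have hcyl : pcylc y s r ⊆ ball 0 1 ×ˢ Ioo a b := by
        intro p hp
        obtain ⟨h1, h2, h3⟩ := hpos p hp
        exact ⟨mem_ball_zero_iff.2 (by linarith), by linarith, by linarith⟩
      suffices h : ∃ p ∈ pcylc y s r, H0 * (5 / 4) ^ (i + 1) < z p by
        obtain ⟨p, hp, hzp'⟩ := h
        exact ⟨p, (hpos p hp).1, (hpos p hp).2.1, (hpos p hp).2.2, hzp'⟩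
      by_contra hno
      push Not at hno
      have key := habp A hA (fun p => 1 * z p + -(Hi / 2)) y s r (3 / 4 * Hi) hr0 (by linarith)
        ((continuousOn_const.mul (hz.mono hcyl)).add continuousOn_const)
        (fun p hp => by
          have := hno p hp
          rw [pow_succ, ← mul_assoc, ← hHi] at this
          linarith)
        (fun p hp hp0 => (hsub p (hcyl (pcyl_subset_pcylc _ _ _ hp)) (by linarith)).affine
          zero_le_one _)
        (by linarith)
      have hv := hvol (Hi / 2) (by linarith)
      have hss : {p ∈ pcyl y s r | 0 < 1 * z p + -(Hi / 2)} ⊆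
          {p ∈ (ball 0 1 ×ˢ Ioo a b : Set (Spc m × ℝ)) | Hi / 2 < z p} := by
        rintro p ⟨hp1, hp2⟩
        exact ⟨hcyl (pcyl_subset_pcylc _ _ _ hp1), by linarith⟩
      have h3 := (key.trans (measure_mono hss)).trans hv
      rw [ENNReal.ofReal_le_ofReal_iff (by positivity)] at h3
      have h4 : C * (Hi / 2) ^ (-e) = C * (H0 / 2) ^ (-e) * (q ^ (m + 3)) ^ i := by
        have h5 : Hi / 2 = H0 / 2 * (5 / 4) ^ i := by rw [hHi]; ring
        rw [h5, Real.mul_rpow (by linarith) (by positivity), hqN, ← Real.rpow_natCast (5 / 4),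
          ← Real.rpow_mul (by norm_num), mul_comm (i : ℝ), Real.rpow_mul (by norm_num),
          Real.rpow_natCast]
        ring
      rw [h4, hr, mul_pow, ← pow_mul, mul_comm i, pow_mul, ← mul_assoc] at h3
      have h6 : 0 < (q ^ (m + 3)) ^ i := by positivity
      exact absurd (le_of_mul_le_mul_right h3 h6) (not_le.2 hH0)
  have hK : IsCompact (closedBall (0 : Spc m) (5 / 8) ×ˢ Icc (a + 1 / 8) t) :=
    (isCompact_closedBall _ _).prod isCompact_Icc
  obtain ⟨B, hB⟩ := (hK.bddAbove_image (hz.mono (prod_mono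
    (closedBall_subset_ball (by norm_num)) fun s hs => ⟨by linarith [hs.1], by linarith [hs.2]⟩)))
  obtain ⟨i, hi⟩ := pow_unbounded_of_one_lt B (by norm_num : (1 : ℝ) < 5 / 4)
  obtain ⟨p, h1, h2, h3, h4⟩ := hex i
  obtain ⟨hi0, hi1⟩ := hqi i
  have h5 : z p ≤ B := hB ⟨p, ⟨mem_closedBall_zero_iff.2 (by linarith), by linarith, h3⟩, rfl⟩
  have h6 : (0 : ℝ) < (5 / 4) ^ i := by positivity
  nlinarith only [hi, h4, h5, h6, hH2]

end Harnack

section HarnackScaled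

open Filter Topology Set MeasureTheory Metric

variable {m : ℕ} {A : Spc m → Matrix (Fin (m + 1)) (Fin (m + 1)) ℝ} {lam Lam : ℝ}

theorem le_mul_of_forall_gt {x C c0 : ℝ} (hC : 0 < C) (h : ∀ c, c0 < c → x ≤ C * c) :
    x ≤ C * c0 := by
  refine le_of_forall_pos_le_add fun ε hε => ?_
  have h1 := h (c0 + ε / C) (by linarith [div_pos hε hC])
  rwa [mul_add, mul_div_cancel₀ _ hC.ne'] at h1

theorem harnack_unit (m : ℕ) {lam Lam : ℝ} (hlam : 0 < lam) (hLam : 0 ≤ Lam) :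
    ∃ C > (0 : ℝ), ∀ A : Spc m → Matrix (Fin (m + 1)) (Fin (m + 1)) ℝ, IsElliptic lam Lam A →
    ∀ (u : Spc m × ℝ → ℝ), NNSol A u (ball 0 40 ×ˢ Ioo 0 9) →
    ∀ x t, ‖x‖ ≤ 1 / 2 → 1 / 4 ≤ t → t < 1 → ∀ y s, ‖y‖ ≤ 1 → 4 ≤ s → s ≤ 8 →
    u (x, t) ≤ C * u (y, s) := by
  obtain ⟨C, hC, e, he, H⟩ := weak_harnack m hlam hLam
  obtain ⟨C', hC', H'⟩ := sup_bound m hlam hLam hC he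
  refine ⟨C', hC', ?_⟩
  intro A hA u hu x t hx ht1 ht2 y s hy hs4 hs8
  have hsub : (ball 0 1 ×ˢ Ioo 0 1 : Set (Spc m × ℝ)) ⊆ ball 0 40 ×ˢ Ioo 0 9 :=
    prod_mono (ball_subset_ball (by norm_num)) (Ioo_subset_Ioo_right (by norm_num))
  refine le_mul_of_forall_gt hC' fun c hc => ?_
  have hq : (y, s) ∈ (ball 0 40 ×ˢ Ioo 0 9 : Set (Spc m × ℝ)) :=
    ⟨mem_ball_zero_iff.2 (by linarith), by linarith, by linarith⟩
  have hc0 : 0 < c := lt_of_le_of_lt (hu.2.2 _ hq) hc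
  have hu' := hu.const_mul (inv_nonneg.2 hc0.le)
  have h1 := H' A hA (fun p => c⁻¹ * u p) 0 1 (hu'.mono hsub).1
    (fun p hp _ => ((hu'.mono hsub).2.1 p hp).subAt)
    (H A hA _ hu' y s hy hs4 hs8 ((inv_mul_le_one₀ hc0).2 hc.le)) x t hx (by linarith) ht2
  rw [inv_mul_le_iff₀ hc0] at h1
  linarith

theorem initial_bound_unit (m : ℕ) {lam Lam : ℝ} (hlam : 0 < lam) (hLam : 0 ≤ Lam) :
    ∃ C > (0 : ℝ), ∀ A : Spc m → Matrix (Fin (m + 1)) (Fin (m + 1)) ℝ, IsElliptic lam Lam A →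
    ∀ (u : Spc m × ℝ → ℝ), NNSol A u (ball 0 40 ×ˢ Ioo 0 9) → ∀ κ, 0 ≤ κ →
    (∀ x ∈ ball (0 : Spc m) 1, ∀ᶠ p in 𝓝 (x, (0 : ℝ)), 0 < p.2 → u p ≤ κ) →
    ∀ x t, ‖x‖ ≤ 1 / 2 → 0 < t → t < 1 → ∀ y s, ‖y‖ ≤ 1 → 4 ≤ s → s ≤ 8 →
    u (x, t) ≤ C * (κ + u (y, s)) := by
  obtain ⟨C, hC, e, he, H⟩ := weak_harnack m hlam hLam
  obtain ⟨C', hC', H'⟩ := sup_bound m hlam hLam hC he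
  refine ⟨C' + 1, by linarith, ?_⟩
  intro A hA u hu κ hκ hini x t hx ht1 ht2 y s hy hs4 hs8
  have hsub : (ball 0 1 ×ˢ Ioo 0 1 : Set (Spc m × ℝ)) ⊆ ball 0 40 ×ˢ Ioo 0 9 :=
    prod_mono (ball_subset_ball (by norm_num)) (Ioo_subset_Ioo_right (by norm_num))
  refine le_mul_of_forall_gt (by linarith) fun c hc => ?_
  have hq : (y, s) ∈ (ball 0 40 ×ˢ Ioo 0 9 : Set (Spc m × ℝ)) :=
    ⟨mem_ball_zero_iff.2 (by linarith), by linarith, by linarith⟩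
  have huq := hu.2.2 _ hq
  have hc0 : 0 < c := by linarith
  have hu' := hu.const_mul (inv_nonneg.2 hc0.le)
  set z : Spc m × ℝ → ℝ := fun p => if 0 < p.2 then max (c⁻¹ * u p + -(c⁻¹ * κ)) 0 else 0 with hz
  have hzpos : ∀ p : Spc m × ℝ, 0 < p.2 → z p = max (c⁻¹ * u p + -(c⁻¹ * κ)) 0 := fun p hp =>
    if_pos hp
  have hzneg : ∀ p : Spc m × ℝ, ¬ 0 < p.2 → z p = 0 := fun p hp => if_neg hp
  have hznhds : ∀ p : Spc m × ℝ, 0 < p.2 → z =ᶠ[𝓝 p] fun q => max (c⁻¹ * u q + -(c⁻¹ * κ)) 0 := by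
    intro p hp
    filter_upwards [(isOpen_lt continuous_const continuous_snd).mem_nhds hp] with q hq
    exact hzpos q hq
  have hopen : IsOpen (ball 0 1 ×ˢ Ioo 0 1 : Set (Spc m × ℝ)) := isOpen_ball.prod isOpen_Ioo
  have hcont1 : ∀ p ∈ (ball 0 1 ×ˢ Ioo 0 1 : Set (Spc m × ℝ)),
      ContinuousAt (fun q => c⁻¹ * u q + -(c⁻¹ * κ)) p := fun p hp =>
    (((hu'.mono hsub).1.continuousAt (hopen.mem_nhds hp))).add continuousAt_const
  have hmem : ∀ p ∈ (ball 0 1 ×ˢ Ioo (-1) 1 : Set (Spc m × ℝ)), 0 < p.2 →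
      p ∈ (ball 0 1 ×ˢ Ioo 0 1 : Set (Spc m × ℝ)) := fun p hp h => ⟨hp.1, h, hp.2.2⟩
  have hzc : ContinuousOn z (ball 0 1 ×ˢ Ioo (-1) 1) := by
    rintro p hp
    refine ContinuousAt.continuousWithinAt ?_
    rcases lt_trichotomy 0 p.2 with h | h | h
    · exact ContinuousAt.congr ((hcont1 p (hmem p hp h)).max continuousAt_const) (hznhds p h).symm
    · have h1 : ∀ᶠ q in 𝓝 p, z q = 0 := by
        have h2 := hini p.1 hp.1
        have h3 : (p.1, (0 : ℝ)) = p := by rw [h]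
        rw [h3] at h2
        filter_upwards [h2] with q hq
        by_cases h4 : 0 < q.2
        · rw [hzpos q h4]
          refine max_eq_right ?_
          have := mul_le_mul_of_nonneg_left (hq h4) (inv_nonneg.2 hc0.le)
          linarith
        · exact hzneg q h4
      exact (continuousAt_const (y := (0 : ℝ))).congr (h1.mono fun q hq => hq.symm)
    · refine (continuousAt_const (y := (0 : ℝ))).congr ?_
      filter_upwards [(isOpen_lt continuous_snd continuous_const).mem_nhds h] with q hq
      exact (hzneg q (not_lt.2 (le_of_lt hq))).symm
  have hzs : ∀ p ∈ (ball 0 1 ×ˢ Ioo (-1) 1 : Set (Spc m × ℝ)), 0 < z p → SubAt A z p := by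
    intro p hp hzp
    have h0 : 0 < p.2 := by
      by_contra h
      rw [hzneg p h] at hzp
      exact lt_irrefl _ hzp
    have hp' := hmem p hp h0
    rw [hzpos p h0] at hzp
    have h1 : 0 < c⁻¹ * u p + -(c⁻¹ * κ) := by
      rcases lt_max_iff.1 hzp with h | h
      · exact h
      · exact absurd h (lt_irrefl _)
    refine SubAt.congr_nhds (((hu.2.1 p (hsub hp')).affine c⁻¹ (-(c⁻¹ * κ))).subAt) ?_
    filter_upwards [hznhds p h0, (hcont1 p hp').eventually_const_lt h1] with q h2 h3
    rw [h2]
    exact max_eq_left h3.le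
  have hvol : ∀ h : ℝ, 1 ≤ h →
      volume {p ∈ (ball 0 1 ×ˢ Ioo (-1) 1 : Set (Spc m × ℝ)) | h < z p}
        ≤ ENNReal.ofReal (C * h ^ (-e)) := by
    intro h hh
    refine (measure_mono ?_).trans
      (H A hA _ hu' y s hy hs4 hs8 ((inv_mul_le_one₀ hc0).2 (by linarith)) h hh)
    rintro p ⟨hp, hp2⟩
    have h0 : 0 < p.2 := by
      by_contra h
      rw [hzneg p h] at hp2
      linarith
    rw [hzpos p h0] at hp2
    refine ⟨hmem p hp h0, ?_⟩
    rcases lt_max_iff.1 hp2 with h1 | h1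
    · have := mul_nonneg (inv_nonneg.2 hc0.le) hκ
      linarith
    · linarith
  have h1 := H' A hA z (-1) 1 hzc hzs hvol x t hx (by linarith) ht2
  rw [hzpos _ ht1] at h1
  have h2 : c⁻¹ * u (x, t) ≤ C' + c⁻¹ * κ := by linarith [le_max_left (c⁻¹ * u (x, t) + -(c⁻¹ * κ)) 0]
  rw [inv_mul_le_iff₀ hc0, mul_add, mul_inv_cancel_left₀ hc0.ne'] at h2
  linarith

theorem pscale_inv (x0 : Spc m) (t0 : ℝ) {r : ℝ} (hr : 0 < r) (x : Spc m) (t : ℝ) :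
    pscale x0 t0 r (r⁻¹ • (x - x0), (t - t0) / r ^ 2) = (x, t) := by
  simp only [pscale, Prod.mk.injEq]
  refine ⟨?_, ?_⟩
  · rw [smul_inv_smul₀ hr.ne', add_sub_cancel]
  · rw [mul_div_cancel₀ _ (by positivity), add_sub_cancel]

theorem norm_inv_smul_sub_le {x0 x : Spc m} {r c : ℝ} (hr : 0 < r) (h : dist x x0 ≤ c * r) :
    ‖r⁻¹ • (x - x0)‖ ≤ c := by
  rw [norm_smul, norm_inv, Real.norm_of_nonneg hr.le, ← dist_eq_norm, inv_mul_le_iff₀ hr]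
  linarith

theorem pscale_mem_box {x0 : Spc m} {t0 r R a b : ℝ} (hr : 0 < r) {p : Spc m × ℝ}
    (hp : p ∈ (ball 0 R ×ˢ Ioo a b : Set (Spc m × ℝ))) :
    pscale x0 t0 r p ∈ (ball x0 (R * r) ×ˢ Ioo (t0 + r ^ 2 * a) (t0 + r ^ 2 * b) :
      Set (Spc m × ℝ)) := by
  obtain ⟨h1, h2, h3⟩ := hp
  have h4 : ‖p.1‖ < R := mem_ball_zero_iff.1 h1
  have hr2 : 0 < r ^ 2 := by positivity
  refine ⟨?_, ?_, ?_⟩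
  · change dist (x0 + r • p.1) x0 < R * r
    rw [dist_self_add_left, norm_smul, Real.norm_of_nonneg hr.le, mul_comm]
    exact mul_lt_mul_of_pos_right h4 hr
  · change t0 + r ^ 2 * a < t0 + r ^ 2 * p.2
    linarith [mul_lt_mul_of_pos_left h2 hr2]
  · change t0 + r ^ 2 * p.2 < t0 + r ^ 2 * b
    linarith [mul_lt_mul_of_pos_left h3 hr2]

/-- The parabolic Harnack inequality at scale `r`. -/
theorem harnack (m : ℕ) {lam Lam : ℝ} (hlam : 0 < lam) (hLam : 0 ≤ Lam) :
    ∃ C ≥ (1 : ℝ), ∀ A : Spc m → Matrix (Fin (m + 1)) (Fin (m + 1)) ℝ, IsElliptic lam Lam A →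
    ∀ (u : Spc m × ℝ → ℝ) (x0 : Spc m) (t0 r : ℝ), 0 < r →
    NNSol A u (ball x0 (40 * r) ×ˢ Ioo (t0 - r ^ 2) (t0 + 9 * r ^ 2)) →
    ∀ x, dist x x0 ≤ r / 2 → ∀ y t, dist y x0 ≤ r → t0 + 4 * r ^ 2 ≤ t → t ≤ t0 + 7 * r ^ 2 →
    u (x, t0) ≤ C * u (y, t) := by
  obtain ⟨C, hC, H⟩ := harnack_unit m hlam hLam
  refine ⟨max C 1, le_max_right _ _, ?_⟩
  intro A hA u x0 t0 r hr hu x hx y t hy ht1 ht2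
  have hr2 : 0 < r ^ 2 := by positivity
  have h1 := H _ (hA.rescale x0 r) (fun p => u (pscale x0 (t0 - r ^ 2 / 2) r p))
    (hu.rescale fun p hp => by
      refine prod_mono (by rfl) (Ioo_subset_Ioo ?_ ?_)
        (pscale_mem_box (t0 := t0 - r ^ 2 / 2) hr hp) <;> linarith)
    (r⁻¹ • (x - x0)) ((t0 - (t0 - r ^ 2 / 2)) / r ^ 2)
    (norm_inv_smul_sub_le hr (by linarith)) (by rw [le_div_iff₀ hr2]; linarith)
    (by rw [div_lt_iff₀ hr2]; linarith)
    (r⁻¹ • (y - x0)) ((t - (t0 - r ^ 2 / 2)) / r ^ 2)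
    (norm_inv_smul_sub_le hr (by linarith)) (by rw [le_div_iff₀ hr2]; linarith)
    (by rw [div_le_iff₀ hr2]; linarith)
  simp only [pscale_inv x0 _ hr] at h1
  have h2 : 0 ≤ u (y, t) := hu.2.2 _ ⟨mem_ball.2 (by linarith), by linarith, by linarith⟩
  exact h1.trans (mul_le_mul_of_nonneg_right (le_max_left _ _) h2)

/-- A solution that is at most `κ` at the initial time is controlled by `κ` and its value at a
later time. -/
theorem initial_bound (m : ℕ) {lam Lam : ℝ} (hlam : 0 < lam) (hLam : 0 ≤ Lam) :
    ∃ C > (0 : ℝ), ∀ A : Spc m → Matrix (Fin (m + 1)) (Fin (m + 1)) ℝ, IsElliptic lam Lam A →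
    ∀ (u : Spc m × ℝ → ℝ) (x0 : Spc m) (a r : ℝ), 0 < r →
    NNSol A u (ball x0 (40 * r) ×ˢ Ioo a (a + 9 * r ^ 2)) → ∀ κ, 0 ≤ κ →
    (∀ x ∈ ball x0 r, ∀ᶠ p in 𝓝 (x, a), a < p.2 → u p ≤ κ) →
    ∀ x t, dist x x0 ≤ r / 2 → a < t → t < a + r ^ 2 →
    ∀ y s, dist y x0 ≤ r → a + 4 * r ^ 2 ≤ s → s ≤ a + 8 * r ^ 2 →
    u (x, t) ≤ C * (κ + u (y, s)) := by
  obtain ⟨C, hC, H⟩ := initial_bound_unit m hlam hLam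
  refine ⟨C, hC, ?_⟩
  intro A hA u x0 a r hr hu κ hκ hini x t hx hat hta y s hy hs1 hs2
  have hr2 : 0 < r ^ 2 := by positivity
  have h1 := H _ (hA.rescale x0 r) (fun p => u (pscale x0 a r p))
    (hu.rescale fun p hp => by
      refine prod_mono (by rfl) (Ioo_subset_Ioo ?_ ?_) (pscale_mem_box (t0 := a) hr hp) <;> linarith)
    κ hκ (by
      intro w hw
      have h2 := hini (x0 + r • w) (by
        rw [mem_ball, dist_self_add_left, norm_smul, Real.norm_of_nonneg hr.le]
        have := mul_lt_mul_of_pos_left (mem_ball_zero_iff.1 hw) hr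
        linarith)
      have h3 : Tendsto (pscale x0 a r) (𝓝 (w, (0 : ℝ))) (𝓝 (x0 + r • w, a)) := by
        have h4 := (continuous_pscale x0 a r).tendsto (w, (0 : ℝ))
        have h5 : pscale x0 a r (w, (0 : ℝ)) = (x0 + r • w, a) := by simp [pscale]
        rwa [h5] at h4
      filter_upwards [h3.eventually h2] with p hp h0
      refine hp ?_
      change a < a + r ^ 2 * p.2
      linarith [mul_pos hr2 h0])
    (r⁻¹ • (x - x0)) ((t - a) / r ^ 2)
    (norm_inv_smul_sub_le hr (by linarith)) (div_pos (by linarith) hr2)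
    (by rw [div_lt_iff₀ hr2]; linarith)
    (r⁻¹ • (y - x0)) ((s - a) / r ^ 2)
    (norm_inv_smul_sub_le hr (by linarith)) (by rw [le_div_iff₀ hr2]; linarith)
    (by rw [div_le_iff₀ hr2]; linarith)
  simpa only [pscale_inv x0 _ hr] using h1

end HarnackScaled

section HarnackEnd

open Filter Topology Set MeasureTheory Metric

variable {m : ℕ} {A : Spc m → Matrix (Fin (m + 1)) (Fin (m + 1)) ℝ} {lam Lam : ℝ}

/-- A nonnegative solution on a cylinder that is at least `k` at the initial time stays comparable
to `k` on the axis. -/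
theorem axis_lower (m : ℕ) {lam Lam : ℝ} (hlam : 0 < lam) (N : ℝ) :
    ∃ c > (0 : ℝ), ∀ A : Spc m → Matrix (Fin (m + 1)) (Fin (m + 1)) ℝ, IsElliptic lam Lam A →
    ∀ (u : Spc m × ℝ → ℝ) (x : Spc m) (t s r k : ℝ), 0 < r → 0 ≤ k → t ≤ s → s ≤ t + N * r ^ 2 →
    ContinuousOn u (closedBall x r ×ˢ Icc t s) →
    (∀ p ∈ (closedBall x r ×ˢ Icc t s : Set (Spc m × ℝ)), 0 ≤ u p) →
    (∀ p ∈ (closedBall x r ×ˢ Icc t s : Set (Spc m × ℝ)), t < p.2 → SolAt A u p) →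
    (∀ y ∈ closedBall x r, k ≤ u (y, t)) → c * k ≤ u (x, s) := by
  set κ : ℝ := ((4 * (m + 1) * Lam + 8 * lam) ^ 2 + 1) / (32 * lam) with hκ
  refine ⟨Real.exp (-(κ * N)), Real.exp_pos _, ?_⟩
  intro A hA u x t s r k hr hk hts hs hc h0 hsol hini
  have hr2 : 0 < r ^ 2 := by positivity
  have h32 : 32 * lam * κ = (4 * (m + 1) * Lam + 8 * lam) ^ 2 + 1 := by
    rw [hκ]; field_simp
  have hκ0 : 0 ≤ κ := by positivity
  rcases hk.eq_or_lt with rfl | hk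
  · rw [mul_zero]
    exact h0 _ ⟨mem_closedBall_self hr.le, hts, le_rfl⟩
  have key := barrier_lower (κ := κ) (β := 0) (S := closedBall x r ×ˢ Icc t s) (T := s - t) (k := k)
    (r := r) (x := x) (t := t) (u := u) hlam hA (by rw [h32]; simp) le_rfl hk hr
    (fun y s' h1 h2 h3 => ⟨by
      rw [mem_closedBall, dist_eq_norm]
      rw [zero_mul, add_zero] at h3
      exact abs_le_of_sq_le_sq' h3 hr.le |>.2, by
        change t ≤ t + s'
        linarith, by
        change t + s' ≤ s
        linarith⟩) hc hsol h0 hini (y := x) (s := s - t) (by linarith) le_rfl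
    (by simp [hr2.le])
  rw [add_sub_cancel, sub_self, norm_zero, zero_mul, add_zero, zero_pow two_ne_zero, sub_zero,
    div_self hr2.ne', one_pow, mul_one, mul_comm] at key
  refine le_trans (mul_le_mul_of_nonneg_right (Real.exp_le_exp.2 ?_) hk.le) key
  have h2 : (s - t) / r ^ 2 ≤ N := by rw [div_le_iff₀ hr2]; linarith
  linarith [mul_le_mul_of_nonneg_left h2 hκ0]

/-- Harnack inequality up to the final time of the cylinder. -/
theorem harnack_end (m : ℕ) {lam Lam : ℝ} (hlam : 0 < lam) (hLam : 0 ≤ Lam) :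
    ∃ C ≥ (1 : ℝ), ∀ A : Spc m → Matrix (Fin (m + 1)) (Fin (m + 1)) ℝ, IsElliptic lam Lam A →
    ∀ (u : Spc m × ℝ → ℝ) (x0 : Spc m) (t0 r : ℝ), 0 < r →
    NNSol A u (ball x0 (40 * r) ×ˢ Ioo (t0 - r ^ 2) (t0 + 9 * r ^ 2)) →
    ∀ x, dist x x0 ≤ r / 2 → ∀ y t, dist y x0 ≤ r / 2 → t0 + 4 * r ^ 2 ≤ t → t < t0 + 9 * r ^ 2 →
    u (x, t0) ≤ C * u (y, t) := by
  obtain ⟨C, hC, H⟩ := harnack m hlam hLam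
  obtain ⟨c, hc, H'⟩ := axis_lower m (Lam := Lam) hlam 16
  refine ⟨max C (C / c), hC.trans (le_max_left _ _), ?_⟩
  intro A hA u x0 t0 r hr hu x hx y t hy ht1 ht2
  have hr2 : 0 < r ^ 2 := by positivity
  have hC0 : 0 < C := by linarith
  have hnn : 0 ≤ u (y, t) := hu.2.2 _ ⟨mem_ball.2 (by linarith), by linarith, by linarith⟩
  rcases le_total t (t0 + 7 * r ^ 2) with h | h
  · exact (H A hA u x0 t0 r hr hu x hx y t (by linarith) ht1 h).trans
      (mul_le_mul_of_nonneg_right (le_max_left _ _) hnn)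
  · have hsub : (closedBall y (r / 2) ×ˢ Icc (t0 + 5 * r ^ 2) t : Set (Spc m × ℝ)) ⊆
        ball x0 (40 * r) ×ˢ Ioo (t0 - r ^ 2) (t0 + 9 * r ^ 2) := by
      refine prod_mono (closedBall_subset_ball' (by linarith)) fun s hs => ⟨?_, ?_⟩
      · linarith [hs.1]
      · linarith [hs.2]
    have hu' := hu.mono hsub
    have h0 : 0 ≤ u (x, t0) := hu.2.2 _ ⟨mem_ball.2 (by linarith), by linarith, by linarith⟩
    have h1 := H' A hA u y (t0 + 5 * r ^ 2) t (r / 2) (u (x, t0) / C) (by positivity)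
      (by positivity) (by linarith) (by linarith) hu'.1 hu'.2.2 (fun p hp _ => hu'.2.1 p hp)
      (fun w hw => by
        rw [div_le_iff₀ hC0, mul_comm]
        refine H A hA u x0 t0 r hr hu x hx w _ ?_ (by linarith) (by linarith)
        have := dist_triangle w y x0
        have h2 : dist w y ≤ r / 2 := hw
        linarith)
    have h2 : u (x, t0) ≤ C / c * u (y, t) := by
      rw [div_mul_eq_mul_div, le_div_iff₀ hc]
      rw [← mul_div_assoc, div_le_iff₀ hC0] at h1
      linarith
    exact h2.trans (mul_le_mul_of_nonneg_right (le_max_right _ _) hnn)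

end HarnackEnd

section LocalContinuity

open Filter Topology Set MeasureTheory Metric

variable {m : ℕ} {A : Spc m → Matrix (Fin (m + 1)) (Fin (m + 1)) ℝ} {lam Lam : ℝ}

/-- A closed space-time box around `(x, t)` of parabolic size comparable to `δ`. -/
def qbox (x : Spc m) (t δ : ℝ) : Set (Spc m × ℝ) :=
  closedBall x (300 * δ) ×ˢ Icc (t - 100 * δ ^ 2) (t + 100 * δ ^ 2)

/-- `w` is `ε`-close to `c` on all lines through points of `Z` in the box of size `δ`. -/
def NearConst (w : Spc m × ℝ → ℝ) (Z : Set (Spc m × ℝ)) (x : Spc m) (t δ c ε : ℝ) : Prop :=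
  ∀ p ∈ Z, p ∈ qbox x t δ → ∀ q ∈ qbox x t δ, q.1 = p.1 ∨ q.2 = p.2 → |w q - c| ≤ ε

theorem exists_slab {Z : Set (Spc m × ℝ)} (hZ : IsClosed Z) {x1 : Spc m} {t1 δ : ℝ} (hδ : 0 < δ)
    {y : Spc m} {s : ℝ} (hy : dist y x1 ≤ δ) (hs : |s - t1| ≤ δ ^ 2)
    (hsT : ∀ x ∈ closedBall x1 (300 * δ), (x, s) ∉ Z) :
    ∃ a b z, a < s ∧ s < b ∧ t1 - 100 * δ ^ 2 ≤ a ∧ b ≤ t1 + 100 * δ ^ 2 ∧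
      (∀ x ∈ closedBall x1 (300 * δ), ∀ t ∈ Ioo a b, (x, t) ∉ Z) ∧
      ((∃ x ∈ closedBall x1 (300 * δ), (x, a) ∈ Z) ∨ 50 * δ ^ 2 ≤ s - a) ∧
      ((∃ x ∈ closedBall x1 (300 * δ), (x, b) ∈ Z) ∨ 50 * δ ^ 2 ≤ b - s) ∧
      dist z y ≤ δ ∧ (z = x1 ∨ z ∈ closedBall x1 (300 * δ) ∧ (z, a) ∈ Z) ∧
      ∀ x ∈ ball y (dist z y), (x, a) ∉ Z := by
  have hδ2 : 0 < δ ^ 2 := by positivity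
  obtain ⟨hs1, hs2⟩ := abs_le.1 hs
  have hQ : IsCompact (qbox x1 t1 δ) := (isCompact_closedBall _ _).prod isCompact_Icc
  set T : Set ℝ := Prod.snd '' (Z ∩ qbox x1 t1 δ) ∪ {t1 - 100 * δ ^ 2, t1 + 100 * δ ^ 2} with hT
  have hTc : IsCompact T :=
    ((hQ.inter_left hZ).image continuous_snd).union ((finite_singleton _).insert _).isCompact
  have hTmem : ∀ t ∈ T, (∃ x ∈ closedBall x1 (300 * δ), (x, t) ∈ Z) ∨ t = t1 - 100 * δ ^ 2 ∨
      t = t1 + 100 * δ ^ 2 := by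
    rintro t (⟨p, ⟨hp1, hp2⟩, rfl⟩ | h)
    · exact Or.inl ⟨p.1, hp2.1, hp1⟩
    · exact Or.inr h
  have hsnT : s ∉ T := by
    intro h
    rcases hTmem s h with ⟨x, hx, hxZ⟩ | h | h
    · exact hsT x hx hxZ
    · linarith
    · linarith
  have hTb : ∀ t ∈ T, t1 - 100 * δ ^ 2 ≤ t ∧ t ≤ t1 + 100 * δ ^ 2 := by
    rintro t (⟨p, ⟨hp1, hp2⟩, rfl⟩ | rfl | rfl)
    · exact hp2.2
    · constructor <;> linarith
    · constructor <;> linarith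
  obtain ⟨a, ⟨haT, has⟩, ha⟩ := (hTc.inter_right isClosed_Iic).exists_isGreatest
    ⟨t1 - 100 * δ ^ 2, Or.inr (Or.inl rfl), (show t1 - 100 * δ ^ 2 ≤ s by linarith)⟩
  obtain ⟨b, ⟨hbT, hbs⟩, hb⟩ := (hTc.inter_right isClosed_Ici).exists_isLeast
    ⟨t1 + 100 * δ ^ 2, Or.inr (Or.inr rfl), (show s ≤ t1 + 100 * δ ^ 2 by linarith)⟩
  have has' : a < s := lt_of_le_of_ne has (by rintro rfl; exact hsnT haT)
  have hbs' : s < b := lt_of_le_of_ne hbs (by rintro rfl; exact hsnT hbT)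
  set F : Set (Spc m) := {x | x ∈ closedBall x1 (300 * δ) ∧ (x, a) ∈ Z} ∪ {x1} with hFdef
  have hx1F : x1 ∈ F := Or.inr rfl
  have hF : IsCompact F := by
    have hcl : IsClosed {x : Spc m | (x, a) ∈ Z} :=
      hZ.preimage (Continuous.prodMk continuous_id continuous_const)
    exact IsCompact.union ((isCompact_closedBall x1 (300 * δ)).inter_right hcl) isCompact_singleton
  obtain ⟨z, hz, hzd⟩ := hF.exists_infDist_eq_dist ⟨x1, hx1F⟩ y
  have hzy : dist z y ≤ δ := by
    rw [dist_comm, ← hzd]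
    exact (infDist_le_dist_of_mem hx1F).trans hy
  refine ⟨a, b, z, has', hbs', (hTb a haT).1, (hTb b hbT).2, ?_, ?_, ?_, hzy, ?_, ?_⟩
  · intro x hx t ht hxt
    have htT : t ∈ T := Or.inl ⟨(x, t), ⟨hxt, hx, by
      constructor
      · exact (hTb a haT).1.trans ht.1.le
      · exact ht.2.le.trans (hTb b hbT).2⟩, rfl⟩
    rcases le_total t s with h | h
    · exact absurd (ha ⟨htT, h⟩) (not_le.2 ht.1)
    · exact absurd (hb ⟨htT, h⟩) (not_le.2 ht.2)
  · rcases hTmem a haT with h | h | h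
    · exact Or.inl h
    · right; linarith
    · linarith
  · rcases hTmem b hbT with h | h | h
    · exact Or.inl h
    · linarith
    · right; linarith
  · rcases hz with h | h
    · exact Or.inr h
    · exact Or.inl h
  · intro x hx hxa
    have hx' : dist x y < dist z y := hx
    have hxb : x ∈ closedBall x1 (300 * δ) := by
      have := dist_triangle x y x1
      rw [mem_closedBall]; linarith
    have := infDist_le_dist_of_mem (x := y) (show x ∈ F from Or.inl ⟨hxb, hxa⟩)
    rw [hzd, dist_comm y z, dist_comm y x] at this
    linarith

theorem nearConst_line {w : Spc m × ℝ → ℝ} {Z : Set (Spc m × ℝ)} {x1 z : Spc m}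
    {t1 δ c ε a : ℝ} (hδ : 0 < δ) (hz1 : (x1, t1) ∈ Z)
    (hN : NearConst w Z x1 t1 δ c ε) (ha1 : t1 - 100 * δ ^ 2 ≤ a) (ha2 : a ≤ t1 + 100 * δ ^ 2)
    (hz : z = x1 ∨ z ∈ closedBall x1 (300 * δ) ∧ (z, a) ∈ Z) {t : ℝ}
    (ht1 : t1 - 100 * δ ^ 2 ≤ t) (ht2 : t ≤ t1 + 100 * δ ^ 2) : |w (z, t) - c| ≤ ε := by
  have hδ2 : 0 < δ ^ 2 := by positivity
  rcases hz with rfl | ⟨h1, h2⟩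
  · exact hN _ hz1 ⟨mem_closedBall_self (by linarith), by linarith, by linarith⟩ _
      ⟨mem_closedBall_self (by linarith), ht1, ht2⟩ (Or.inl rfl)
  · exact hN _ h2 ⟨h1, ha1, ha2⟩ _ ⟨h1, ht1, ht2⟩ (Or.inl rfl)

/-- Improvement of a one-sided bound near a point where the solution is nearly constant along
lines through the possible discontinuities. -/
theorem one_sided_improvement (m : ℕ) {lam Lam : ℝ} (hlam : 0 < lam) (hLam : 0 ≤ Lam) :
    ∃ θ > (0 : ℝ), θ ≤ 1 ∧ ∀ A : Spc m → Matrix (Fin (m + 1)) (Fin (m + 1)) ℝ,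
    IsElliptic lam Lam A → ∀ (w : Spc m × ℝ → ℝ) (Z : Set (Spc m × ℝ)) (x1 : Spc m)
    (t1 δ c ε G : ℝ), IsClosed Z → 0 < δ → ε ≤ G → (x1, t1) ∈ Z →
    (∀ p ∈ qbox x1 t1 δ, SolAt A w p) → (∀ p ∈ qbox x1 t1 δ, p ∉ Z → ContinuousAt w p) →
    (∀ p ∈ qbox x1 t1 δ, w p ≤ c + G) → NearConst w Z x1 t1 δ c ε →
    ∀ y s, dist y x1 ≤ δ → |s - t1| ≤ δ ^ 2 → w (y, s) ≤ c + G - θ * (G - ε) := by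
  obtain ⟨C, hC, H⟩ := harnack_end m hlam hLam
  obtain ⟨c0, hc0, H'⟩ := axis_lower m (Lam := Lam) hlam 160
  have hC0 : 0 < C := by linarith
  refine ⟨min C⁻¹ c0, lt_min (inv_pos.2 hC0) hc0,
    (min_le_left _ _).trans (inv_le_one_of_one_le₀ hC), ?_⟩
  intro A hA w Z x1 t1 δ c ε G hZ hδ hεG hz1 hsol hcont hbd hN y s hy hs
  set θ := min C⁻¹ c0 with hθ
  have hθ1 : θ ≤ 1 := (min_le_left _ _).trans (inv_le_one_of_one_le₀ hC)
  have hθ0 : 0 < θ := lt_min (inv_pos.2 hC0) hc0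
  have hδ2 : 0 < δ ^ 2 := by positivity
  obtain ⟨hs1, hs2⟩ := abs_le.1 hs
  have hgood : ∀ q, |w q - c| ≤ ε → w q ≤ c + G - θ * (G - ε) := fun q hq => by
    have := (abs_le.1 hq).2
    nlinarith only [this, hθ1, hεG]
  have hyQ : y ∈ closedBall x1 (300 * δ) := by rw [mem_closedBall]; linarith
  by_cases hsT : ∃ x ∈ closedBall x1 (300 * δ), (x, s) ∈ Z
  · obtain ⟨x, hx, hxs⟩ := hsT
    exact hgood _ (hN _ hxs ⟨hx, by linarith, by linarith⟩ _ ⟨hyQ, by linarith, by linarith⟩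
      (Or.inr rfl))
  push Not at hsT
  obtain ⟨a, b, z, has, hsb, ha1, hb1, hfree, haT, -, hzy, hz, hball⟩ :=
    exists_slab hZ hδ hy hs hsT
  have hline : ∀ t, t1 - 100 * δ ^ 2 ≤ t → t ≤ t1 + 100 * δ ^ 2 → |w (z, t) - c| ≤ ε :=
    fun t h1 h2 => nearConst_line hδ hz1 hN ha1 (by linarith) hz h1 h2
  set h : Spc m × ℝ → ℝ := fun p => (-1) * w p + (c + G) with hh
  have hslabQ : ∀ p ∈ (ball x1 (300 * δ) ×ˢ Ico a b : Set (Spc m × ℝ)), p ∈ qbox x1 t1 δ := by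
    rintro p ⟨h1, h2, h3⟩
    exact ⟨ball_subset_closedBall h1, by linarith, by linarith⟩
  have hhc : ∀ p ∈ (ball x1 (300 * δ) ×ˢ Ico a b : Set (Spc m × ℝ)), p ∉ Z → ContinuousAt h p :=
    fun p hp hpZ => (continuousAt_const.mul (hcont p (hslabQ p hp) hpZ)).add continuousAt_const
  have hhs : ∀ p ∈ (ball x1 (300 * δ) ×ˢ Ico a b : Set (Spc m × ℝ)), SolAt A h p :=
    fun p hp => (hsol p (hslabQ p hp)).affine (-1) (c + G)
  have hh0 : ∀ p ∈ (ball x1 (300 * δ) ×ˢ Ico a b : Set (Spc m × ℝ)), 0 ≤ h p := fun p hp => by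
    have := hbd p (hslabQ p hp)
    simp only [hh]; linarith
  have hnn : NNSol A h (ball x1 (300 * δ) ×ˢ Ioo a b) := by
    have hio : ∀ p ∈ (ball x1 (300 * δ) ×ˢ Ioo a b : Set (Spc m × ℝ)),
      p ∈ (ball x1 (300 * δ) ×ˢ Ico a b : Set (Spc m × ℝ)) := fun p hp => ⟨hp.1, hp.2.1.le, hp.2.2⟩
    exact ⟨fun p hp => (hhc p (hio p hp) (hfree p.1 (ball_subset_closedBall hp.1) p.2
      hp.2)).continuousWithinAt, fun p hp => hhs p (hio p hp), fun p hp => hh0 p (hio p hp)⟩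
  have hlow : ∀ q, |w q - c| ≤ ε → G - ε ≤ h q := fun q hq => by
    have := (abs_le.1 hq).2
    simp only [hh]; linarith
  suffices hmain : θ * (G - ε) ≤ h (y, s) by
    simp only [hh] at hmain; linarith
  have hGε : 0 ≤ G - ε := by linarith
  set d := dist z y with hd
  rcases (dist_nonneg : 0 ≤ dist z y).eq_or_lt with hd0 | hd0
  · have hzy' : z = y := dist_eq_zero.1 hd0.symm
    have h1 := hlow _ (hline s (by linarith) (by linarith))
    rw [hzy'] at h1
    nlinarith only [h1, hθ1, hGε]
  rw [← hd] at hd0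
  have hdd : d ^ 2 ≤ δ ^ 2 := by nlinarith only [hd0, hzy]
  have hd2 : 0 < d ^ 2 := by positivity
  by_cases hcase : 40 * d ^ 2 ≤ s - a
  · set b' := min b (s + (2 * d) ^ 2) with hb'
    have hb'1 : b' ≤ b := min_le_left _ _
    have hb'2 : b' ≤ s + (2 * d) ^ 2 := min_le_right _ _
    have hb'3 : s < b' := lt_min hsb (by linarith only [hd2, mul_pow 2 d 2])
    have e1 : (2 * d) ^ 2 = 4 * d ^ 2 := by ring
    rw [e1] at hb'2
    have h1 := H A hA h z (b' - 9 * (2 * d) ^ 2) (2 * d) (by linarith)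
      (hnn.mono (prod_mono (ball_subset_ball' (by
          have := dist_triangle z y x1
          linarith))
        (Ioo_subset_Ioo (by rw [e1]; linarith) (by linarith))))
      z (by rw [dist_self]; linarith) y s (by rw [dist_comm]; linarith) (by rw [e1]; linarith)
      (by linarith)
    rw [e1] at h1
    have h2 := (hlow _ (hline (b' - 9 * (4 * d ^ 2)) (by linarith) (by linarith))).trans h1
    calc θ * (G - ε) ≤ C⁻¹ * (G - ε) := mul_le_mul_of_nonneg_right (min_le_left _ _) hGε
      _ ≤ h (y, s) := by rwa [inv_mul_le_iff₀ hC0]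
  · obtain ⟨x, hx, hxa⟩ : ∃ x ∈ closedBall x1 (300 * δ), (x, a) ∈ Z := by
      rcases haT with h | h
      · exact h
      · linarith
    have hbx : ∀ x' ∈ closedBall y (d / 2), x' ∈ ball x1 (300 * δ) := by
      intro x' hx'
      have h1 : dist x' y ≤ d / 2 := hx'
      have := dist_triangle x' y x1
      rw [mem_ball]; linarith
    have hsub : ∀ p ∈ (closedBall y (d / 2) ×ˢ Icc a s : Set (Spc m × ℝ)),
        p ∈ (ball x1 (300 * δ) ×ˢ Ico a b : Set (Spc m × ℝ)) := fun p hp =>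
      ⟨hbx _ hp.1, hp.2.1, lt_of_le_of_lt hp.2.2 hsb⟩
    have h1 := H' A hA h y a s (d / 2) (G - ε) (by linarith) hGε has.le (by linarith)
      (fun p hp => by
        refine (hhc p (hsub p hp) ?_).continuousWithinAt
        rcases eq_or_lt_of_le hp.2.1 with h | h
        · have h3 : p = (p.1, a) := by rw [h]
          rw [h3]
          refine hball p.1 ?_
          have h2 : dist p.1 y ≤ d / 2 := hp.1
          rw [mem_ball]; linarith
        · exact hfree p.1 (ball_subset_closedBall (hsub p hp).1) p.2 ⟨h, (hsub p hp).2.2⟩)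
      (fun p hp => hh0 p (hsub p hp)) (fun p hp _ => hhs p (hsub p hp))
      (fun x' hx' => hlow _ (hN _ hxa ⟨hx, ha1, by linarith⟩ _
        ⟨ball_subset_closedBall (hbx x' hx'), ha1, by linarith⟩ (Or.inr rfl)))
    exact (mul_le_mul_of_nonneg_right (min_le_right _ _) hGε).trans h1

end LocalContinuity

section ContinuityOfSolutions

open Filter Topology Set MeasureTheory Metric

variable {m : ℕ} {A : Spc m → Matrix (Fin (m + 1)) (Fin (m + 1)) ℝ} {lam Lam : ℝ}

/-- If the vertical line over `y` takes a value at most `M` at the final time, the Harnack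
inequality bounds earlier values. -/
theorem harnack_top (m : ℕ) {lam Lam : ℝ} (hlam : 0 < lam) (hLam : 0 ≤ Lam) :
    ∃ C ≥ (1 : ℝ), ∀ A : Spc m → Matrix (Fin (m + 1)) (Fin (m + 1)) ℝ,
    IsElliptic lam Lam A → ∀ (u : Spc m × ℝ → ℝ) (y : Spc m) (a b s R : ℝ),
    NNSol A u (ball y R ×ˢ Ioo a b) → a < s → s < b → b - s ≤ 9 * (s - a) →
    1600 * (b - s) ≤ 9 * R ^ 2 → 0 < R → ContinuousAt (fun t => u (y, t)) b →
    u (y, s) ≤ C * u (y, b) := by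
  obtain ⟨C, hC, H⟩ := harnack_end m hlam hLam
  refine ⟨C, hC, ?_⟩
  intro A hA u y a b s R hu has hsb h1 h2 hR hcont
  set r : ℝ := √((b - s) / 9) with hr
  have hr2 : r ^ 2 = (b - s) / 9 := Real.sq_sqrt (by linarith)
  have hr0 : 0 < r := Real.sqrt_pos.2 (by linarith)
  have hrR : 40 * r ≤ R := abs_le_of_sq_le_sq' (by rw [mul_pow, hr2]; linarith) hR.le |>.2
  have hlim : Tendsto (fun t => C * u (y, t)) (𝓝[<] b) (𝓝 (C * u (y, b))) :=
    (hcont.tendsto.mono_left nhdsWithin_le_nhds).const_mul C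
  refine ge_of_tendsto hlim ?_
  have hmem : Ioo (s + 4 * r ^ 2) b ∈ 𝓝[<] b := Ioo_mem_nhdsLT (by rw [hr2]; linarith)
  filter_upwards [hmem] with t ht
  refine H A hA u y s r hr0 (hu.mono (prod_mono (ball_subset_ball hrR)
    (Ioo_subset_Ioo (by rw [hr2]; linarith) (by rw [hr2]; linarith)))) y (by simp; linarith) y t
    (by simp; linarith) ht.1.le (by rw [hr2]; linarith [ht.2])

/-- Local upper bound near a point where the solution is nearly constant along lines through the
possible discontinuities. -/
theorem local_upper_bound (m : ℕ) {lam Lam : ℝ} (hlam : 0 < lam) (hLam : 0 ≤ Lam) :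
    ∃ C > (0 : ℝ), ∀ A : Spc m → Matrix (Fin (m + 1)) (Fin (m + 1)) ℝ,
    IsElliptic lam Lam A → ∀ (u : Spc m × ℝ → ℝ) (Z : Set (Spc m × ℝ)) (x1 : Spc m)
    (t1 δ c : ℝ), IsClosed Z → 0 < δ → (x1, t1) ∈ Z →
    (∀ p ∈ qbox x1 t1 δ, SolAt A u p) → (∀ p ∈ qbox x1 t1 δ, p ∉ Z → ContinuousAt u p) →
    (∀ p ∈ qbox x1 t1 δ, 0 ≤ u p) → NearConst u Z x1 t1 δ c 1 →
    ∀ y s, dist y x1 ≤ δ → |s - t1| ≤ δ ^ 2 → u (y, s) ≤ C * (c + 2) := by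
  obtain ⟨C1, hC1, H1⟩ := harnack m hlam hLam
  obtain ⟨C2, hC2, H2⟩ := harnack_top m hlam hLam
  obtain ⟨C3, hC3, H3⟩ := initial_bound m hlam hLam
  refine ⟨C1 + C2 + C3 + 2 * C3 * C2 + 2 * C3, by positivity, ?_⟩
  intro A hA u Z x1 t1 δ c hZ hδ hz1 hsol hcont h0 hN y s hy hs
  have hδ2 : 0 < δ ^ 2 := by positivity
  obtain ⟨hs1, hs2⟩ := abs_le.1 hs
  have hx1Q : (x1, t1) ∈ qbox x1 t1 δ :=
    ⟨mem_closedBall_self (by linarith), by linarith, by linarith⟩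
  have hup : ∀ q, |u q - c| ≤ 1 → u q ≤ c + 1 := fun q hq => by linarith [(abs_le.1 hq).2]
  have hc1 : 0 ≤ c + 1 := (h0 _ hx1Q).trans (hup _ (hN _ hz1 hx1Q _ hx1Q (Or.inl rfl)))
  have hc2 : 0 ≤ c + 2 := by linarith
  have hC32 : 0 ≤ C3 * C2 := by positivity
  have hfin : ∀ X, X ≤ C1 * (c + 2) ∨ X ≤ C2 * (c + 2) ∨ X ≤ 2 * C3 * (c + 2) ∨
      X ≤ (C3 + C3 * C2) * (c + 2) → X ≤ (C1 + C2 + C3 + 2 * C3 * C2 + 2 * C3) * (c + 2) := by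
    rintro X (h | h | h | h) <;> refine h.trans (mul_le_mul_of_nonneg_right ?_ hc2) <;>
      nlinarith only [hC1, hC2, hC3, hC32]
  have hgood : ∀ q, |u q - c| ≤ 1 → u q ≤ (C1 + C2 + C3 + 2 * C3 * C2 + 2 * C3) * (c + 2) :=
    fun q hq => hfin _ (Or.inl (by nlinarith only [hup q hq, hC1, hc2]))
  have hyQ : y ∈ closedBall x1 (300 * δ) := by rw [mem_closedBall]; linarith
  by_cases hsT : ∃ x ∈ closedBall x1 (300 * δ), (x, s) ∈ Z
  · obtain ⟨x, hx, hxs⟩ := hsT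
    exact hgood _ (hN _ hxs ⟨hx, by linarith, by linarith⟩ _ ⟨hyQ, by linarith, by linarith⟩
      (Or.inr rfl))
  push Not at hsT
  obtain ⟨a, b, z, has, hsb, ha1, hb1, hfree, haT, hbT, hzy, hz, hball⟩ :=
    exists_slab hZ hδ hy hs hsT
  have hline : ∀ t, t1 - 100 * δ ^ 2 ≤ t → t ≤ t1 + 100 * δ ^ 2 → u (z, t) ≤ c + 1 :=
    fun t h1 h2 => hup _ (nearConst_line hδ hz1 hN ha1 (by linarith) hz h1 h2)
  have hnn : NNSol A u (ball x1 (300 * δ) ×ˢ Ioo a b) := by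
    have hio : ∀ p ∈ (ball x1 (300 * δ) ×ˢ Ioo a b : Set (Spc m × ℝ)),
      p ∈ qbox x1 t1 δ := fun p hp => ⟨ball_subset_closedBall hp.1, by linarith [hp.2.1], by
        linarith [hp.2.2]⟩
    exact ⟨fun p hp => (hcont p (hio p hp) (hfree p.1 (ball_subset_closedBall hp.1) p.2
      hp.2)).continuousWithinAt, fun p hp => hsol p (hio p hp), fun p hp => h0 p (hio p hp)⟩
  set d := dist z y with hd
  rcases (dist_nonneg : 0 ≤ dist z y).eq_or_lt with hd0 | hd0
  · have hzy' : z = y := dist_eq_zero.1 hd0.symm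
    have h1 := nearConst_line hδ hz1 hN ha1 (by linarith) hz (t := s) (by linarith) (by linarith)
    rw [hzy'] at h1
    exact hgood _ h1
  rw [← hd] at hd0
  have hdd : d ^ 2 ≤ δ ^ 2 := by nlinarith only [hd0, hzy]
  have hd2 : 0 < d ^ 2 := by positivity
  have hbally : ball y (299 * δ) ⊆ ball x1 (300 * δ) := ball_subset_ball' (by linarith)
  have htop : b - s < 9 * d ^ 2 → ∀ s', a < s' → s' < b → b - s' ≤ 9 * (s' - a) →
      u (y, s') ≤ C2 * (c + 2) := by
    intro hbs s' h1 h2 h3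
    obtain ⟨x, hx, hxb⟩ : ∃ x ∈ closedBall x1 (300 * δ), (x, b) ∈ Z := by
      rcases hbT with h | h
      · exact h
      · linarith
    have hyb : (y, b) ∈ qbox x1 t1 δ := ⟨hyQ, by linarith, hb1⟩
    have h4 := H2 A hA u y a b s' (299 * δ) (hnn.mono (prod_mono hbally le_rfl)) h1 h2 h3
      (by rw [mul_pow]; nlinarith only [hδ2, hb1, ha1, h1]) (by linarith)
      (hsol _ hyb).2.continuousAt
    have h5 := hup _ (hN _ hxb ⟨hx, by linarith, hb1⟩ _ hyb (Or.inr rfl))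
    exact h4.trans (mul_le_mul_of_nonneg_left (by linarith) (by linarith))
  by_cases hcase : d ^ 2 ≤ s - a
  · by_cases hcase2 : 9 * d ^ 2 ≤ b - s
    · refine hfin _ (Or.inl ?_)
      have h1 := H1 A hA u y s d hd0 (hnn.mono (prod_mono
        ((ball_subset_ball (by linarith)).trans hbally) (Ioo_subset_Ioo (by linarith)
        (by linarith)))) y (by simp; linarith) z (s + 5 * d ^ 2) le_rfl (by linarith) (by linarith)
      have h2 := hline (s + 5 * d ^ 2) (by linarith) (by linarith)
      exact h1.trans (mul_le_mul_of_nonneg_left (by linarith) (by linarith))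
    · exact hfin _ (Or.inr (Or.inl (htop (by linarith) s has hsb (by linarith))))
  obtain ⟨x, hx, hxa⟩ : ∃ x ∈ closedBall x1 (300 * δ), (x, a) ∈ Z := by
    rcases haT with h | h
    · exact h
    · linarith
  have hini : ∀ r ≤ d, ∀ x' ∈ ball y r, ∀ᶠ p in 𝓝 (x', a), a < p.2 → u p ≤ c + 2 := by
    intro r hr x' hx'
    have hx'd : x' ∈ ball y d := ball_subset_ball hr hx'
    have hx'Q : (x', a) ∈ qbox x1 t1 δ :=
      ⟨ball_subset_closedBall (hbally (ball_subset_ball (by linarith) hx'd)), ha1, by linarith⟩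
    have h1 : u (x', a) < c + 2 := by
      have := hup _ (hN _ hxa ⟨hx, ha1, by linarith⟩ _ hx'Q (Or.inr rfl))
      linarith
    filter_upwards [(hcont _ hx'Q (hball x' hx'd)).eventually_lt_const h1] with p hp _
    exact hp.le
  by_cases hcase2 : 9 * d ^ 2 ≤ b - a
  · refine hfin _ (Or.inr (Or.inr (Or.inl ?_)))
    have h1 := H3 A hA u y a d hd0 (hnn.mono (prod_mono
        ((ball_subset_ball (by linarith)).trans hbally) (Ioo_subset_Ioo (by linarith)
        (by linarith)))) (c + 2) hc2 (hini d le_rfl) y s (by simp; linarith) has (by linarith) z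
        (a + 5 * d ^ 2) le_rfl (by linarith) (by linarith)
    have h2 := hline (a + 5 * d ^ 2) (by linarith) (by linarith)
    refine h1.trans ?_
    nlinarith only [h2, hC3]
  · have hbs : b - s < 9 * d ^ 2 := by linarith
    set r : ℝ := √((b - a) / 9) with hr
    have hr2 : r ^ 2 = (b - a) / 9 := Real.sq_sqrt (by linarith)
    have hr0 : 0 < r := Real.sqrt_pos.2 (by linarith)
    have hrd : r ≤ d := abs_le_of_sq_le_sq' (by rw [hr2]; linarith) hd0.le |>.2
    by_cases hcase3 : s - a < r ^ 2
    · have h1 := H3 A hA u y a r hr0 (hnn.mono (prod_mono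
        ((ball_subset_ball (by linarith)).trans hbally) (Ioo_subset_Ioo (by linarith)
        (by linarith)))) (c + 2) hc2 (hini r hrd) y s (by simp; linarith) has (by linarith) y
        (a + 5 * r ^ 2) (by simp; linarith) (by linarith) (by linarith)
      have h2 := htop hbs (a + 5 * r ^ 2) (by linarith) (by linarith) (by linarith)
      refine hfin _ (Or.inr (Or.inr (Or.inr (h1.trans ?_))))
      nlinarith only [h2, hC3]
    · exact hfin _ (Or.inr (Or.inl (htop hbs s has hsb (by linarith))))

end ContinuityOfSolutions

section BaireContinuity

open Filter Topology Set MeasureTheory Metric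

variable {m : ℕ} {A : Spc m → Matrix (Fin (m + 1)) (Fin (m + 1)) ℝ} {lam Lam : ℝ}

theorem eventually_forall_qbox {P : Spc m × ℝ → Prop} {x : Spc m} {t : ℝ}
    (h : ∀ᶠ p in 𝓝 (x, t), P p) : ∀ᶠ δ in 𝓝[>] (0 : ℝ), ∀ p ∈ qbox x t δ, P p := by
  obtain ⟨r, hr, hP⟩ := Metric.eventually_nhds_iff.1 h
  have h1 : Tendsto (fun δ : ℝ => 300 * δ) (𝓝[>] 0) (𝓝 (300 * 0)) :=
    ((continuous_const.mul continuous_id).tendsto 0).mono_left nhdsWithin_le_nhds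
  have h2 : Tendsto (fun δ : ℝ => 100 * δ ^ 2) (𝓝[>] 0) (𝓝 (100 * 0 ^ 2)) :=
    ((continuous_const.mul (continuous_id.pow 2)).tendsto 0).mono_left nhdsWithin_le_nhds
  rw [mul_zero] at h1
  rw [zero_pow two_ne_zero, mul_zero] at h2
  filter_upwards [h1.eventually_lt_const hr, h2.eventually_lt_const hr] with δ h3 h4 p hp
  refine hP ?_
  rw [Prod.dist_eq]
  have h5 : dist p.1 x ≤ 300 * δ := hp.1
  refine max_lt (by simp only; linarith) ?_
  simp only
  rw [Real.dist_eq, abs_lt]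
  constructor <;> linarith [hp.2.1, hp.2.2]

theorem eventually_dist_le (x : Spc m) (t : ℝ) {δ : ℝ} (hδ : 0 < δ) :
    ∀ᶠ p in 𝓝 (x, t), dist p.1 x ≤ δ ∧ |p.2 - t| ≤ δ ^ 2 := by
  have h1 : ∀ᶠ p in 𝓝 (x, t), p.1 ∈ ball x δ :=
    continuous_fst.continuousAt.eventually_mem (ball_mem_nhds x hδ)
  have h2 : ∀ᶠ p in 𝓝 (x, t), p.2 ∈ ball t (δ ^ 2) :=
    continuous_snd.continuousAt.eventually_mem (ball_mem_nhds t (by positivity))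
  filter_upwards [h1, h2] with p hp1 hp2
  exact ⟨le_of_lt hp1, le_of_lt (by rwa [mem_ball, Real.dist_eq] at hp2)⟩

theorem eventually_le_of_nearConst (hlam : 0 < lam) (hLam : 0 ≤ Lam) (hA : IsElliptic lam Lam A)
    {w : Spc m × ℝ → ℝ} {Z : Set (Spc m × ℝ)} {x1 : Spc m} {t1 c G : ℝ} (hZ : IsClosed Z)
    (hz1 : (x1, t1) ∈ Z) (hsol : ∀ᶠ p in 𝓝 (x1, t1), SolAt A w p)
    (hcont : ∀ᶠ p in 𝓝 (x1, t1), p ∉ Z → ContinuousAt w p)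
    (hN : ∀ ε > 0, ∀ᶠ δ in 𝓝[>] (0 : ℝ), NearConst w Z x1 t1 δ c ε) (hG0 : 0 < G)
    (hG : ∀ᶠ p in 𝓝 (x1, t1), w p ≤ c + G) {η : ℝ} (hη : 0 < η) :
    ∀ᶠ p in 𝓝 (x1, t1), w p ≤ c + η := by
  obtain ⟨θ, hθ0, hθ1, H⟩ := one_sided_improvement m hlam hLam
  have hiter : ∀ n : ℕ, ∀ᶠ p in 𝓝 (x1, t1), w p ≤ c + (1 - θ / 2) ^ n * G := by
    intro n
    induction n with
    | zero => simpa using hG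
    | succ n ih =>
      set Gn := (1 - θ / 2) ^ n * G with hGn
      have hGn0 : 0 < Gn := mul_pos (pow_pos (by linarith) n) hG0
      have hpos : ∀ᶠ δ in 𝓝[>] (0 : ℝ), 0 < δ := self_mem_nhdsWithin
      obtain ⟨δ, hδ, h1, h2, h3, h4⟩ := (hpos.and
        ((eventually_forall_qbox hsol).and ((eventually_forall_qbox hcont).and
        ((eventually_forall_qbox ih).and (hN (Gn / 2) (by linarith)))))).exists
      filter_upwards [eventually_dist_le x1 t1 (show 0 < δ from hδ)] with p hp
      have h5 := H A hA w Z x1 t1 δ c (Gn / 2) Gn hZ hδ (by linarith) hz1 h1 h2 h3 h4 p.1 p.2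
        hp.1 hp.2
      have h6 : (1 - θ / 2) ^ (n + 1) * G = Gn - θ * (Gn - Gn / 2) := by rw [hGn, pow_succ]; ring
      rw [h6]
      linarith
  have hlim : Tendsto (fun n : ℕ => (1 - θ / 2) ^ n * G) atTop (𝓝 (0 * G)) :=
    (tendsto_pow_atTop_nhds_zero_of_lt_one (by linarith) (by linarith)).mul_const G
  rw [zero_mul] at hlim
  obtain ⟨n, hn⟩ := (hlim.eventually_lt_const hη).exists
  filter_upwards [hiter n] with p hp
  linarith

theorem continuousAt_of_nearConst (hlam : 0 < lam) (hLam : 0 ≤ Lam) (hA : IsElliptic lam Lam A)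
    {u : Spc m × ℝ → ℝ} {Z : Set (Spc m × ℝ)} {x1 : Spc m} {t1 : ℝ} (hZ : IsClosed Z)
    (hz1 : (x1, t1) ∈ Z) (hsol : ∀ᶠ p in 𝓝 (x1, t1), SolAt A u p)
    (h0 : ∀ᶠ p in 𝓝 (x1, t1), 0 ≤ u p)
    (hcont : ∀ᶠ p in 𝓝 (x1, t1), p ∉ Z → ContinuousAt u p)
    (hN : ∀ ε > 0, ∀ᶠ δ in 𝓝[>] (0 : ℝ), NearConst u Z x1 t1 δ (u (x1, t1)) ε) :
    ContinuousAt u (x1, t1) := by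
  obtain ⟨C, hC, H⟩ := local_upper_bound m hlam hLam
  set c := u (x1, t1) with hc
  have hc0 : 0 ≤ c := h0.self_of_nhds
  have hbd : ∀ᶠ p in 𝓝 (x1, t1), u p ≤ c + C * (c + 2) := by
    have hpos : ∀ᶠ δ in 𝓝[>] (0 : ℝ), 0 < δ := self_mem_nhdsWithin
    obtain ⟨δ, hδ, h1, h2, h3, h4⟩ := (hpos.and
      ((eventually_forall_qbox hsol).and ((eventually_forall_qbox hcont).and
      ((eventually_forall_qbox h0).and (hN 1 one_pos))))).exists
    filter_upwards [eventually_dist_le x1 t1 (show 0 < δ from hδ)] with p hp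
    have := H A hA u Z x1 t1 δ c hZ hδ hz1 h1 h2 h3 h4 p.1 p.2 hp.1 hp.2
    linarith
  have hsol' : ∀ᶠ p in 𝓝 (x1, t1), SolAt A (fun q => (-1) * u q + 0) p :=
    hsol.mono fun p hp => hp.affine (-1) 0
  have hcont' : ∀ᶠ p in 𝓝 (x1, t1), p ∉ Z → ContinuousAt (fun q => (-1) * u q + 0) p :=
    hcont.mono fun p hp hpZ => (continuousAt_const.mul (hp hpZ)).add continuousAt_const
  have hN' : ∀ ε > 0, ∀ᶠ δ in 𝓝[>] (0 : ℝ),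
      NearConst (fun q => (-1) * u q + 0) Z x1 t1 δ (-c) ε := fun ε hε =>
    (hN ε hε).mono fun δ h p hp hpq q hq hqp => by
      have := h p hp hpq q hq hqp
      have e : (-1) * u q + 0 - -c = -(u q - c) := by ring
      show |(-1) * u q + 0 - -c| ≤ ε
      rwa [e, abs_neg]
  rw [ContinuousAt, Metric.tendsto_nhds]
  intro ε hε
  filter_upwards [eventually_le_of_nearConst hlam hLam hA hZ hz1 hsol hcont hN
    (by positivity : 0 < C * (c + 2)) hbd (half_pos hε),
    eventually_le_of_nearConst hlam hLam hA hZ hz1 hsol' hcont' hN'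
    (by linarith : 0 < c + 1) (h0.mono fun p hp => by linarith) (half_pos hε)] with p h1 h2
  rw [Real.dist_eq, abs_lt]
  constructor <;> linarith

/-- Points at which `u` is `k`-Lipschitz, at scale `1 / (k + 1)`, along both coordinate slices. -/
def slicewiseLip (u : Spc m × ℝ → ℝ) (Ω : Set (Spc m × ℝ)) (k : ℕ) : Set (Spc m × ℝ) :=
  {p | (∀ s, |s - p.2| < 1 / (k + 1) → (p.1, s) ∈ Ω → |u (p.1, s) - u p| ≤ k * |s - p.2|) ∧
    ∀ y, dist y p.1 < 1 / (k + 1) → (y, p.2) ∈ Ω → |u (y, p.2) - u p| ≤ k * dist y p.1}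

theorem mem_slicewiseLip_of_tendsto {u : Spc m × ℝ → ℝ} {Ω : Set (Spc m × ℝ)} (hΩ : IsOpen Ω)
    (hx : ∀ p ∈ Ω, ContinuousAt (fun y => u (y, p.2)) p.1)
    (ht : ∀ p ∈ Ω, ContinuousAt (fun s => u (p.1, s)) p.2) {k : ℕ} {f : ℕ → Spc m × ℝ}
    {p : Spc m × ℝ} (hf : ∀ n, f n ∈ slicewiseLip u Ω k) (hp : p ∈ Ω)
    (hlim : Tendsto f atTop (𝓝 p)) : p ∈ slicewiseLip u Ω k := by
  have hk : (0 : ℝ) < 1 / (k + 1) := by positivity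
  have h1 : Tendsto (fun n => (f n).1) atTop (𝓝 p.1) := (continuous_fst.tendsto p).comp hlim
  have h2 : Tendsto (fun n => (f n).2) atTop (𝓝 p.2) := (continuous_snd.tendsto p).comp hlim
  have hslice : ∀ s : ℝ, Tendsto (fun n => ((f n).1, s)) atTop (𝓝 (p.1, s)) := fun s =>
    h1.prodMk_nhds tendsto_const_nhds
  have hslice' : ∀ y : Spc m, Tendsto (fun n => (y, (f n).2)) atTop (𝓝 (y, p.2)) := fun y =>
    tendsto_const_nhds.prodMk_nhds h2
  have hu1 : ∀ s, (p.1, s) ∈ Ω → Tendsto (fun n => u ((f n).1, s)) atTop (𝓝 (u (p.1, s))) :=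
    fun s hs => (hx _ hs).tendsto.comp h1
  have hu2 : ∀ y : Spc m, (y, p.2) ∈ Ω → Tendsto (fun n => u (y, (f n).2)) atTop (𝓝 (u (y, p.2))) :=
    fun y hy => (ht _ hy).tendsto.comp h2
  have hd2 : ∀ s, Tendsto (fun n => |s - (f n).2|) atTop (𝓝 |s - p.2|) := fun s =>
    (tendsto_const_nhds.sub h2).abs
  have hd1 : ∀ y : Spc m, Tendsto (fun n => dist y (f n).1) atTop (𝓝 (dist y p.1)) := fun y =>
    tendsto_const_nhds.dist h1
  have hu : Tendsto (fun n => u (f n)) atTop (𝓝 (u p)) := by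
    have h3 : Tendsto (fun n => u ((f n).1, p.2) - u (f n)) atTop (𝓝 0) := by
      have h4 : Tendsto (fun n => (k : ℝ) * |p.2 - (f n).2|) atTop (𝓝 (k * |p.2 - p.2|)) :=
        (hd2 p.2).const_mul _
      rw [sub_self, abs_zero, mul_zero] at h4
      refine squeeze_zero_norm' ?_ h4
      have h5 : ∀ᶠ n in atTop, |p.2 - (f n).2| < 1 / (k + 1) :=
        (hd2 p.2).eventually_lt_const (by simpa using hk)
      filter_upwards [h5, (hslice p.2).eventually_mem (hΩ.mem_nhds hp)] with n h6 h7
      exact (hf n).1 _ h6 h7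
    have h4 := (hu1 p.2 hp).sub h3
    simpa using h4
  refine ⟨fun s hs hsΩ => ?_, fun y hy hyΩ => ?_⟩
  · refine le_of_tendsto_of_tendsto ((hu1 s hsΩ).sub hu).abs ((hd2 s).const_mul _) ?_
    filter_upwards [(hd2 s).eventually_lt_const hs,
      (hslice s).eventually_mem (hΩ.mem_nhds hsΩ)] with n h6 h7
    exact (hf n).1 _ h6 h7
  · refine le_of_tendsto_of_tendsto ((hu2 y hyΩ).sub hu).abs ((hd1 y).const_mul _) ?_
    filter_upwards [(hd1 y).eventually_lt_const hy,
      (hslice' y).eventually_mem (hΩ.mem_nhds hyΩ)] with n h6 h7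
    exact (hf n).2 _ h6 h7

theorem exists_mem_slicewiseLip {u : Spc m × ℝ → ℝ} {Ω : Set (Spc m × ℝ)} {p : Spc m × ℝ}
    (hx : DifferentiableAt ℝ (fun y => u (y, p.2)) p.1)
    (ht : DifferentiableAt ℝ (fun s => u (p.1, s)) p.2) : ∃ k, p ∈ slicewiseLip u Ω k := by
  obtain ⟨K1, h1⟩ := hx.isBigO_sub.bound
  obtain ⟨K2, h2⟩ := ht.isBigO_sub.bound
  obtain ⟨r1, hr1, h1⟩ := Metric.eventually_nhds_iff.1 h1
  obtain ⟨r2, hr2, h2⟩ := Metric.eventually_nhds_iff.1 h2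
  obtain ⟨k, hk⟩ := exists_nat_gt (max (max K1 K2) (max (1 / r1) (1 / r2)))
  simp only [max_lt_iff] at hk
  obtain ⟨⟨hk1, hk2⟩, hk3, hk4⟩ := hk
  have hr : ∀ r : ℝ, 0 < r → 1 / r < k → 1 / ((k : ℝ) + 1) ≤ r := fun r hr h => by
    rw [div_lt_iff₀ hr] at h
    rw [div_le_iff₀ (by positivity)]
    nlinarith only [h, hr]
  refine ⟨k, fun s hs _ => ?_, fun y hy _ => ?_⟩
  · refine (h2 (y := s) ?_).trans (mul_le_mul_of_nonneg_right hk2.le (norm_nonneg _))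
    exact lt_of_lt_of_le hs (hr _ hr2 hk4)
  · have h3 := (h1 (y := y) (lt_of_lt_of_le hy (hr _ hr1 hk3))).trans
      (mul_le_mul_of_nonneg_right hk1.le (norm_nonneg _))
    rwa [← dist_eq_norm] at h3

/-- A nonnegative pointwise solution, only assumed regular in each variable separately, is
continuous. -/
theorem continuousOn_of_solAt (hlam : 0 < lam) (hLam : 0 ≤ Lam) (hA : IsElliptic lam Lam A)
    {u : Spc m × ℝ → ℝ} {Ω : Set (Spc m × ℝ)} (hΩ : IsOpen Ω) (hsol : ∀ p ∈ Ω, SolAt A u p)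
    (h0 : ∀ p ∈ Ω, 0 ≤ u p) : ContinuousOn u Ω := by
  set Z : Set (Spc m × ℝ) := {p | ¬ ∀ᶠ q in 𝓝 p, ContinuousAt u q} with hZdef
  have hZ : IsClosed Z := isOpen_compl_iff.1 (by
    have : Zᶜ = {p | ∀ᶠ q in 𝓝 p, ContinuousAt u q} := by ext p; simp [hZdef]
    rw [this]
    exact isOpen_setOfPred_eventually_nhds)
  have hoff : ∀ p, p ∉ Z → ContinuousAt u p := fun p hp => by
    have : ∀ᶠ q in 𝓝 p, ContinuousAt u q := not_not.1 hp
    exact this.self_of_nhds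
  suffices hdisj : ∀ p ∈ Ω, p ∉ Z from fun p hp => (hoff p (hdisj p hp)).continuousWithinAt
  intro p0 hp0 hp0Z
  obtain ⟨r, hr, hrΩ⟩ := Metric.nhds_basis_closedBall.mem_iff.1 (hΩ.mem_nhds hp0)
  set X : Set (Spc m × ℝ) := closure (Z ∩ ball p0 r) with hX
  have hXZ : X ⊆ Z := closure_minimal inter_subset_left hZ
  have hXΩ : X ⊆ Ω := (closure_minimal (inter_subset_right.trans ball_subset_closedBall)
    isClosed_closedBall).trans hrΩ
  have hdx : ∀ p ∈ Ω, DifferentiableAt ℝ (fun y => u (y, p.2)) p.1 := fun p hp =>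
    (hsol p hp).1.differentiableAt (by norm_num)
  have hdt : ∀ p ∈ Ω, DifferentiableAt ℝ (fun s => u (p.1, s)) p.2 := fun p hp =>
    (hsol p hp).2.differentiableAt
  have : CompleteSpace X := isClosed_closure.completeSpace_coe
  have : Nonempty X := ⟨⟨p0, subset_closure ⟨hp0Z, mem_ball_self hr⟩⟩⟩
  obtain ⟨k, p1, hp1⟩ := nonempty_interior_of_iUnion_of_closed
    (f := fun k : ℕ => ((↑) : X → Spc m × ℝ) ⁻¹' slicewiseLip u Ω k)
    (fun k => IsSeqClosed.isClosed fun f p hf hlim =>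
      mem_slicewiseLip_of_tendsto hΩ (fun p hp => (hdx p hp).continuousAt)
        (fun p hp => (hdt p hp).continuousAt) hf (hXΩ p.2)
        ((continuous_subtype_val.tendsto p).comp hlim))
    (by
      refine eq_univ_of_forall fun p => mem_iUnion.2 ?_
      exact exists_mem_slicewiseLip (hdx p (hXΩ p.2)) (hdt p (hXΩ p.2)))
  rw [mem_interior_iff_mem_nhds, nhds_subtype_eq_comap, mem_comap] at hp1
  obtain ⟨V, hV, hVk⟩ := hp1
  obtain ⟨U, hUV, hUo, hp1U⟩ := _root_.mem_nhds_iff.1 hV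
  obtain ⟨q1, hq1U, hq1Z, hq1b⟩ := mem_closure_iff.1 p1.2 U hUo hp1U
  have hW : IsOpen (U ∩ ball p0 r) := hUo.inter isOpen_ball
  have hWΩ : U ∩ ball p0 r ⊆ Ω := fun p hp => hrΩ (ball_subset_closedBall hp.2)
  have hLip : ∀ p ∈ U ∩ ball p0 r, p ∈ Z → p ∈ slicewiseLip u Ω k := fun p hp hpZ =>
    hVk (a := ⟨p, subset_closure ⟨hpZ, hp.2⟩⟩) (hUV hp.1)
  refine hq1Z ?_
  filter_upwards [hW.mem_nhds ⟨hq1U, hq1b⟩] with z hz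
  by_cases hzZ : z ∈ Z
  swap
  · exact hoff z hzZ
  obtain ⟨x1, t1⟩ := z
  refine continuousAt_of_nearConst hlam hLam hA hZ hzZ
    (Filter.Eventually.mono (hW.mem_nhds hz) fun p hp => hsol p (hWΩ hp))
    (Filter.Eventually.mono (hW.mem_nhds hz) fun p hp => h0 p (hWΩ hp)) (Eventually.of_forall hoff) ?_
  intro ε hε
  have hk : (0 : ℝ) < 1 / (k + 1) := by positivity
  have hlim : Tendsto (fun δ : ℝ => 600 * δ + 200 * δ ^ 2) (𝓝[>] 0) (𝓝 0) := by
    have : Tendsto (fun δ : ℝ => 600 * δ + 200 * δ ^ 2) (𝓝[>] 0) (𝓝 (600 * 0 + 200 * 0 ^ 2)) :=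
      (((continuous_const.mul continuous_id).add (continuous_const.mul
        (continuous_id.pow 2))).tendsto 0).mono_left nhdsWithin_le_nhds
    simpa using this
  have hε' : 0 < ε / (3 * (k + 1)) := by positivity
  filter_upwards [eventually_forall_qbox (hW.mem_nhds hz), hlim.eventually_lt_const hk,
    hlim.eventually_lt_const hε', self_mem_nhdsWithin] with δ h1 h2 h3 hδ p hpZ hp q hq hqp
  have hδ' : 0 < δ := hδ
  have hδ2 : 0 < δ ^ 2 := by positivity
  have hbound : ∀ {D : ℝ}, D ≤ 600 * δ + 200 * δ ^ 2 → (k : ℝ) * D ≤ ε / 3 := by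
    intro D hD
    have h4 : (k : ℝ) * D ≤ k * (ε / (3 * (k + 1))) :=
      mul_le_mul_of_nonneg_left (hD.trans h3.le) (Nat.cast_nonneg k)
    refine h4.trans ?_
    rw [mul_div_assoc', div_le_div_iff₀ (by positivity) (by norm_num)]
    nlinarith only [hε, (Nat.cast_nonneg k : (0 : ℝ) ≤ k)]
  have hdist1 : ∀ p ∈ qbox x1 t1 δ, ∀ q ∈ qbox x1 t1 δ, dist q.1 p.1 ≤ 600 * δ + 200 * δ ^ 2 := by
    intro p hp q hq
    have h4 : dist q.1 x1 ≤ 300 * δ := hq.1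
    have h5 : dist p.1 x1 ≤ 300 * δ := hp.1
    have := dist_triangle_right q.1 p.1 x1
    linarith
  have hdist2 : ∀ p ∈ qbox x1 t1 δ, ∀ q ∈ qbox x1 t1 δ, |q.2 - p.2| ≤ 600 * δ + 200 * δ ^ 2 := by
    intro p hp q hq
    rw [abs_le]
    constructor <;> linarith [hp.2.1, hp.2.2, hq.2.1, hq.2.2]
  have hkey : ∀ p ∈ qbox x1 t1 δ, p ∈ Z → ∀ q ∈ qbox x1 t1 δ, q.1 = p.1 ∨ q.2 = p.2 →
      |u q - u p| ≤ ε / 3 := by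
    intro p hp hpZ q hq hqp
    have hL := hLip p (h1 p hp) hpZ
    rcases hqp with h | h
    · have h4 : q = (p.1, q.2) := by rw [← h]
      have h5 := hL.1 q.2 (lt_of_le_of_lt (hdist2 p hp q hq) h2) (by rw [← h4]; exact hWΩ (h1 q hq))
      rw [← h4] at h5
      exact h5.trans (hbound (hdist2 p hp q hq))
    · have h4 : q = (q.1, p.2) := by rw [← h]
      have h5 := hL.2 q.1 (lt_of_le_of_lt (hdist1 p hp q hq) h2) (by rw [← h4]; exact hWΩ (h1 q hq))
      rw [← h4] at h5
      exact h5.trans (hbound (hdist1 p hp q hq))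
  have hz1 : (x1, t1) ∈ qbox x1 t1 δ :=
    ⟨mem_closedBall_self (by linarith), by linarith, by linarith⟩
  have hz2 : (x1, p.2) ∈ qbox x1 t1 δ := ⟨mem_closedBall_self (by linarith), hp.2⟩
  have e1 := hkey p hp hpZ q hq hqp
  have e2 := hkey p hp hpZ (x1, p.2) hz2 (Or.inr rfl)
  have e3 := hkey (x1, t1) hz1 hzZ (x1, p.2) hz2 (Or.inl rfl)
  rw [abs_le] at e1 e2 e3 ⊢
  constructor <;> linarith [e1.1, e1.2, e2.1, e2.2, e3.1, e3.2]

end BaireContinuity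

section Chains

open Filter Topology Set MeasureTheory Metric

variable {m : ℕ} {A : Spc m → Matrix (Fin (m + 1)) (Fin (m + 1)) ℝ} {lam Lam : ℝ}

theorem xprime_add (x y : Spc m) : xprime (x + y) = xprime x + xprime y := rfl

theorem xprime_sub (x y : Spc m) : xprime (x - y) = xprime x - xprime y := rfl

theorem xprime_smul (c : ℝ) (x : Spc m) : xprime (c • x) = c • xprime x := rfl

theorem xlast_add (x y : Spc m) : xlast (x + y) = xlast x + xlast y := rfl

theorem xlast_sub (x y : Spc m) : xlast (x - y) = xlast x - xlast y := rfl

theorem xlast_smul (c : ℝ) (x : Spc m) : xlast (c • x) = c * xlast x := rfl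

theorem xprime_mkPt (x : Spc' m) (s : ℝ) : xprime (mkPt x s) = x := by
  ext i
  simp [xprime, mkPt, Fin.castSucc_ne_last]

theorem xlast_mkPt (x : Spc' m) (s : ℝ) : xlast (mkPt x s) = s := by
  simp [xlast, mkPt]

theorem norm_sq_eq (x : Spc m) : ‖x‖ ^ 2 = ‖xprime x‖ ^ 2 + xlast x ^ 2 := by
  rw [EuclideanSpace.norm_sq_eq, EuclideanSpace.norm_sq_eq, Fin.sum_univ_castSucc]
  simp [xprime, xlast]

theorem norm_xprime_le (x : Spc m) : ‖xprime x‖ ≤ ‖x‖ :=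
  le_of_sq_le_sq (by rw [norm_sq_eq x]; nlinarith only [sq_nonneg (xlast x)]) (norm_nonneg _)

theorem abs_xlast_le (x : Spc m) : |xlast x| ≤ ‖x‖ :=
  abs_le_of_sq_le_sq (by rw [norm_sq_eq x]; nlinarith only [sq_nonneg ‖xprime x‖]) (norm_nonneg _)

theorem norm_le_xprime_add_xlast (x : Spc m) : ‖x‖ ≤ ‖xprime x‖ + |xlast x| := by
  refine le_of_sq_le_sq ?_ (by positivity)
  rw [norm_sq_eq x, ← sq_abs (xlast x)]
  nlinarith only [norm_nonneg (xprime x), abs_nonneg (xlast x),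
    mul_nonneg (norm_nonneg (xprime x)) (abs_nonneg (xlast x))]

theorem continuous_xprime : Continuous (xprime : Spc m → Spc' m) := by
  refine LipschitzWith.continuous (K := 1) (LipschitzWith.of_dist_le_mul fun x y => ?_)
  rw [dist_eq_norm, dist_eq_norm, ← xprime_sub]
  simpa using norm_xprime_le (x - y)

theorem continuous_xlast : Continuous (xlast : Spc m → ℝ) := by
  refine LipschitzWith.continuous (K := 1) (LipschitzWith.of_dist_le_mul fun x y => ?_)
  rw [dist_eq_norm, dist_eq_norm, ← xlast_sub]
  simpa using abs_xlast_le (x - y)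

theorem eq_mkPt (x : Spc m) : x = mkPt (xprime x) (xlast x) := by
  have h : ‖x - mkPt (xprime x) (xlast x)‖ ≤ 0 := by
    refine (norm_le_xprime_add_xlast _).trans ?_
    rw [xprime_sub, xlast_sub, xprime_mkPt, xlast_mkPt]
    simp
  exact sub_eq_zero.1 (norm_le_zero_iff.1 h)

theorem continuous_hGamma {g : Spc' m → ℝ → ℝ} (hg : Continuous fun q : Spc' m × ℝ => g q.1 q.2) :
    Continuous (hGamma g) :=
  (continuous_xlast.comp continuous_fst).sub
    (hg.comp ((continuous_xprime.comp continuous_fst).prodMk continuous_snd))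

/-- The space-time neighbourhood needed around a point to run Harnack steps of size `ρ`. -/
def roomBox (p : Spc m × ℝ) (ρ : ℝ) : Set (Spc m × ℝ) :=
  ball p.1 (40 * ρ) ×ˢ Ioo (p.2 - 9 * ρ ^ 2) (p.2 + 9 * ρ ^ 2)

/-- `P` and `Q` are related by a Harnack chain with constant `E`; the chain runs forward in time
if `σ = 1` and backward in time if `σ = -1`. -/
def Conn (A : Spc m → Matrix (Fin (m + 1)) (Fin (m + 1)) ℝ) (Ω : Set (Spc m × ℝ)) (σ E : ℝ)
    (P Q : Spc m × ℝ) : Prop :=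
  ∀ u, NNSol A u Ω → (σ = 1 → u P ≤ E * u Q) ∧ (σ = -1 → u Q ≤ E * u P)

theorem Conn.trans {Ω : Set (Spc m × ℝ)} {σ E E' : ℝ} {P Q R : Spc m × ℝ} (h : Conn A Ω σ E P Q)
    (h' : Conn A Ω σ E' Q R) (hE : 0 ≤ E) (hE' : 0 ≤ E') : Conn A Ω σ (E * E') P R := by
  refine fun u hu => ⟨fun hσ => ?_, fun hσ => ?_⟩
  · rw [mul_assoc]
    exact ((h u hu).1 hσ).trans (mul_le_mul_of_nonneg_left ((h' u hu).1 hσ) hE)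
  · rw [mul_comm E, mul_assoc]
    exact ((h' u hu).2 hσ).trans (mul_le_mul_of_nonneg_left ((h u hu).2 hσ) hE')

theorem Conn.mono {Ω : Set (Spc m × ℝ)} {σ E E' : ℝ} {P Q : Spc m × ℝ} (h : Conn A Ω σ E P Q)
    (hE : E ≤ E') (hP : P ∈ Ω) (hQ : Q ∈ Ω) : Conn A Ω σ E' P Q := fun u hu =>
  ⟨fun hσ => ((h u hu).1 hσ).trans (mul_le_mul_of_nonneg_right hE (hu.2.2 Q hQ)),
    fun hσ => ((h u hu).2 hσ).trans (mul_le_mul_of_nonneg_right hE (hu.2.2 P hP))⟩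

theorem Conn.refl (Ω : Set (Spc m × ℝ)) (σ : ℝ) (P : Spc m × ℝ) : Conn A Ω σ 1 P P :=
  fun u _ => by simp

theorem harnack_segment (m : ℕ) {lam Lam : ℝ} (hlam : 0 < lam) (hLam : 0 ≤ Lam) :
    ∃ C ≥ (1 : ℝ), ∀ A : Spc m → Matrix (Fin (m + 1)) (Fin (m + 1)) ℝ, IsElliptic lam Lam A →
    ∀ (u : Spc m × ℝ → ℝ) (Ω : Set (Spc m × ℝ)), NNSol A u Ω →
    ∀ (P Q : Spc m × ℝ) (ρ : ℝ) (N : ℕ), 0 < ρ → ‖Q.1 - P.1‖ ≤ N * ρ →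
    Q.2 - P.2 = 5 * N * ρ ^ 2 →
    (∀ θ ∈ Icc (0 : ℝ) 1, roomBox (P + θ • (Q - P)) ρ ⊆ Ω) → u P ≤ C ^ N * u Q := by
  obtain ⟨C, hC, H⟩ := harnack m hlam hLam
  refine ⟨C, hC, fun A hA u Ω hu P Q ρ N hρ hx ht hroom => ?_⟩
  rcases Nat.eq_zero_or_pos N with rfl | hN
  · have h1 : Q.1 = P.1 := sub_eq_zero.1 (norm_le_zero_iff.1 (by simpa using hx))
    have h2 : Q.2 = P.2 := sub_eq_zero.1 (by simpa using ht)
    rw [Prod.ext h1 h2]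
    simp
  have hN' : (0 : ℝ) < N := Nat.cast_pos.2 hN
  have hstep : ∀ k : ℕ, k ≤ N → u P ≤ C ^ k * u (P + ((k : ℝ) / N) • (Q - P)) := by
    intro k
    induction k with
    | zero => intro _; simp
    | succ k ih =>
      intro hk
      refine (ih (by omega)).trans ?_
      rw [pow_succ, mul_assoc]
      refine mul_le_mul_of_nonneg_left ?_ (by positivity)
      have hk' : ((k : ℝ) + 1) ≤ N := by exact_mod_cast hk
      set R := P + ((k : ℝ) / N) • (Q - P) with hR
      have hR' : P + (((k + 1 : ℕ) : ℝ) / N) • (Q - P) = R + (1 / (N : ℝ)) • (Q - P) := by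
        rw [hR, add_assoc, ← add_smul]
        push_cast
        rw [add_div]
      have hRΩ : roomBox R ρ ⊆ Ω := hroom _ ⟨by positivity, by
        rw [div_le_one hN']; linarith⟩
      have hρ2 : 0 < ρ ^ 2 := by positivity
      have htime : (R + (1 / (N : ℝ)) • (Q - P)).2 = R.2 + 5 * ρ ^ 2 := by
        simp only [Prod.snd_add, Prod.smul_snd, Prod.snd_sub, smul_eq_mul, ht]
        field_simp
      rw [hR']
      refine H A hA u R.1 R.2 ρ hρ (hu.mono (Subset.trans (prod_mono (by rfl)
        (Ioo_subset_Ioo (by linarith) (by linarith))) hRΩ)) R.1 (by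
        rw [dist_self]; positivity) (R + (1 / (N : ℝ)) • (Q - P)).1
        (R + (1 / (N : ℝ)) • (Q - P)).2 ?_ (by linarith) (by linarith)
      simp only [Prod.fst_add, Prod.smul_fst, Prod.fst_sub]
      rw [dist_eq_norm, add_sub_cancel_left, norm_smul, Real.norm_of_nonneg (by positivity),
        one_div, inv_mul_le_iff₀ hN']
      exact hx
  have := hstep N le_rfl
  rwa [div_self hN'.ne', one_smul, add_sub_cancel] at this

theorem conn_segment (m : ℕ) {lam Lam : ℝ} (hlam : 0 < lam) (hLam : 0 ≤ Lam) :
    ∃ C ≥ (1 : ℝ), ∀ A : Spc m → Matrix (Fin (m + 1)) (Fin (m + 1)) ℝ, IsElliptic lam Lam A →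
    ∀ (Ω : Set (Spc m × ℝ)) (σ : ℝ) (P Q : Spc m × ℝ) (ρ : ℝ) (N : ℕ), 0 < ρ →
    ‖Q.1 - P.1‖ ≤ N * ρ → Q.2 - P.2 = σ * (5 * N * ρ ^ 2) →
    (∀ θ ∈ Icc (0 : ℝ) 1, roomBox (P + θ • (Q - P)) ρ ⊆ Ω) → Conn A Ω σ (C ^ N) P Q := by
  obtain ⟨C, hC, H⟩ := harnack_segment m hlam hLam
  refine ⟨C, hC, fun A hA Ω σ P Q ρ N hρ hx ht hroom u hu => ⟨fun hσ => ?_, fun hσ => ?_⟩⟩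
  · exact H A hA u Ω hu P Q ρ N hρ hx (by rw [ht, hσ, one_mul]) hroom
  · refine H A hA u Ω hu Q P ρ N hρ (by rwa [norm_sub_rev]) (by rw [hσ] at ht; linarith) ?_
    intro θ hθ
    have : Q + θ • (P - Q) = P + (1 - θ) • (Q - P) := by
      rw [sub_smul, one_smul, smul_sub, smul_sub]; abel
    rw [this]
    exact hroom _ ⟨by linarith [hθ.2], by linarith [hθ.1]⟩

end Chains

section Ascent

open Filter Topology Set MeasureTheory Metric

variable {m : ℕ} {A : Spc m → Matrix (Fin (m + 1)) (Fin (m + 1)) ℝ} {lam Lam : ℝ}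

theorem exists_holder_modulus {α β K η : ℝ} (hα : 0 < α) (hβ : 0 < β) (hK : 0 < K) (hη : 0 < η) :
    ∃ δ > (0 : ℝ), δ < 1 ∧ K * (δ ^ α + δ ^ β) ≤ η := by
  have h1 : Tendsto (fun δ : ℝ => K * (δ ^ α + δ ^ β)) (𝓝[>] 0) (𝓝 (K * (0 ^ α + 0 ^ β))) :=
    (((Real.continuousAt_rpow_const 0 α (Or.inr hα.le)).add
      (Real.continuousAt_rpow_const 0 β (Or.inr hβ.le))).tendsto.const_mul K).mono_left
      nhdsWithin_le_nhds
  rw [Real.zero_rpow hα.ne', Real.zero_rpow hβ.ne', add_zero, mul_zero] at h1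
  have h2 : ∀ᶠ δ in 𝓝[>] (0 : ℝ), 0 < δ := self_mem_nhdsWithin
  have h3 : ∀ᶠ δ in 𝓝[>] (0 : ℝ), δ < 1 :=
    (eventually_lt_nhds one_pos).filter_mono nhdsWithin_le_nhds
  obtain ⟨δ, h4, h5, h6⟩ := (h2.and (h3.and (h1.eventually_lt_const hη))).exists
  exact ⟨δ, h4, h5, h6.le⟩

theorem HolderSemi.osc_le {α β K δ η : ℝ} {g : Spc' m → ℝ → ℝ} (hg : HolderSemi α β K g)
    (hα : 0 < α) (hβ : 0 < β) (hK : 0 < K) (hδ : K * (δ ^ α + δ ^ β) ≤ η)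
    {x y : Spc' m} {t s : ℝ} (ha : ‖x - y‖ ≤ δ) (hb : |t - s| ≤ δ) : |g x t - g y s| ≤ η := by
  refine (hg x y t s).trans (le_trans ?_ hδ)
  refine mul_le_mul_of_nonneg_left (add_le_add ?_ ?_) hK.le
  · exact Real.rpow_le_rpow (norm_nonneg _) ha hα.le
  · exact Real.rpow_le_rpow (abs_nonneg _) hb hβ.le

theorem rpow_mul_le_scaled {δ h c α : ℝ} (hδ : 0 < δ) (hh : 0 < h) (hh1 : h ≤ 1) (hα : 0 < α)
    (hc : 1 ≤ c * α) {a : ℝ} (ha0 : 0 ≤ a) (ha : a ≤ δ * h ^ c) : a ^ α ≤ δ ^ α * h := by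
  refine (Real.rpow_le_rpow ha0 ha hα.le).trans ?_
  rw [Real.mul_rpow hδ.le (by positivity), ← Real.rpow_mul hh.le]
  refine mul_le_mul_of_nonneg_left ?_ (by positivity)
  simpa using Real.rpow_le_rpow_of_exponent_ge hh hh1 hc

theorem HolderSemi.osc_le_scaled {α β γ K δ η h : ℝ} {g : Spc' m → ℝ → ℝ}
    (hg : HolderSemi α β K g) (hα : 0 < α) (hβ : 0 < β) (hK : 0 < K)
    (hαγ : 1 ≤ (1 + γ) * α) (hβγ : 1 ≤ (2 + γ) * β) (hδ0 : 0 < δ)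
    (hδ : K * (δ ^ α + δ ^ β) ≤ η) (hh : 0 < h) (hh1 : h ≤ 1)
    {x y : Spc' m} {t s : ℝ} (ha : ‖x - y‖ ≤ δ * h ^ (1 + γ)) (hb : |t - s| ≤ δ * h ^ (2 + γ)) :
    |g x t - g y s| ≤ η * h := by
  refine (hg x y t s).trans ?_
  calc K * (‖x - y‖ ^ α + |t - s| ^ β) ≤ K * (δ ^ α * h + δ ^ β * h) := by
        refine mul_le_mul_of_nonneg_left (add_le_add ?_ ?_) hK.le
        · exact rpow_mul_le_scaled hδ0 hh hh1 hα hαγ (norm_nonneg _) ha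
        · exact rpow_mul_le_scaled hδ0 hh hh1 hβ hβγ (abs_nonneg _) hb
    _ = (K * (δ ^ α + δ ^ β)) * h := by ring
    _ ≤ η * h := mul_le_mul_of_nonneg_right hδ hh.le

theorem mem_Cyl_one {g : Spc' m → ℝ → ℝ} {p : Spc m × ℝ} (h1 : ‖xprime p.1‖ < 1) (h2 : |p.2| < 1)
    (h3 : 0 < hGamma g p) (h4 : hGamma g p < 1) : p ∈ Cyl g 1 := by
  rw [abs_lt] at h2
  unfold hGamma at h3 h4
  exact ⟨h1, by linarith [h2.1], by linarith [h2.2], by linarith, by linarith⟩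

theorem one_le_rpow_neg {h γ : ℝ} (hh : 0 < h) (hh1 : h ≤ 1) (hγ : 0 < γ) : 1 ≤ h ^ (-γ) :=
  Real.one_le_rpow_of_pos_of_le_one_of_nonpos hh hh1 (by linarith)

theorem pow_le_exp_mul {C E : ℝ} (hC : 1 ≤ C) {N : ℕ} (hN : (N : ℝ) ≤ E) :
    C ^ N ≤ Real.exp (Real.log C * E) := by
  rw [← Real.rpow_natCast, Real.rpow_def_of_pos (by linarith)]
  exact Real.exp_le_exp.2 (mul_le_mul_of_nonneg_left hN (Real.log_nonneg hC))

theorem conn_ascend_step (m : ℕ) {lam Lam α β γ K : ℝ} (hlam : 0 < lam) (hLam : 0 ≤ Lam)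
    (hα : 0 < α) (hβ : 0 < β) (hγ : 0 < γ) (hαγ : 1 ≤ (1 + γ) * α) (hβγ : 1 ≤ (2 + γ) * β)
    (hK : 0 < K) :
    ∃ B > (0 : ℝ), ∀ A : Spc m → Matrix (Fin (m + 1)) (Fin (m + 1)) ℝ, IsElliptic lam Lam A →
    ∀ g : Spc' m → ℝ → ℝ, HolderSemi α β K g → ∀ σ : ℝ, |σ| = 1 → ∀ p : Spc m × ℝ,
    0 < hGamma g p → hGamma g p ≤ 1 / 4 → ‖xprime p.1‖ ≤ 3 / 4 → |p.2| ≤ 3 / 4 →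
    ∃ q : Spc m × ℝ, xprime q.1 = xprime p.1 ∧ |q.2 - p.2| ≤ hGamma g p / 100 ∧
      7 / 4 * hGamma g p ≤ hGamma g q ∧ hGamma g q ≤ 9 / 4 * hGamma g p ∧
      Conn A (Cyl g 1) σ (Real.exp (B * hGamma g p ^ (-γ))) p q := by
  obtain ⟨C, hC, H⟩ := conn_segment m hlam hLam
  obtain ⟨δ, hδ0, hδ1, hδ⟩ := exists_holder_modulus hα hβ hK (show (0 : ℝ) < 1 / 4 by norm_num)
  have hlogC : 0 ≤ Real.log C := Real.log_nonneg hC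
  refine ⟨Real.log C * (500 / δ + 1) + 1, by positivity, ?_⟩
  intro A hA g hg σ hσ p hh hh4 hpx hpt
  set h := hGamma g p with hhdef
  have hh1 : h ≤ 1 := by linarith
  have hγ1 := one_le_rpow_neg hh hh1 hγ
  set N := ⌈500 / δ * h ^ (-γ)⌉₊ with hN
  have hN1 : 500 / δ * h ^ (-γ) ≤ N := Nat.le_ceil _
  have hNle : (N : ℝ) ≤ (500 / δ + 1) * h ^ (-γ) := by
    have := Nat.ceil_lt_add_one (show 0 ≤ 500 / δ * h ^ (-γ) by positivity)
    rw [add_mul, one_mul]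
    linarith
  have hN0 : (0 : ℝ) < N := lt_of_lt_of_le (by positivity) hN1
  set ρ := h / N with hρ
  have hρ0 : 0 < ρ := by positivity
  have hNρ : N * ρ = h := by rw [hρ]; field_simp
  have hpow : h ^ (1 + γ) * h ^ (-γ) = h := by
    rw [← Real.rpow_add hh]; simp
  have hpow2 : h ^ (2 + γ) = h * h ^ (1 + γ) := by
    rw [show 2 + γ = 1 + (1 + γ) by ring, Real.rpow_add hh, Real.rpow_one]
  have hρle : 500 * ρ ≤ δ * h ^ (1 + γ) := by
    have h1 : 500 * h ≤ δ * h ^ (1 + γ) * N := by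
      calc 500 * h = δ * h ^ (1 + γ) * (500 / δ * h ^ (-γ)) := by
            rw [show δ * h ^ (1 + γ) * (500 / δ * h ^ (-γ))
              = (δ * (500 / δ)) * (h ^ (1 + γ) * h ^ (-γ)) by ring, hpow]
            field_simp
        _ ≤ _ := mul_le_mul_of_nonneg_left hN1 (by positivity)
    rw [hρ, mul_div_assoc', div_le_iff₀ hN0]
    exact h1
  have hpowle : h ^ (1 + γ) ≤ h := by
    simpa using Real.rpow_le_rpow_of_exponent_ge hh hh1 (show 1 ≤ 1 + γ by linarith)
  have hρh : 500 * ρ ≤ h := by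
    refine hρle.trans ((mul_le_mul hδ1.le hpowle (by positivity) zero_le_one).trans ?_)
    rw [one_mul]
  have hhρ : 500 * (h * ρ) ≤ δ * h ^ (2 + γ) := by
    rw [hpow2]
    nlinarith only [mul_le_mul_of_nonneg_left hρle hh.le]
  have hρρ : ρ ^ 2 ≤ h * ρ := by nlinarith only [hρh, hρ0, hh]
  have hhρ' : 0 < h * ρ := by positivity
  have hhρ'' : 500 * (h * ρ) ≤ h := by nlinarith only [hρh, hh, hh1, hρ0]
  set q : Spc m × ℝ := (p.1 + mkPt 0 h, p.2 + σ * (5 * h * ρ)) with hq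
  have hqx : xprime q.1 = xprime p.1 := by rw [hq, xprime_add, xprime_mkPt, add_zero]
  have hqt : |q.2 - p.2| = 5 * (h * ρ) := by
    rw [hq, add_sub_cancel_left, abs_mul, hσ, one_mul, abs_of_pos (by positivity)]; ring
  have hosc : ∀ y : Spc' m, ∀ s, ‖y - xprime p.1‖ ≤ 40 * ρ → |s - p.2| ≤ 14 * (h * ρ) →
      |g y s - g (xprime p.1) p.2| ≤ 1 / 4 * h := fun y s hy hs =>
    hg.osc_le_scaled hα hβ hK hαγ hβγ hδ0 hδ hh hh1 (by linarith) (by linarith)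
  have hqh : hGamma g q = 2 * h - (g (xprime p.1) q.2 - g (xprime p.1) p.2) := by
    have h1 : xlast q.1 = xlast p.1 + h := by rw [hq, xlast_add, xlast_mkPt]
    unfold hGamma at hhdef ⊢
    rw [hqx, h1]
    linarith
  have hq1 := abs_le.1 (hosc (xprime p.1) q.2 (by rw [sub_self, norm_zero]; positivity)
    (by rw [hqt]; linarith))
  refine ⟨q, hqx, by rw [hqt]; linarith, by linarith [hq1.2], by linarith [hq1.1], ?_⟩
  have hroom : ∀ θ ∈ Icc (0 : ℝ) 1, roomBox (p + θ • (q - p)) ρ ⊆ Cyl g 1 := by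
    rintro θ ⟨hθ0, hθ1⟩ ⟨y, s⟩ ⟨hy, hs1, hs2⟩
    have e1 : (p + θ • (q - p)).1 = p.1 + θ • mkPt 0 h := by
      simp [hq]
    have e2 : (p + θ • (q - p)).2 = p.2 + θ * (σ * (5 * h * ρ)) := by
      simp [hq]
    rw [e1] at hy
    rw [e2] at hs1 hs2
    simp only at hy hs1 hs2
    rw [mem_ball, dist_eq_norm] at hy
    have hy1 := (norm_xprime_le _).trans hy.le
    have hy2 := (abs_xlast_le _).trans hy.le
    rw [xprime_sub, xprime_add, xprime_smul, xprime_mkPt, smul_zero, add_zero] at hy1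
    rw [xlast_sub, xlast_add, xlast_smul, xlast_mkPt] at hy2
    have hσ' : |θ * (σ * (5 * h * ρ))| ≤ 5 * (h * ρ) := by
      rw [abs_mul, abs_mul, hσ, one_mul, abs_of_nonneg hθ0, abs_of_pos (by positivity)]
      nlinarith only [hhρ', hθ1]
    have hs : |s - p.2| ≤ 14 * (h * ρ) := by
      rw [abs_le] at hσ' ⊢
      constructor <;> linarith [hσ'.1, hσ'.2]
    have hg1 := abs_le.1 (hosc (xprime y) s hy1 hs)
    have hy3 := abs_le.1 hy2
    have hheight : hGamma g (y, s) = xlast y - g (xprime y) s := rfl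
    have hph : h = xlast p.1 - g (xprime p.1) p.2 := hhdef
    have hθh : 0 ≤ θ * h := by positivity
    have hθh' : θ * h ≤ h := by nlinarith only [hh, hθ1]
    refine mem_Cyl_one ?_ ?_ ?_ ?_
    · have h1 : ‖xprime y‖ ≤ ‖xprime y - xprime p.1‖ + ‖xprime p.1‖ := by
        simpa using norm_add_le (xprime y - xprime p.1) (xprime p.1)
      show ‖xprime y‖ < 1
      linarith
    · have h1 : |s| ≤ |s - p.2| + |p.2| := by simpa using abs_add_le (s - p.2) p.2
      show |s| < 1
      linarith
    · rw [hheight]; linarith [hg1.2, hy3.1]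
    · rw [hheight]; linarith [hg1.1, hy3.2]
  have hpΩ : p ∈ Cyl g 1 := mem_Cyl_one (by linarith) (by linarith) hh (by linarith)
  have hqΩ : q ∈ Cyl g 1 := by
    refine mem_Cyl_one (by rw [hqx]; linarith) ?_ (by linarith [hq1.2]) (by linarith [hq1.1])
    have h1 : |q.2| ≤ |q.2 - p.2| + |p.2| := by simpa using abs_add_le (q.2 - p.2) p.2
    linarith
  have hmain := H A hA (Cyl g 1) σ p q ρ N hρ0 (by
      have h0 : q.1 - p.1 = mkPt 0 h := by rw [hq, add_sub_cancel_left]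
      rw [h0, hNρ]
      refine (norm_le_xprime_add_xlast _).trans ?_
      rw [xprime_mkPt, xlast_mkPt, norm_zero, zero_add, abs_of_pos hh]) (by
      rw [hq, add_sub_cancel_left]
      rw [← hNρ]; ring) hroom
  refine hmain.mono ((pow_le_exp_mul hC hNle).trans (Real.exp_le_exp.2 ?_)) hpΩ hqΩ
  rw [add_mul (Real.log C * _), one_mul, mul_assoc]
  linarith

theorem conn_ascend (m : ℕ) {lam Lam α β γ K a : ℝ} (hlam : 0 < lam) (hLam : 0 ≤ Lam)
    (hα : 0 < α) (hβ : 0 < β) (hγ : 0 < γ) (hαγ : 1 ≤ (1 + γ) * α) (hβγ : 1 ≤ (2 + γ) * β)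
    (hK : 0 < K) (ha : 0 < a) (ha1 : a ≤ 1 / 8) :
    ∃ B > (0 : ℝ), ∀ A : Spc m → Matrix (Fin (m + 1)) (Fin (m + 1)) ℝ, IsElliptic lam Lam A →
    ∀ g : Spc' m → ℝ → ℝ, HolderSemi α β K g → ∀ σ : ℝ, |σ| = 1 → ∀ p : Spc m × ℝ,
    0 < hGamma g p → hGamma g p ≤ a → ‖xprime p.1‖ ≤ 5 / 8 → |p.2| ≤ 3 / 8 →
    ∃ q : Spc m × ℝ, xprime q.1 = xprime p.1 ∧ |q.2 - p.2| ≤ 1 / 100 ∧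
      a ≤ hGamma g q ∧ hGamma g q ≤ 5 / 8 ∧
      Conn A (Cyl g 1) σ (Real.exp (B * hGamma g p ^ (-γ))) p q := by
  obtain ⟨B, hB, H⟩ := conn_ascend_step m hlam hLam hα hβ hγ hαγ hβγ hK
  have hr : (7 / 4 : ℝ) ^ (-γ) < 1 := Real.rpow_lt_one_of_one_lt_of_neg (by norm_num) (by linarith)
  have hr' : 0 < 1 - (7 / 4 : ℝ) ^ (-γ) := by linarith
  set B' := B / (1 - (7 / 4 : ℝ) ^ (-γ)) with hB'
  have hB'0 : 0 < B' := by positivity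
  have hBB : B + B' * (7 / 4 : ℝ) ^ (-γ) = B' := by
    have : B' * (1 - (7 / 4 : ℝ) ^ (-γ)) = B := div_mul_cancel₀ _ hr'.ne'
    linarith
  refine ⟨B', hB'0, fun A hA g hg σ hσ => ?_⟩
  have key : ∀ n : ℕ, ∀ p : Spc m × ℝ, 0 < hGamma g p → hGamma g p ≤ 9 / 4 * a →
      a ≤ (7 / 4) ^ n * hGamma g p → ‖xprime p.1‖ ≤ 5 / 8 →
      |p.2| + (9 / 4 * a - hGamma g p) / 50 ≤ 3 / 4 →
      ∃ q : Spc m × ℝ, xprime q.1 = xprime p.1 ∧ |q.2 - p.2| ≤ (hGamma g q - hGamma g p) / 50 ∧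
        a ≤ hGamma g q ∧ hGamma g q ≤ 9 / 4 * a ∧
        Conn A (Cyl g 1) σ (Real.exp (B' * hGamma g p ^ (-γ))) p q := by
    intro n
    induction n with
    | zero =>
      intro p h1 h2 h3 h4 h5
      rw [pow_zero, one_mul] at h3
      have hpΩ : p ∈ Cyl g 1 := mem_Cyl_one (by linarith) (by linarith) h1 (by linarith)
      exact ⟨p, rfl, by simp, h3, h2, (Conn.refl _ σ p).mono
        (Real.one_le_exp (by positivity)) hpΩ hpΩ⟩
    | succ n ih =>
      intro p h1 h2 h3 h4 h5
      have hpΩ : p ∈ Cyl g 1 := mem_Cyl_one (by linarith) (by linarith) h1 (by linarith)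
      rcases le_or_gt a (hGamma g p) with h6 | h6
      · exact ⟨p, rfl, by simp, h6, h2, (Conn.refl _ σ p).mono
          (Real.one_le_exp (by positivity)) hpΩ hpΩ⟩
      obtain ⟨p1, hp1x, hp1t, hp1l, hp1u, hconn⟩ := H A hA g hg σ hσ p h1 (by linarith)
        (by linarith) (by linarith)
      have h7 : |p1.2| ≤ |p1.2 - p.2| + |p.2| := by simpa using abs_add_le (p1.2 - p.2) p.2
      obtain ⟨q, hqx, hqt, hql, hqu, hconn'⟩ := ih p1 (by linarith) (by linarith) (by
        refine h3.trans ?_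
        rw [pow_succ, mul_assoc]
        exact mul_le_mul_of_nonneg_left hp1l (by positivity)) (by rwa [hp1x]) (by linarith)
      have hqΩ : q ∈ Cyl g 1 := by
        have h8 : |q.2| ≤ |q.2 - p1.2| + |p1.2| := by simpa using abs_add_le (q.2 - p1.2) p1.2
        exact mem_Cyl_one (by rw [hqx, hp1x]; linarith) (by linarith) (by linarith) (by linarith)
      refine ⟨q, hqx.trans hp1x, ?_, hql, hqu, ?_⟩
      · have h8 : |q.2 - p.2| ≤ |q.2 - p1.2| + |p1.2 - p.2| := abs_sub_le _ _ _
        linarith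
      · refine (hconn.trans hconn' (Real.exp_pos _).le (Real.exp_pos _).le).mono ?_ hpΩ hqΩ
        rw [← Real.exp_add]
        refine Real.exp_le_exp.2 ?_
        have h8 : hGamma g p1 ^ (-γ) ≤ (7 / 4) ^ (-γ) * hGamma g p ^ (-γ) := by
          rw [← Real.mul_rpow (by norm_num) h1.le]
          exact Real.rpow_le_rpow_of_nonpos (by positivity) hp1l (by linarith)
        have h9 := mul_le_mul_of_nonneg_left h8 hB'0.le
        calc B * hGamma g p ^ (-γ) + B' * hGamma g p1 ^ (-γ)
            ≤ B * hGamma g p ^ (-γ) + B' * ((7 / 4) ^ (-γ) * hGamma g p ^ (-γ)) := by linarith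
          _ = (B + B' * (7 / 4) ^ (-γ)) * hGamma g p ^ (-γ) := by ring
          _ = B' * hGamma g p ^ (-γ) := by rw [hBB]
  intro p h1 h2 h3 h4
  obtain ⟨n, hn⟩ := pow_unbounded_of_one_lt (a / hGamma g p) (show (1 : ℝ) < 7 / 4 by norm_num)
  rw [div_lt_iff₀ h1] at hn
  obtain ⟨q, hqx, hqt, hql, hqu, hconn⟩ := key n p h1 (by linarith) hn.le h3 (by linarith)
  exact ⟨q, hqx, by linarith, hql, by linarith, hconn⟩

end Ascent

section InteriorChain

open Filter Topology Set MeasureTheory Metric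

variable {m : ℕ} {A : Spc m → Matrix (Fin (m + 1)) (Fin (m + 1)) ℝ} {lam Lam : ℝ}

theorem conn_local (m : ℕ) {lam Lam α β K a : ℝ} (hlam : 0 < lam) (hLam : 0 ≤ Lam)
    (hα : 0 < α) (hβ : 0 < β) (hK : 0 < K) (ha : 0 < a) (ha1 : a ≤ 1 / 8) :
    ∃ δ > (0 : ℝ), δ ≤ 1 / 8 ∧ ∀ κ > (0 : ℝ), ∃ E ≥ (1 : ℝ),
    ∀ A : Spc m → Matrix (Fin (m + 1)) (Fin (m + 1)) ℝ, IsElliptic lam Lam A →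
    ∀ g : Spc' m → ℝ → ℝ, HolderSemi α β K g → ∀ σ : ℝ, |σ| = 1 → ∀ P Q : Spc m × ℝ, ∀ S : ℝ,
    ‖xprime P.1‖ ≤ 5 / 8 → |P.2| ≤ 1 / 2 → a ≤ hGamma g P → hGamma g P ≤ 5 / 8 →
    ‖xprime Q.1 - xprime P.1‖ ≤ δ → |hGamma g Q - hGamma g P| ≤ δ → Q.2 - P.2 = σ * S →
    κ ≤ S → S ≤ δ → Conn A (Cyl g 1) σ E P Q := by
  obtain ⟨C, hC, H⟩ := conn_segment m hlam hLam
  obtain ⟨d, hd0, hd1, hd⟩ := exists_holder_modulus hα hβ hK (show (0 : ℝ) < a / 8 by linarith)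
  set δ := min (d / 2) (a / 16) with hδdef
  have hδ0 : 0 < δ := lt_min (by linarith) (by linarith)
  have hδd : 2 * δ ≤ d := by linarith [min_le_left (d / 2) (a / 16)]
  have hδa : δ ≤ a / 16 := min_le_right _ _
  refine ⟨δ, hδ0, by linarith, fun κ hκ => ?_⟩
  obtain ⟨N, hN⟩ := exists_nat_gt (max (5 / κ) (320 / δ ^ 2))
  obtain ⟨hN1, hN2⟩ := max_lt_iff.1 hN
  have hN0 : (0 : ℝ) < N := lt_trans (by positivity) hN1
  rw [div_lt_iff₀ hκ] at hN1
  rw [div_lt_iff₀ (by positivity)] at hN2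
  refine ⟨C ^ N, one_le_pow₀ hC, ?_⟩
  intro A hA g hg σ hσ P Q S hPx hPt hPl hPu hx hh ht hSl hSu
  have hS0 : 0 < S := lt_of_lt_of_le hκ hSl
  set ρ := √(S / (5 * N)) with hρ
  have hρ2 : ρ ^ 2 = S / (5 * N) := Real.sq_sqrt (by positivity)
  have hρ2' : 5 * N * ρ ^ 2 = S := by rw [hρ2]; field_simp
  have hρ0 : 0 < ρ := Real.sqrt_pos.2 (by positivity)
  have hρδ : 40 * ρ ≤ δ := by
    refine le_of_sq_le_sq ?_ hδ0.le
    rw [mul_pow, hρ2, mul_div_assoc', div_le_iff₀ (by positivity)]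
    nlinarith only [hN2, hSu, hδa, ha1]
  have hρδ2 : 9 * ρ ^ 2 ≤ δ := by nlinarith only [hρδ, hδa, ha1, hρ0]
  have hNρ : 1 ≤ N * ρ := by
    refine le_of_sq_le_sq ?_ (by positivity)
    have : (N * ρ) ^ 2 = N * S / 5 := by rw [mul_pow, hρ2]; field_simp
    rw [this, one_pow, le_div_iff₀ (by norm_num)]
    have := mul_le_mul_of_nonneg_left hSl hN0.le
    linarith
  have hQt : |Q.2 - P.2| ≤ δ := by rw [ht, abs_mul, hσ, one_mul, abs_of_pos hS0]; exact hSu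
  have hosc : ∀ y : Spc' m, ∀ s, ‖y - xprime P.1‖ ≤ 2 * δ → |s - P.2| ≤ 2 * δ →
      |g y s - g (xprime P.1) P.2| ≤ a / 8 := fun y s hy hs =>
    hg.osc_le hα hβ hK hd (hy.trans hδd) (hs.trans hδd)
  have hgQ := abs_le.1 (hosc (xprime Q.1) Q.2 (by linarith) (by linarith))
  have hlast : |xlast Q.1 - xlast P.1| ≤ δ + a / 8 := by
    unfold hGamma at hh
    rw [abs_le] at hh ⊢
    constructor <;> linarith [hh.1, hh.2, hgQ.1, hgQ.2]
  refine H A hA (Cyl g 1) σ P Q ρ N hρ0 ?_ (by rw [ht, hρ2']) ?_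
  · have h1 := norm_le_xprime_add_xlast (Q.1 - P.1)
    rw [xprime_sub, xlast_sub] at h1
    linarith
  rintro θ ⟨hθ0, hθ1⟩ ⟨y, s⟩ ⟨hy, hs1, hs2⟩
  have e1 : (P + θ • (Q - P)).1 = P.1 + θ • (Q.1 - P.1) := rfl
  have e2 : (P + θ • (Q - P)).2 = P.2 + θ * (Q.2 - P.2) := rfl
  rw [e1] at hy
  rw [e2] at hs1 hs2
  simp only at hy hs1 hs2
  rw [mem_ball, dist_eq_norm] at hy
  have hy1 := (norm_xprime_le _).trans hy.le
  have hy2 := abs_le.1 ((abs_xlast_le _).trans hy.le)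
  rw [xprime_sub, xprime_add, xprime_smul, xprime_sub, ← sub_sub] at hy1
  rw [xlast_sub, xlast_add, xlast_smul, xlast_sub] at hy2
  have hc : ∀ z b : ℝ, |z| ≤ b → |θ * z| ≤ b := fun z b hz => by
    rw [abs_mul, abs_of_nonneg hθ0]
    nlinarith only [hz, hθ0, hθ1, abs_nonneg z]
  have hs3 := abs_le.1 (hc _ _ hQt)
  have hs : |s - P.2| ≤ 2 * δ := by
    rw [abs_le]
    constructor <;> linarith [hs3.1, hs3.2]
  have hy3 : ‖xprime y - xprime P.1‖ ≤ 2 * δ := by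
    have h1 : ‖θ • (xprime Q.1 - xprime P.1)‖ ≤ δ := by
      rw [norm_smul, Real.norm_of_nonneg hθ0]
      nlinarith only [hx, hθ0, hθ1, norm_nonneg (xprime Q.1 - xprime P.1)]
    have h2 : ‖xprime y - xprime P.1‖ ≤ ‖xprime y - xprime P.1 - θ • (xprime Q.1 - xprime P.1)‖
        + ‖θ • (xprime Q.1 - xprime P.1)‖ := by
      simpa using norm_add_le (xprime y - xprime P.1 - θ • (xprime Q.1 - xprime P.1))
        (θ • (xprime Q.1 - xprime P.1))
    linarith
  have hg1 := abs_le.1 (hosc (xprime y) s hy3 hs)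
  have hl := abs_le.1 (hc _ _ hlast)
  have hheight : hGamma g (y, s) = xlast y - g (xprime y) s := rfl
  have hPh : hGamma g P = xlast P.1 - g (xprime P.1) P.2 := rfl
  rw [hPh] at hPl hPu
  refine mem_Cyl_one ?_ ?_ ?_ ?_
  · have h1 : ‖xprime y‖ ≤ ‖xprime y - xprime P.1‖ + ‖xprime P.1‖ := by
      simpa using norm_add_le (xprime y - xprime P.1) (xprime P.1)
    show ‖xprime y‖ < 1
    linarith
  · have h1 : |s| ≤ |s - P.2| + |P.2| := by simpa using abs_add_le (s - P.2) P.2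
    show |s| < 1
    linarith
  · rw [hheight]; linarith [hg1.2, hy2.1, hl.1]
  · rw [hheight]; linarith [hg1.1, hy2.2, hl.2]

/-- The point at height `1/2` above the origin of the graph at time `σ / 2`. -/
def refPt (g : Spc' m → ℝ → ℝ) (σ : ℝ) : Spc m × ℝ := (mkPt 0 (g 0 (σ / 2) + 1 / 2), σ / 2)

theorem conn_interior (m : ℕ) {lam Lam α β K a : ℝ} (hlam : 0 < lam) (hLam : 0 ≤ Lam)
    (hα : 0 < α) (hβ : 0 < β) (hK : 0 < K) (ha : 0 < a) (ha1 : a ≤ 1 / 8) :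
    ∃ E ≥ (1 : ℝ),
    ∀ A : Spc m → Matrix (Fin (m + 1)) (Fin (m + 1)) ℝ, IsElliptic lam Lam A →
    ∀ g : Spc' m → ℝ → ℝ, HolderSemi α β K g → ∀ σ : ℝ, |σ| = 1 → ∀ P : Spc m × ℝ,
    ‖xprime P.1‖ ≤ 5 / 8 → |P.2| ≤ 2 / 5 → a ≤ hGamma g P → hGamma g P ≤ 5 / 8 →
    Conn A (Cyl g 1) σ E P (refPt g σ) := by
  obtain ⟨δ, hδ0, hδ1, H⟩ := conn_local m hlam hLam hα hβ hK ha ha1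
  obtain ⟨M, hM⟩ := exists_nat_gt (1 / δ)
  have hM0 : (0 : ℝ) < M := lt_trans (by positivity) hM
  have hMδ : 1 / (M : ℝ) ≤ δ := by
    rw [div_lt_iff₀ hδ0] at hM
    rw [div_le_iff₀ hM0]; linarith
  obtain ⟨E, hE, HE⟩ := H (1 / (10 * M)) (by positivity)
  refine ⟨E ^ M, one_le_pow₀ hE, fun A hA g hg σ hσ P hPx hPt hPl hPu => ?_⟩
  have hσ2 : σ * σ = 1 := by rw [← abs_mul_abs_self, hσ, one_mul]
  set T := σ * (σ / 2 - P.2) with hT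
  have hTσ : σ / 2 - P.2 = σ * T := by rw [hT, ← mul_assoc, hσ2, one_mul]
  have hσP : |σ * P.2| ≤ 2 / 5 := by rwa [abs_mul, hσ, one_mul]
  have hT' : T = 1 / 2 - σ * P.2 := by rw [hT]; linear_combination hσ2 / 2
  have hT1 : 1 / 10 ≤ T := by rw [hT']; linarith [(abs_le.1 hσP).2]
  have hT2 : T ≤ 1 := by rw [hT']; linarith [(abs_le.1 hσP).1]
  set X : ℝ → Spc' m := fun θ => (1 - θ) • xprime P.1 with hX
  set τ : ℝ → ℝ := fun θ => P.2 + θ * (σ / 2 - P.2) with hτ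
  set R : ℝ → Spc m × ℝ := fun θ =>
    (mkPt (X θ) (g (X θ) (τ θ) + ((1 - θ) * hGamma g P + θ / 2)), τ θ) with hR
  have hRx : ∀ θ, xprime (R θ).1 = X θ := fun θ => xprime_mkPt _ _
  have hRh : ∀ θ, hGamma g (R θ) = (1 - θ) * hGamma g P + θ / 2 := fun θ => by
    unfold hGamma
    rw [hRx]
    show xlast (mkPt _ _) - g (X θ) (τ θ) = _
    rw [xlast_mkPt, add_sub_cancel_left]
    rfl
  have hR0 : R 0 = P := by
    have h1 : X 0 = xprime P.1 := by simp [hX]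
    have h2 : τ 0 = P.2 := by simp [hτ]
    refine Prod.ext ?_ h2
    show mkPt (X 0) (g (X 0) (τ 0) + _) = P.1
    rw [h1, h2, eq_mkPt P.1, xprime_mkPt]
    congr 1
    unfold hGamma
    ring
  have hR1 : R 1 = refPt g σ := by
    have h1 : X 1 = 0 := by simp [hX]
    have h2 : τ 1 = σ / 2 := by simp [hτ]
    refine Prod.ext ?_ h2
    show mkPt (X 1) (g (X 1) (τ 1) + _) = mkPt 0 _
    rw [h1, h2]
    congr 1
    ring
  have hchain : ∀ k : ℕ, k ≤ M → Conn A (Cyl g 1) σ (E ^ k) P (R (k / M)) := by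
    intro k
    induction k with
    | zero =>
      intro _
      simpa [hR0] using Conn.refl (A := A) (Cyl g 1) σ P
    | succ k ih =>
      intro hk
      rw [pow_succ]
      refine (ih (by omega)).trans ?_ (by positivity) (by positivity)
      have hk' : ((k : ℝ) + 1) ≤ M := by exact_mod_cast hk
      set θ : ℝ := k / M with hθ
      have hθ' : ((k + 1 : ℕ) : ℝ) / M = θ + 1 / M := by push_cast; rw [hθ, add_div]
      have hθ0 : 0 ≤ θ := by positivity
      have hθ1 : θ ≤ 1 := by rw [hθ, div_le_one hM0]; linarith
      rw [hθ']
      have hstep : 0 < 1 / (M : ℝ) := by positivity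
      have hPh0 : 0 < hGamma g P := by linarith
      refine HE A hA g hg σ hσ _ _ (T / M) ?_ ?_ ?_ ?_ ?_ ?_ ?_ ?_ ?_
      · rw [hRx, norm_smul, Real.norm_of_nonneg (by linarith)]
        nlinarith only [hθ0, hθ1, hPx, norm_nonneg (xprime P.1)]
      · show |P.2 + θ * (σ / 2 - P.2)| ≤ 1 / 2
        have h1 : P.2 + θ * (σ / 2 - P.2) = (1 - θ) * P.2 + θ * (σ / 2) := by ring
        have h2 : |σ / 2| = 1 / 2 := by rw [abs_div, hσ, abs_two]
        rw [h1]
        refine (abs_add_le _ _).trans ?_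
        rw [abs_mul, abs_mul, h2, abs_of_nonneg hθ0, abs_of_nonneg (by linarith : 0 ≤ 1 - θ)]
        nlinarith only [hθ0, hθ1, hPt]
      · rw [hRh]; nlinarith only [hθ0, hθ1, hPl, ha1]
      · rw [hRh]; nlinarith only [hθ0, hθ1, hPu]
      · rw [hRx, hRx]
        have h1 : X (θ + 1 / M) - X θ = (-(1 / (M : ℝ))) • xprime P.1 := by
          simp only [hX]; rw [← sub_smul]; congr 1; ring
        rw [h1, norm_smul, norm_neg, Real.norm_of_nonneg hstep.le]
        nlinarith only [hMδ, hstep, hPx, norm_nonneg (xprime P.1)]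
      · rw [hRh, hRh]
        have h1 : (1 - (θ + 1 / M)) * hGamma g P + (θ + 1 / M) / 2 -
            ((1 - θ) * hGamma g P + θ / 2) = 1 / M * (1 / 2 - hGamma g P) := by ring
        rw [h1, abs_mul, abs_of_pos hstep]
        have h2 : |1 / 2 - hGamma g P| ≤ 1 := abs_le.2 ⟨by linarith, by linarith⟩
        nlinarith only [hMδ, hstep, h2, abs_nonneg (1 / 2 - hGamma g P)]
      · show P.2 + (θ + 1 / M) * (σ / 2 - P.2) - (P.2 + θ * (σ / 2 - P.2)) = σ * (T / M)
        rw [hTσ]; ring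
      · rw [div_le_div_iff₀ (by positivity) hM0]
        nlinarith only [hT1, hM0]
      · refine le_trans ?_ hMδ
        exact div_le_div_of_nonneg_right hT2 hM0.le
  have := hchain M le_rfl
  rwa [div_self hM0.ne', hR1] at this

theorem refPt_mem_Cyl (g : Spc' m → ℝ → ℝ) {σ : ℝ} (hσ : |σ| = 1) :
    (refPt g σ : Spc m × ℝ) ∈ Cyl g 1 := by
  have e : hGamma g (refPt g σ : Spc m × ℝ) = 1 / 2 := by
    show xlast (mkPt _ _) - g (xprime (mkPt _ _)) (σ / 2) = _
    rw [xlast_mkPt, xprime_mkPt, add_sub_cancel_left]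
  refine mem_Cyl_one ?_ ?_ (by rw [e]; norm_num) (by rw [e]; norm_num)
  · show ‖xprime (mkPt _ _)‖ < 1
    rw [xprime_mkPt, norm_zero]; norm_num
  · show |σ / 2| < 1
    rw [abs_div, hσ, abs_two]; norm_num

theorem conn_growth (m : ℕ) {lam Lam α β γ K : ℝ} (hlam : 0 < lam) (hLam : 0 ≤ Lam)
    (hα : 0 < α) (hβ : 0 < β) (hγ : 0 < γ) (hαγ : 1 ≤ (1 + γ) * α) (hβγ : 1 ≤ (2 + γ) * β)
    (hK : 0 < K) :
    ∃ B > (0 : ℝ), ∀ A : Spc m → Matrix (Fin (m + 1)) (Fin (m + 1)) ℝ, IsElliptic lam Lam A →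
    ∀ g : Spc' m → ℝ → ℝ, HolderSemi α β K g → ∀ σ : ℝ, |σ| = 1 → ∀ p : Spc m × ℝ,
    0 < hGamma g p → hGamma g p ≤ 5 / 8 → ‖xprime p.1‖ ≤ 5 / 8 → |p.2| ≤ 3 / 8 →
    Conn A (Cyl g 1) σ (Real.exp (B * hGamma g p ^ (-γ))) p (refPt g σ) := by
  have ha : (0 : ℝ) < 1 / 8 := by norm_num
  obtain ⟨B, hB, H1⟩ := conn_ascend m hlam hLam hα hβ hγ hαγ hβγ hK ha le_rfl
  obtain ⟨E, hE, H2⟩ := conn_interior m hlam hLam hα hβ hK ha le_rfl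
  have hlogE : 0 ≤ Real.log E := Real.log_nonneg hE
  refine ⟨B + Real.log E, by positivity, fun A hA g hg σ hσ p h1 h2 h3 h4 => ?_⟩
  have hγ1 := one_le_rpow_neg h1 (by linarith) hγ
  have hpΩ : p ∈ Cyl g 1 := mem_Cyl_one (by linarith) (by linarith) h1 (by linarith)
  have hrΩ : refPt g σ ∈ Cyl g 1 := refPt_mem_Cyl g hσ
  have hEexp : E ≤ Real.exp (Real.log E * hGamma g p ^ (-γ)) := by
    nth_rewrite 1 [← Real.exp_log (by linarith : 0 < E)]
    exact Real.exp_le_exp.2 (le_mul_of_one_le_right hlogE hγ1)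
  rcases le_or_gt (1 / 8) (hGamma g p) with h5 | h5
  · refine (H2 A hA g hg σ hσ p h3 (by linarith) h5 h2).mono (hEexp.trans ?_) hpΩ hrΩ
    refine Real.exp_le_exp.2 (mul_le_mul_of_nonneg_right (by linarith) (by linarith))
  · obtain ⟨q, hqx, hqt, hql, hqu, hconn⟩ := H1 A hA g hg σ hσ p h1 h5.le h3 h4
    have h6 : |q.2| ≤ |q.2 - p.2| + |p.2| := by simpa using abs_add_le (q.2 - p.2) p.2
    have hconn' := H2 A hA g hg σ hσ q (by rwa [hqx]) (by linarith) hql hqu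
    refine (hconn.trans hconn' (Real.exp_pos _).le (by linarith)).mono ?_ hpΩ hrΩ
    rw [add_mul, Real.exp_add]
    exact mul_le_mul_of_nonneg_left hEexp (Real.exp_pos _).le

end InteriorChain

section BoundaryDecay

open Filter Topology Set MeasureTheory Metric

variable {m : ℕ} {A : Spc m → Matrix (Fin (m + 1)) (Fin (m + 1)) ℝ} {lam Lam : ℝ}

/-- A thin layer above a graph occupies a small fraction of a large parabolic cylinder. -/
theorem volume_strip_le {g : Spc' m → ℝ → ℝ} (hg : Continuous fun q : Spc' m × ℝ => g q.1 q.2)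
    (x : Spc m) (t : ℝ) {h R : ℝ} {J : ℕ} (hh : 0 < h) (hR : 0 < R) (hJ : J * h ≤ R) :
    J * volume {q ∈ pcyl x t R | 0 < hGamma g q ∧ hGamma g q < h} ≤ volume (pcyl x t (2 * R)) := by
  set S : Set (Spc m × ℝ) := {q ∈ pcyl x t R | 0 < hGamma g q ∧ hGamma g q < h} with hS
  have hSm : MeasurableSet S := by
    have hc := continuous_hGamma hg
    exact ((isOpen_pcyl x t R).inter ((isOpen_lt continuous_const hc).inter
      (isOpen_lt hc continuous_const))).measurableSet
  set e : ℕ → Spc m × ℝ := fun j => (mkPt 0 (-(j * h)), 0) with he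
  have hshift : ∀ (j : ℕ) (q : Spc m × ℝ), hGamma g (q + e j) = hGamma g q - j * h := by
    intro j q
    unfold hGamma
    rw [Prod.fst_add, Prod.snd_add, xprime_add, xlast_add]
    show xlast q.1 + xlast (mkPt _ _) - g (xprime q.1 + xprime (mkPt _ _)) (q.2 + 0) = _
    rw [xlast_mkPt, xprime_mkPt, add_zero, add_zero]
    ring
  have hdisj : Pairwise (Function.onFun Disjoint fun j : ℕ => (fun q => q + e j) ⁻¹' S) := by
    have haux : ∀ i j : ℕ, i < j → ∀ q : Spc m × ℝ, q + e i ∈ S → q + e j ∈ S → False := by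
      intro i j hij q hi hj
      have h1 := hi.2.2
      have h2 := hj.2.1
      rw [hshift] at h1 h2
      have h3 : ((i : ℝ) + 1) ≤ j := by exact_mod_cast hij
      nlinarith only [h1, h2, h3, hh]
    intro i j hij
    refine Set.disjoint_left.2 fun q hi hj => ?_
    rcases lt_or_gt_of_ne hij with h1 | h1
    · exact haux i j h1 q hi hj
    · exact haux j i h1 q hj hi
  have hsub : (⋃ j ∈ Finset.range J, (fun q => q + e j) ⁻¹' S) ⊆ pcyl x t (2 * R) := by
    intro q hq
    simp only [mem_iUnion, Finset.mem_range, mem_preimage] at hq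
    obtain ⟨j, hj, ⟨hq1, hq2⟩, -⟩ := hq
    have h1 : ((j : ℝ)) ≤ J := by exact_mod_cast hj.le
    have h2 : ‖mkPt (0 : Spc' m) (-(j * h))‖ ≤ R := by
      refine (norm_le_xprime_add_xlast _).trans ?_
      rw [xprime_mkPt, xlast_mkPt, norm_zero, zero_add, abs_neg, abs_of_nonneg (by positivity)]
      nlinarith only [h1, hh, hJ]
    have h3 : dist (q.1 + mkPt 0 (-(j * h))) x < R := hq1
    have h4 : q.2 + 0 ∈ Ioo (t - R ^ 2) t := hq2
    rw [add_zero] at h4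
    refine ⟨?_, ?_, h4.2⟩
    · rw [mem_ball, dist_eq_norm]
      rw [dist_eq_norm] at h3
      have h5 : q.1 - x = (q.1 + mkPt 0 (-(j * h)) - x) - mkPt 0 (-(j * h)) := by abel
      rw [h5]
      refine (norm_sub_le _ _).trans_lt ?_
      linarith
    · nlinarith only [h4.1, hR]
  have : (volume : Measure (Spc m × ℝ)).IsAddRightInvariant := by
    rw [Measure.volume_eq_prod]
    infer_instance
  calc J * volume S = ∑ j ∈ Finset.range J, volume ((fun q => q + e j) ⁻¹' S) := by
        rw [Finset.sum_congr rfl fun j _ =>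
          (measurePreserving_add_right volume (e j)).measure_preimage hSm.nullMeasurableSet,
          Finset.sum_const, Finset.card_range, nsmul_eq_mul]
    _ = volume (⋃ j ∈ Finset.range J, (fun q => q + e j) ⁻¹' S) := by
        rw [measure_biUnion_finset (fun i _ j _ hij => hdisj hij)
          (fun j _ => (measurable_add_const (e j)) hSm)]
    _ ≤ _ := measure_mono hsub

theorem strip_halving (m : ℕ) {lam Lam : ℝ} (hlam : 0 < lam) (hLam : 0 ≤ Lam) :
    ∃ J : ℕ, 0 < J ∧ ∀ A : Spc m → Matrix (Fin (m + 1)) (Fin (m + 1)) ℝ, IsElliptic lam Lam A →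
    ∀ g : Spc' m → ℝ → ℝ, (Continuous fun q : Spc' m × ℝ => g q.1 q.2) →
    ∀ (z : Spc m × ℝ → ℝ) (x : Spc m) (t h M : ℝ), 0 < h → 0 < M →
    ContinuousOn z (pcylc x t (J * h)) → (∀ p ∈ pcylc x t (J * h), z p ≤ M) →
    (∀ p ∈ pcyl x t (J * h), 0 < z p → SubAt A z p ∧ 0 < hGamma g p ∧ hGamma g p < h) →
    z (x, t) ≤ M / 2 := by
  obtain ⟨ε, hε, H⟩ := abp_estimate m hlam hLam
  set V := volume (ball (0 : Spc m) 1 ×ˢ Ioo (-1 : ℝ) 0) with hV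
  have hVtop : V ≠ ⊤ := by
    rw [hV, Measure.volume_eq_prod, Measure.prod_prod]
    exact ENNReal.mul_ne_top measure_ball_lt_top.ne measure_Ioo_lt_top.ne
  obtain ⟨J, hJ⟩ := exists_nat_gt (2 ^ (m + 3) * V.toReal / ε)
  have hJ0 : (0 : ℝ) < J := lt_of_le_of_lt (by positivity) hJ
  refine ⟨J, Nat.cast_pos.1 hJ0, fun A hA g hg z x t h M hh hM hz hzM hzs => ?_⟩
  by_contra! hlt
  set R := (J : ℝ) * h with hR
  have hR0 : 0 < R := by positivity
  have h1 := H A hA z x t R M hR0 hM hz hzM (fun p hp hp0 => (hzs p hp hp0).1) hlt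
  have hsub : {p ∈ pcyl x t R | 0 < z p} ⊆ {q ∈ pcyl x t R | 0 < hGamma g q ∧ hGamma g q < h} :=
    fun p hp => ⟨hp.1, (hzs p hp.1 hp.2).2⟩
  have h2 := h1.trans (measure_mono hsub)
  have h3 : (J : ENNReal) * ENNReal.ofReal (ε * R ^ (m + 3)) ≤
      ENNReal.ofReal ((2 * R) ^ (m + 3)) * V := by
    rw [hV, ← volume_pcyl x t (by positivity : 0 < 2 * R)]
    exact (mul_le_mul_right h2 _).trans (volume_strip_le hg x t hh hR0 le_rfl)
  rw [← ENNReal.ofReal_toReal hVtop, ← ENNReal.ofReal_mul (by positivity),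
    ← ENNReal.ofReal_natCast, ← ENNReal.ofReal_mul (by positivity),
    ENNReal.ofReal_le_ofReal_iff (by positivity), mul_pow 2 R] at h3
  rw [div_lt_iff₀ hε] at hJ
  have h4 : 0 < R ^ (m + 3) := by positivity
  nlinarith only [h3, mul_lt_mul_of_pos_right hJ h4]

/-- The window of size `s` around the half-size cylinder, including points below the graph. -/
def window (g : Spc' m → ℝ → ℝ) (s : ℝ) : Set (Spc m × ℝ) :=
  {p | ‖xprime p.1‖ ≤ 1 / 2 + s ∧ |p.2| ≤ 1 / 4 + s ∧ hGamma g p ≤ 5 / 8}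

theorem window_mono (g : Spc' m → ℝ → ℝ) {s s' : ℝ} (h : s ≤ s') : window g s ⊆ window g s' :=
  fun _ hp => ⟨hp.1.trans (by linarith), hp.2.1.trans (by linarith), hp.2.2⟩

theorem mem_Cyl_of_mem_window {g : Spc' m → ℝ → ℝ} {s : ℝ} (hs : s ≤ 1 / 8) {p : Spc m × ℝ}
    (hp : p ∈ window g s) (h0 : 0 < hGamma g p) : p ∈ Cyl g 1 :=
  mem_Cyl_one (by linarith [hp.1]) (by linarith [hp.2.1]) h0 (by linarith [hp.2.2])

theorem isOpen_Cyl {g : Spc' m → ℝ → ℝ} (hg : Continuous fun q : Spc' m × ℝ => g q.1 q.2) (r : ℝ) :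
    IsOpen (Cyl g r) := by
  have h1 : Continuous fun p : Spc m × ℝ => ‖xprime p.1‖ :=
    (continuous_xprime.comp continuous_fst).norm
  have h2 : Continuous fun p : Spc m × ℝ => xlast p.1 := continuous_xlast.comp continuous_fst
  have h3 : Continuous fun p : Spc m × ℝ => g (xprime p.1) p.2 :=
    hg.comp ((continuous_xprime.comp continuous_fst).prodMk continuous_snd)
  exact (isOpen_lt h1 continuous_const).inter ((isOpen_lt continuous_const continuous_snd).inter
    ((isOpen_lt continuous_snd continuous_const).inter ((isOpen_lt h3 h2).inter
      (isOpen_lt h2 (h3.add continuous_const)))))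

/-- The positive part of `w` above the graph, extended by zero below it. -/
def posExt (g : Spc' m → ℝ → ℝ) (w : Spc m × ℝ → ℝ) (p : Spc m × ℝ) : ℝ :=
  if 0 < hGamma g p then max (w p) 0 else 0

theorem posExt_of_pos {g : Spc' m → ℝ → ℝ} {w : Spc m × ℝ → ℝ} {p : Spc m × ℝ}
    (hp : 0 < hGamma g p) : posExt g w p = max (w p) 0 := if_pos hp

theorem posExt_of_nonpos {g : Spc' m → ℝ → ℝ} {w : Spc m × ℝ → ℝ} {p : Spc m × ℝ}
    (hp : hGamma g p ≤ 0) : posExt g w p = 0 := if_neg (not_lt.2 hp)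

theorem continuousOn_posExt {g : Spc' m → ℝ → ℝ}
    (hg : Continuous fun q : Spc' m × ℝ => g q.1 q.2) {u w : Spc m × ℝ → ℝ}
    (hw : ContinuousOn w (Cyl g 1)) (hwu : ∀ p ∈ Cyl g 1, w p ≤ u p)
    (hu : VanishesOn u (Cyl g 1) (graphSet g)) : ContinuousOn (posExt g w) (window g (1 / 8)) := by
  have hc := continuous_hGamma (m := m) hg
  intro p hp
  refine ContinuousAt.continuousWithinAt ?_
  rcases lt_trichotomy (hGamma g p) 0 with h0 | h0 | h0
  · have h1 : posExt g w =ᶠ[𝓝 p] fun _ => 0 := by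
      filter_upwards [(isOpen_lt hc continuous_const).mem_nhds h0] with q hq
      exact posExt_of_nonpos (le_of_lt hq)
    exact continuousAt_const.congr h1.symm
  · have hlim : Tendsto u (𝓝[Cyl g 1] p) (𝓝 0) := by
      by_cases hcl : p ∈ closure (Cyl g 1)
      · refine hu p ⟨?_, hcl⟩
        unfold hGamma at h0
        exact sub_eq_zero.1 h0
      · rw [mem_closure_iff_nhdsWithin_neBot, not_neBot] at hcl
        rw [hcl]
        exact tendsto_bot
    rw [ContinuousAt, posExt_of_nonpos h0.le, Metric.tendsto_nhds]
    intro ε hε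
    have h1 := eventually_nhdsWithin_iff.1 (hlim.eventually_lt_const hε)
    have h2 : ∀ᶠ q in 𝓝 p, ‖xprime q.1‖ < 1 ∧ |q.2| < 1 ∧ hGamma g q < 1 := by
      have e1 : Continuous fun q : Spc m × ℝ => ‖xprime q.1‖ :=
        (continuous_xprime.comp continuous_fst).norm
      have e2 : Continuous fun q : Spc m × ℝ => |q.2| := continuous_snd.abs
      have hp1 : ‖xprime p.1‖ < 1 := by linarith [hp.1]
      have hp2 : |p.2| < 1 := by linarith [hp.2.1]
      have hp3 : hGamma g p < 1 := by linarith
      exact Filter.inter_mem ((isOpen_lt e1 continuous_const).mem_nhds hp1)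
        (Filter.inter_mem ((isOpen_lt e2 continuous_const).mem_nhds hp2)
          ((isOpen_lt hc continuous_const).mem_nhds hp3))
    filter_upwards [h1, h2] with q hq1 hq2
    rw [Real.dist_eq, sub_zero]
    rcases le_or_gt (hGamma g q) 0 with h3 | h3
    · rw [posExt_of_nonpos h3, abs_zero]; exact hε
    · have hqC := mem_Cyl_one hq2.1 hq2.2.1 h3 hq2.2.2
      rw [posExt_of_pos h3, abs_of_nonneg (le_max_right _ _)]
      exact max_lt ((hwu q hqC).trans_lt (hq1 hqC)) hε
  · have hpC := mem_Cyl_of_mem_window le_rfl hp h0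
    have h1 : posExt g w =ᶠ[𝓝 p] fun q => max (w q) 0 := by
      filter_upwards [(isOpen_lt continuous_const hc).mem_nhds h0] with q hq
      exact posExt_of_pos hq
    exact ContinuousAt.congr
      ((hw.continuousAt ((isOpen_Cyl hg 1).mem_nhds hpC)).max continuousAt_const) h1.symm

theorem subAt_posExt {g : Spc' m → ℝ → ℝ} (hg : Continuous fun q : Spc' m × ℝ => g q.1 q.2)
    {w : Spc m × ℝ → ℝ} (hw : ContinuousOn w (Cyl g 1)) (hsol : ∀ p ∈ Cyl g 1, SolAt A w p)
    {p : Spc m × ℝ} (hp : p ∈ window g (1 / 8)) (hpos : 0 < posExt g w p) :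
    SubAt A (posExt g w) p ∧ 0 < hGamma g p ∧ 0 < w p := by
  have h0 : 0 < hGamma g p := by
    by_contra h
    rw [posExt_of_nonpos (not_lt.1 h)] at hpos
    exact lt_irrefl _ hpos
  have hw0 : 0 < w p := by
    rw [posExt_of_pos h0] at hpos
    exact (lt_max_iff.1 hpos).resolve_right (lt_irrefl _)
  have hpC := mem_Cyl_of_mem_window le_rfl hp h0
  refine ⟨(hsol p hpC).subAt.congr_nhds ?_, h0, hw0⟩
  filter_upwards [(isOpen_lt continuous_const (continuous_hGamma hg)).mem_nhds h0,
    (hw.continuousAt ((isOpen_Cyl hg 1).mem_nhds hpC)).eventually (lt_mem_nhds hw0)] with q h1 h2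
  rw [posExt_of_pos h1, max_eq_left (le_of_lt h2)]

theorem pcylc_subset_window {α β K δ : ℝ} {g : Spc' m → ℝ → ℝ} (hg : HolderSemi α β K g)
    (hα : 0 < α) (hβ : 0 < β) (hK : 0 < K) (hδ : K * (δ ^ α + δ ^ β) ≤ 1 / 8)
    {p : Spc m × ℝ} {R s : ℝ} (hp : p ∈ window g s) (hp8 : hGamma g p ≤ 1 / 8) (hR0 : 0 < R)
    (hRδ : R ≤ δ) (hR8 : R ≤ 1 / 8) : pcylc p.1 p.2 R ⊆ window g (s + R) := by
  rintro ⟨y, r⟩ ⟨hy, hr1, hr2⟩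
  rw [mem_closedBall, dist_eq_norm] at hy
  simp only at hy hr1 hr2
  have hRR : R ^ 2 ≤ R := by nlinarith only [hR0, hR8]
  have h1 := (norm_xprime_le _).trans hy
  have h2 := abs_le.1 ((abs_xlast_le _).trans hy)
  rw [xprime_sub] at h1
  rw [xlast_sub] at h2
  have h3 : |r - p.2| ≤ R := abs_le.2 ⟨by linarith, by linarith⟩
  have h4 := abs_le.1 (hg.osc_le hα hβ hK hδ (h1.trans hRδ) (h3.trans hRδ))
  refine ⟨?_, ?_, ?_⟩
  · have h5 : ‖xprime y‖ ≤ ‖xprime y - xprime p.1‖ + ‖xprime p.1‖ := by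
      simpa using norm_add_le (xprime y - xprime p.1) (xprime p.1)
    have := hp.1
    show ‖xprime y‖ ≤ _
    linarith
  · have h5 : |r| ≤ |r - p.2| + |p.2| := by simpa using abs_add_le (r - p.2) p.2
    have := hp.2.1
    show |r| ≤ _
    linarith
  · have h5 : hGamma g p = xlast p.1 - g (xprime p.1) p.2 := rfl
    show xlast y - g (xprime y) r ≤ 5 / 8
    linarith [h2.2, h4.1]

theorem strip_decay (m : ℕ) {lam Lam α β K : ℝ} (hlam : 0 < lam) (hLam : 0 ≤ Lam)
    (hα : 0 < α) (hβ : 0 < β) (hK : 0 < K) :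
    ∃ J : ℕ, 0 < J ∧ ∃ δ > (0 : ℝ),
    ∀ A : Spc m → Matrix (Fin (m + 1)) (Fin (m + 1)) ℝ, IsElliptic lam Lam A →
    ∀ g : Spc' m → ℝ → ℝ, (Continuous fun q : Spc' m × ℝ => g q.1 q.2) → HolderSemi α β K g →
    ∀ u w : Spc m × ℝ → ℝ, VanishesOn u (Cyl g 1) (graphSet g) → (∀ p ∈ Cyl g 1, w p ≤ u p) →
    ContinuousOn w (Cyl g 1) → (∀ p ∈ Cyl g 1, SolAt A w p) → ∀ h > (0 : ℝ), J * h ≤ δ →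
    ∀ M > (0 : ℝ), ∀ (n : ℕ) (s : ℝ), s + n * (J * h) ≤ 1 / 8 →
    (∀ p ∈ window g (s + n * (J * h)), h ≤ hGamma g p → w p ≤ 0) →
    (∀ p ∈ window g (s + n * (J * h)), 0 < hGamma g p → w p ≤ M) →
    ∀ p ∈ window g s, 0 < hGamma g p → w p ≤ M / 2 ^ n := by
  obtain ⟨J, hJ, H⟩ := strip_halving m hlam hLam
  obtain ⟨δ, hδ0, -, hδ⟩ := exists_holder_modulus hα hβ hK (show (0 : ℝ) < 1 / 8 by norm_num)
  refine ⟨J, hJ, min δ (1 / 8), lt_min hδ0 (by norm_num), ?_⟩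
  intro A hA g hgc hg u w hu hwu hw hsol h hh hJh M hM n
  have hJ1 : (1 : ℝ) ≤ J := by exact_mod_cast hJ
  set R := (J : ℝ) * h with hR
  have hR0 : 0 < R := by positivity
  have hRδ : R ≤ δ := hJh.trans (min_le_left _ _)
  have hR8 : R ≤ 1 / 8 := hJh.trans (min_le_right _ _)
  have hhR : h ≤ R := by nlinarith only [hJ1, hh, hR]
  induction n with
  | zero => intro s _ _ hs p hp hp0; simpa using hs p (by simpa using hp) hp0
  | succ n ih =>
    intro s hs8 hpos hsM p hp hp0
    push_cast at hs8 hpos hsM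
    have hnR : 0 ≤ n * R := by positivity
    have e : s + R + n * R = s + (n + 1) * R := by ring
    have hstep := ih (s + R) (by rw [e]; exact hs8) (by rw [e]; exact hpos) (by rw [e]; exact hsM)
    rcases le_or_gt h (hGamma g p) with h1 | h1
    · exact (hpos p (window_mono g (by linarith) hp) h1).trans (by positivity)
    have hsub := pcylc_subset_window hg hα hβ hK hδ hp (by linarith) hR0 hRδ hR8
    have hsub' : pcylc p.1 p.2 R ⊆ window g (1 / 8) :=
      hsub.trans (window_mono g (by linarith))
    have hMn : 0 < M / 2 ^ n := by positivity
    have h2 := H A hA g hgc (posExt g w) p.1 p.2 h (M / 2 ^ n) hh hMn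
      ((continuousOn_posExt hgc hw hwu hu).mono hsub')
      (fun q hq => by
        rcases le_or_gt (hGamma g q) 0 with h3 | h3
        · rw [posExt_of_nonpos h3]; exact hMn.le
        · rw [posExt_of_pos h3]; exact max_le (hstep q (hsub hq) h3) hMn.le)
      (fun q hq hq0 => by
        have hqW := hsub' (pcyl_subset_pcylc _ _ _ hq)
        obtain ⟨h3, h4, h5⟩ := subAt_posExt hgc hw hsol hqW hq0
        refine ⟨h3, h4, ?_⟩
        by_contra! h6
        exact absurd (hpos q (window_mono g (by linarith) (hsub (pcyl_subset_pcylc _ _ _ hq))) h6)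
          (not_le.2 h5))
    rw [pow_succ, ← div_div]
    refine (le_max_left (w p) 0).trans ?_
    rw [← posExt_of_pos hp0]
    exact h2

end BoundaryDecay

section BoundaryHarnack

open Filter Topology Set MeasureTheory Metric

variable {m : ℕ} {A : Spc m → Matrix (Fin (m + 1)) (Fin (m + 1)) ℝ} {lam Lam : ℝ}

/-- Dyadic heights `h₀ 2⁻ᵏ` for which exponentially many halvings in the strip of that height
use up a geometrically small amount of room. -/
theorem exists_dyadic_scales {γ D δ : ℝ} {J : ℕ} (hγ0 : 0 < γ) (hγ1 : γ < 1) (hD : 0 < D)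
    (hδ : 0 < δ) (hJ : 0 < J) :
    ∃ h₀ > (0 : ℝ), ∃ ρ > (0 : ℝ), h₀ ≤ 1 / 2 ∧ J * h₀ ≤ δ ∧ ρ < 1 ∧ ∀ k : ℕ,
      1 ≤ (h₀ / 2 ^ k) ^ (-γ) ∧ h₀ ^ (-γ) ≤ (h₀ / 2 ^ k) ^ (-γ) ∧
      (h₀ / 2 ^ (k + 1)) ^ (-γ) ≤ 2 * (h₀ / 2 ^ k) ^ (-γ) ∧ k ≤ 2 / γ * (h₀ / 2 ^ k) ^ (-γ) ∧
      ∃ n : ℕ, Real.exp (D * (h₀ / 2 ^ k) ^ (-γ)) ≤ 2 ^ n ∧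
        n * (J * (h₀ / 2 ^ k)) ≤ ρ ^ k * (1 - ρ) / 16 := by
  have hJ0 : (0 : ℝ) < J := by exact_mod_cast hJ
  have hγ' : 0 < 1 - γ := by linarith
  set ρ : ℝ := 2 ^ (-(1 - γ)) with hρ
  have hρ0 : 0 < ρ := by positivity
  have hρ1 : ρ < 1 := Real.rpow_lt_one_of_one_lt_of_neg (by norm_num) (by linarith)
  set c : ℝ := (1 - ρ) / 16 / ((2 * D + 1) * J) with hc
  have hc0 : 0 < c := by
    have : 0 < 1 - ρ := by linarith
    positivity
  set h₀ : ℝ := min (1 / 2) (min (δ / J) (c ^ (1 / (1 - γ)))) with hh₀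
  have h0 : 0 < h₀ := by
    refine lt_min (by norm_num) (lt_min (by positivity) (by positivity))
  have hle1 : h₀ ≤ 1 / 2 := min_le_left _ _
  have hle2 : h₀ ≤ δ / J := (min_le_right _ _).trans (min_le_left _ _)
  have hle3 : h₀ ^ (1 - γ) ≤ c := by
    have h1 : h₀ ≤ c ^ (1 / (1 - γ)) := (min_le_right _ _).trans (min_le_right _ _)
    calc h₀ ^ (1 - γ) ≤ (c ^ (1 / (1 - γ))) ^ (1 - γ) := Real.rpow_le_rpow h0.le h1 hγ'.le
      _ = c := by rw [← Real.rpow_mul hc0.le, one_div_mul_cancel hγ'.ne', Real.rpow_one]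
  refine ⟨h₀, h0, ρ, hρ0, hle1, ?_, hρ1, fun k => ?_⟩
  · rw [le_div_iff₀ hJ0] at hle2
    linarith
  have h2k : (1 : ℝ) ≤ 2 ^ k := one_le_pow₀ (by norm_num)
  have hk0 : 0 < h₀ / 2 ^ k := by positivity
  have hkle : h₀ / 2 ^ k ≤ h₀ := div_le_self h0.le h2k
  have hX1 : 1 ≤ (h₀ / 2 ^ k) ^ (-γ) := one_le_rpow_neg hk0 (by linarith) hγ0
  have hX0 : 1 ≤ h₀ ^ (-γ) := one_le_rpow_neg h0 (by linarith) hγ0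
  have hpow : ∀ s : ℝ, (h₀ / 2 ^ k) ^ s = h₀ ^ s * ((2 : ℝ) ^ (-s)) ^ k := by
    intro s
    rw [Real.div_rpow h0.le (by positivity), Real.rpow_neg (by norm_num), inv_pow, div_eq_mul_inv,
      ← Real.rpow_natCast, ← Real.rpow_natCast, ← Real.rpow_mul (by norm_num),
      ← Real.rpow_mul (by norm_num), mul_comm s]
  refine ⟨hX1, Real.rpow_le_rpow_of_nonpos hk0 hkle (by linarith), ?_, ?_, ?_⟩
  · have e : h₀ / 2 ^ (k + 1) = (h₀ / 2 ^ k) / 2 := by rw [pow_succ, div_div]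
    rw [e, Real.div_rpow hk0.le (by norm_num), Real.rpow_neg (by norm_num : (0 : ℝ) ≤ 2),
      div_inv_eq_mul, mul_comm]
    refine mul_le_mul_of_nonneg_right ?_ (by positivity)
    calc (2 : ℝ) ^ γ ≤ 2 ^ (1 : ℝ) := Real.rpow_le_rpow_of_exponent_le (by norm_num) hγ1.le
      _ = 2 := Real.rpow_one 2
  · have h3 : γ * k / 2 ≤ ((2 : ℝ) ^ γ) ^ k := by
      rw [← Real.rpow_natCast, ← Real.rpow_mul (by norm_num), Real.rpow_def_of_pos (by norm_num)]
      have h4 := Real.add_one_le_exp (Real.log 2 * (γ * k))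
      have h5 := Real.log_two_gt_d9
      have h6 : 0 ≤ γ * k := by positivity
      nlinarith only [h4, h5, h6]
    have h4 : γ * k / 2 ≤ (h₀ / 2 ^ k) ^ (-γ) := by
      rw [hpow, neg_neg]
      exact h3.trans (le_mul_of_one_le_left (by positivity) hX0)
    rw [div_mul_eq_mul_div, le_div_iff₀ hγ0]
    linarith
  · set X := (h₀ / 2 ^ k) ^ (-γ) with hX
    refine ⟨⌈2 * D * X⌉₊, ?_, ?_⟩
    · have h3 : 2 * D * X ≤ ⌈2 * D * X⌉₊ := Nat.le_ceil _
      have h5 := Real.log_two_gt_d9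
      rw [← Real.exp_log (by positivity : (0 : ℝ) < 2 ^ ⌈2 * D * X⌉₊), Real.log_pow]
      refine Real.exp_le_exp.2 ?_
      have h6 : 0 ≤ D * X := by positivity
      nlinarith only [h3, h5, h6]
    · have h3 : (⌈2 * D * X⌉₊ : ℝ) ≤ (2 * D + 1) * X := by
        have := (Nat.ceil_lt_add_one (by positivity : 0 ≤ 2 * D * X)).le
        linarith
      have h4 : X * (h₀ / 2 ^ k) = h₀ ^ (1 - γ) * ρ ^ k := by
        rw [hρ, ← hpow, hX]
        nth_rewrite 2 [← Real.rpow_one (h₀ / 2 ^ k)]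
        rw [← Real.rpow_add hk0]
        congr 1
        ring
      calc ⌈2 * D * X⌉₊ * (J * (h₀ / 2 ^ k)) ≤ (2 * D + 1) * X * (J * (h₀ / 2 ^ k)) :=
            mul_le_mul_of_nonneg_right h3 (by positivity)
        _ = (2 * D + 1) * J * (X * (h₀ / 2 ^ k)) := by ring
        _ ≤ (2 * D + 1) * J * (c * ρ ^ k) := by
            rw [h4]
            gcongr
        _ = _ := by
            rw [hc]
            field_simp

theorem exists_bound_window {α β K : ℝ} {g : Spc' m → ℝ → ℝ} (hα : 0 < α) (hβ : 0 < β)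
    (hK : 0 < K) (hgc : Continuous fun q : Spc' m × ℝ => g q.1 q.2) (hg : HolderSemi α β K g)
    {u : Spc m × ℝ → ℝ} (hu : ContinuousOn u (Cyl g 1))
    (hu0 : VanishesOn u (Cyl g 1) (graphSet g)) :
    ∃ M : ℝ, ∀ p ∈ window g (1 / 8), 0 < hGamma g p → u p ≤ M := by
  have hc := continuous_hGamma (m := m) hgc
  set S : Set (Spc m × ℝ) := {p | p ∈ window g (1 / 8) ∧ 0 ≤ hGamma g p} with hS
  have hSc : IsClosed S := by
    have e1 : Continuous fun q : Spc m × ℝ => ‖xprime q.1‖ :=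
      (continuous_xprime.comp continuous_fst).norm
    have e2 : Continuous fun q : Spc m × ℝ => |q.2| := continuous_snd.abs
    exact ((isClosed_le e1 continuous_const).inter ((isClosed_le e2 continuous_const).inter
      (isClosed_le hc continuous_const))).inter (isClosed_le continuous_const hc)
  have hSb : S ⊆ closedBall 0 (3 + |g 0 0| + 2 * K) := by
    rintro ⟨x, t⟩ ⟨⟨h1, h2, h3⟩, h4⟩
    have h1' : ‖xprime x‖ ≤ 1 / 2 + 1 / 8 := h1
    have h2' : |t| ≤ 1 / 4 + 1 / 8 := h2
    have h5 : |g (xprime x) t - g 0 0| ≤ K * (1 + 1) := by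
      refine (hg _ _ _ _).trans ?_
      rw [sub_zero, sub_zero]
      gcongr
      · exact Real.rpow_le_one (norm_nonneg _) (by linarith) hα.le
      · exact Real.rpow_le_one (abs_nonneg _) (by linarith) hβ.le
    have h6 : hGamma g (x, t) = xlast x - g (xprime x) t := rfl
    have h7 : |xlast x| ≤ 1 + |g 0 0| + 2 * K := by
      have h8 := abs_le.1 h5
      have h9 := abs_le.1 (le_refl |g 0 0|)
      exact abs_le.2 ⟨by linarith, by linarith⟩
    rw [mem_closedBall, dist_zero_right, Prod.norm_mk, Real.norm_eq_abs]
    have h10 := abs_nonneg (g 0 0)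
    refine max_le ((norm_le_xprime_add_xlast x).trans (by linarith)) (by linarith)
  have hcomp : IsCompact S :=
    Metric.isCompact_of_isClosed_isBounded hSc (isBounded_closedBall.subset hSb)
  obtain ⟨M, hM⟩ := hcomp.exists_bound_of_continuousOn
    ((continuousOn_posExt hgc hu (fun _ _ => le_rfl) hu0).mono fun p hp => hp.1)
  refine ⟨M, fun p hp hp0 => ?_⟩
  calc u p ≤ posExt g u p := by rw [posExt_of_pos hp0]; exact le_max_left _ _
    _ ≤ ‖posExt g u p‖ := Real.le_norm_self _
    _ ≤ M := hM p ⟨hp, hp0.le⟩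

theorem harnack_normalized (m : ℕ) {lam Lam α β K : ℝ} (hlam : 0 < lam) (hLam : 0 ≤ Lam)
    (hα : 1 / 2 < α) (hβ : 1 / 3 < β) (hK : 0 < K) :
    ∃ C > (0 : ℝ), ∀ A : Spc m → Matrix (Fin (m + 1)) (Fin (m + 1)) ℝ, IsElliptic lam Lam A →
    ∀ g : Spc' m → ℝ → ℝ, (Continuous fun q : Spc' m × ℝ => g q.1 q.2) → HolderSemi α β K g →
    ∀ u v : Spc m × ℝ → ℝ, NNSol A u (Cyl g 1) → NNSol A v (Cyl g 1) →
    VanishesOn u (Cyl g 1) (graphSet g) → u (refPt g 1) = 1 → v (refPt g (-1)) = 1 →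
    ∀ p ∈ Cyl g (1 / 2), u p ≤ C * v p := by
  obtain ⟨γ, hγ0, hγ1, hαγ, hβγ⟩ : ∃ γ : ℝ, 0 < γ ∧ γ < 1 ∧ 1 ≤ (1 + γ) * α ∧
      1 ≤ (2 + γ) * β := by
    have hα0 : 0 < α := by linarith
    have hβ0 : 0 < β := by linarith
    refine ⟨max (1 / 2) (max (1 / α - 1) (1 / β - 2)), lt_max_of_lt_left (by norm_num), ?_, ?_, ?_⟩
    · refine max_lt (by norm_num) (max_lt ?_ ?_)
      · have : 1 / α < 2 := by rw [div_lt_iff₀ hα0]; linarith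
        linarith
      · have : 1 / β < 3 := by rw [div_lt_iff₀ hβ0]; linarith
        linarith
    · rw [← div_le_iff₀ hα0]
      linarith [(le_max_left (1 / α - 1) (1 / β - 2)).trans (le_max_right (1 / 2) _)]
    · rw [← div_le_iff₀ hβ0]
      linarith [(le_max_right (1 / α - 1) (1 / β - 2)).trans (le_max_right (1 / 2) _)]
  have hα0 : 0 < α := by linarith
  have hβ0 : 0 < β := by linarith
  obtain ⟨B, hB, Hg⟩ := conn_growth m hlam hLam hα0 hβ0 hγ0 hαγ hβγ hK
  obtain ⟨J, hJ, δ, hδ, Hs⟩ := strip_decay m hlam hLam hα0 hβ0 hK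
  set D : ℝ := 3 * B + 1 + 2 / γ with hD
  have hγinv : 0 < 2 / γ := by positivity
  obtain ⟨h₀, hh₀, ρ, hρ, hh2, hJh, hρ1, Hk⟩ :=
    exists_dyadic_scales hγ0 hγ1 (by positivity : 0 < D) hδ hJ
  set h : ℕ → ℝ := fun k => h₀ / 2 ^ k with hh
  set X : ℕ → ℝ := fun k => h k ^ (-γ) with hX
  have hhpos : ∀ k, 0 < h k := fun k => by positivity
  have hhle : ∀ k, h k ≤ h₀ := fun k => div_le_self hh₀.le (one_le_pow₀ (by norm_num))
  have hJhk : ∀ k, J * h k ≤ δ := fun k =>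
    (mul_le_mul_of_nonneg_left (hhle k) (Nat.cast_nonneg J)).trans hJh
  have hX1 : ∀ k, 1 ≤ X k := fun k => (Hk k).1
  have hX0 : ∀ k, X 0 ≤ X k := fun k => by
    have e : X 0 = h₀ ^ (-γ) := by simp [hX, hh]
    rw [e]
    exact (Hk k).2.1
  have hXs : ∀ k, X (k + 1) ≤ 2 * X k := fun k => (Hk k).2.2.1
  have hXk : ∀ k : ℕ, k ≤ 2 / γ * X k := fun k => (Hk k).2.2.2.1
  have hXD : ∀ k, ∃ n : ℕ, Real.exp (D * X k) ≤ 2 ^ n ∧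
      n * (J * h k) ≤ ρ ^ k * (1 - ρ) / 16 := fun k => (Hk k).2.2.2.2
  have hρk : ∀ k : ℕ, 0 < ρ ^ k := fun k => by positivity
  have hρk1 : ∀ k : ℕ, ρ ^ k ≤ 1 := fun k => pow_le_one₀ hρ.le hρ1.le
  set C₀ : ℝ := 2 * Real.exp (B * X 0) with hC₀
  have hC₀0 : 0 < C₀ := by positivity
  set M₀ : ℝ := C₀ * Real.exp (B * X 0) with hM₀
  have hM₀0 : 0 < M₀ := by positivity
  refine ⟨M₀ + 2, by positivity, fun A hA g hgc hg u v hu hv hu0 hu1 hv1 => ?_⟩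
  have hconn : ∀ σ : ℝ, |σ| = 1 → ∀ k, ∀ p ∈ window g (1 / 8), h k ≤ hGamma g p →
      Conn A (Cyl g 1) σ (Real.exp (B * X k)) p (refPt g σ) := by
    intro σ hσ k p hp hpk
    refine (Hg A hA g hg σ hσ p ((hhpos k).trans_le hpk) hp.2.2 (by linarith [hp.1])
      (by linarith [hp.2.1])).mono (Real.exp_le_exp.2 (mul_le_mul_of_nonneg_left ?_ hB.le))
      (mem_Cyl_of_mem_window le_rfl hp ((hhpos k).trans_le hpk)) (refPt_mem_Cyl g hσ)
    exact Real.rpow_le_rpow_of_nonpos (hhpos k) hpk (by linarith)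
  have hup : ∀ k, ∀ p ∈ window g (1 / 8), h k ≤ hGamma g p → u p ≤ Real.exp (B * X k) := by
    intro k p hp hpk
    have h1 := (hconn 1 abs_one k p hp hpk u hu).1 rfl
    rwa [hu1, mul_one] at h1
  have hlow : ∀ k, ∀ p ∈ window g (1 / 8), h k ≤ hGamma g p → 1 ≤ Real.exp (B * X k) * v p := by
    intro k p hp hpk
    have h1 := (hconn (-1) (by simp) k p hp hpk v hv).2 rfl
    rwa [hv1] at h1
  have hcarleson : ∀ p ∈ window g (1 / 16), 0 < hGamma g p → u p ≤ C₀ := by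
    have hstep : ∀ k,
        (∀ p ∈ window g (1 / 8 - ρ ^ (k + 1) / 16), 0 < hGamma g p →
          u p ≤ 2 * Real.exp (B * X (k + 1))) →
        ∀ p ∈ window g (1 / 8 - ρ ^ k / 16), 0 < hGamma g p → u p ≤ 2 * Real.exp (B * X k) := by
      intro k IH p hp hp0
      obtain ⟨n, hn1, hn2⟩ := hXD k
      have hs : 1 / 8 - ρ ^ k / 16 + n * (J * h k) ≤ 1 / 8 - ρ ^ (k + 1) / 16 := by
        rw [pow_succ]
        linarith
      have hs8 : 1 / 8 - ρ ^ (k + 1) / 16 ≤ 1 / 8 := by linarith [hρk (k + 1)]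
      have hE : 0 < Real.exp (B * X k) := Real.exp_pos _
      have h1 := Hs A hA g hgc hg u (fun q => 1 * u q + 0 * u q + -Real.exp (B * X k)) hu0
        (fun q _ => by linarith)
        (((continuousOn_const.mul hu.1).add (continuousOn_const.mul hu.1)).add continuousOn_const)
        (fun q hq => SolAt.comb (hu.2.1 q hq) (hu.2.1 q hq) _ _ _) (h k) (hhpos k) (hJhk k)
        (2 * Real.exp (B * X (k + 1))) (by positivity) n _ (hs.trans hs8)
        (fun q hq hqk => by linarith [hup k q (window_mono g (hs.trans hs8) hq) hqk])
        (fun q hq hq0 => by linarith [IH q (window_mono g hs hq) hq0]) p hp hp0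
      have h2 : 2 * Real.exp (B * X (k + 1)) / 2 ^ n ≤ Real.exp (B * X k) := by
        rw [div_le_iff₀ (by positivity)]
        have h3 : 2 * Real.exp (B * X (k + 1)) ≤ Real.exp (D * X k) := by
          have h4 : (2 : ℝ) ≤ Real.exp 1 := by linarith [Real.add_one_le_exp 1]
          calc 2 * Real.exp (B * X (k + 1)) ≤ Real.exp 1 * Real.exp (B * X (k + 1)) := by gcongr
            _ = Real.exp (1 + B * X (k + 1)) := by rw [Real.exp_add]
            _ ≤ Real.exp (D * X k) := by
              refine Real.exp_le_exp.2 ?_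
              have h5 := mul_le_mul_of_nonneg_left (hXs k) hB.le
              have h6 := mul_le_mul_of_nonneg_left (hX1 k) hB.le
              have h7 := mul_le_mul_of_nonneg_left (hX1 k) hγinv.le
              rw [hD]
              nlinarith only [h5, h6, h7, hX1 k, hB, hγinv]
        have h5 : 1 ≤ Real.exp (B * X k) :=
          Real.one_le_exp (mul_nonneg hB.le (by linarith [hX1 k]))
        exact (h3.trans hn1).trans (le_mul_of_one_le_left (by positivity) h5)
      linarith
    obtain ⟨M, hM⟩ := exists_bound_window hα0 hβ0 hK hgc hg hu.1 hu0
    obtain ⟨k, hk⟩ := exists_nat_gt (2 / γ * (M / B))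
    have hkM : M ≤ 2 * Real.exp (B * X k) := by
      have h1 : 2 / γ * (M / B) < 2 / γ * X k := hk.trans_le (hXk k)
      have h2 := (div_lt_iff₀ hB).1 (lt_of_mul_lt_mul_left h1 hγinv.le)
      have h3 := Real.add_one_le_exp (B * X k)
      have h4 := Real.exp_pos (B * X k)
      linarith
    have hall : ∀ k, (∀ p ∈ window g (1 / 8 - ρ ^ k / 16), 0 < hGamma g p →
          u p ≤ 2 * Real.exp (B * X k)) →
        ∀ p ∈ window g (1 / 16), 0 < hGamma g p → u p ≤ C₀ := by
      intro k
      induction k with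
      | zero =>
        intro h1 p hp hp0
        exact h1 p (window_mono g (by norm_num) hp) hp0
      | succ k ih => exact fun h1 => ih (hstep k h1)
    refine hall k fun p hp hp0 => (hM p (window_mono g ?_ hp) hp0).trans hkM
    linarith [hρk k]
  have hmain : ∀ j : ℕ, ∀ p ∈ window g (ρ ^ j / 16), h j ≤ hGamma g p →
      u p ≤ (M₀ + 2 - 2 / 2 ^ j) * v p := by
    intro j
    induction j with
    | zero =>
      intro p hp hpj
      rw [pow_zero] at hp
      have h1 := hcarleson p hp ((hhpos 0).trans_le hpj)
      have h2 := hlow 0 p (window_mono g (by norm_num) hp) hpj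
      have h3 := mul_le_mul_of_nonneg_left h2 hC₀0.le
      rw [pow_zero, hM₀]
      linarith
    | succ j ih =>
      intro p hp hpj
      obtain ⟨n, hn1, hn2⟩ := hXD j
      have hs : ρ ^ (j + 1) / 16 + n * (J * h j) ≤ ρ ^ j / 16 := by
        rw [pow_succ]
        linarith
      have hs16 : ρ ^ j / 16 ≤ 1 / 16 := by linarith [hρk1 j]
      have hs8 : ρ ^ j / 16 ≤ 1 / 8 := by linarith
      set M : ℝ := M₀ + 2 - 2 / 2 ^ j with hM
      have hM0 : 0 ≤ M := by
        have : (2 : ℝ) / 2 ^ j ≤ 2 := div_le_self (by norm_num) (one_le_pow₀ (by norm_num))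
        linarith
      have hwu : ∀ q ∈ Cyl g 1, 1 * u q + -M * v q + 0 ≤ u q := fun q hq => by
        linarith [mul_nonneg hM0 (hv.2.2 q hq)]
      have h1 := Hs A hA g hgc hg u (fun q => 1 * u q + -M * v q + 0) hu0 hwu
        (((continuousOn_const.mul hu.1).add (continuousOn_const.mul hv.1)).add continuousOn_const)
        (fun q hq => SolAt.comb (hu.2.1 q hq) (hv.2.1 q hq) _ _ _) (h j) (hhpos j) (hJhk j)
        C₀ hC₀0 n _ (hs.trans hs8)
        (fun q hq hqk => by linarith [ih q (window_mono g hs hq) hqk])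
        (fun q hq hq0 => (hwu q (mem_Cyl_of_mem_window hs8 (window_mono g hs hq) hq0)).trans
          (hcarleson q (window_mono g (hs.trans hs16) hq) hq0)) p hp ((hhpos _).trans_le hpj)
      have hs' : ρ ^ (j + 1) / 16 ≤ 1 / 8 := by linarith [hρk1 (j + 1)]
      have h2 := hlow (j + 1) p (window_mono g hs' hp) hpj
      have h3 : C₀ / 2 ^ n * (Real.exp (B * X (j + 1)) * v p) ≤ 1 / 2 ^ j * v p := by
        rw [← mul_assoc]
        refine mul_le_mul_of_nonneg_right ?_
          (hv.2.2 p (mem_Cyl_of_mem_window hs' hp ((hhpos _).trans_le hpj)))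
        rw [div_mul_eq_mul_div, div_le_div_iff₀ (by positivity) (by positivity), one_mul]
        refine le_trans ?_ hn1
        have h4 : (2 : ℝ) ≤ Real.exp 1 := by linarith [Real.add_one_le_exp 1]
        have h5 : (2 : ℝ) ^ j ≤ Real.exp j := by
          rw [← Real.exp_one_pow]
          exact pow_le_pow_left₀ (by norm_num) h4 j
        calc C₀ * Real.exp (B * X (j + 1)) * 2 ^ j
            ≤ Real.exp 1 * Real.exp (B * X 0) * Real.exp (B * X (j + 1)) * Real.exp j := by
              rw [hC₀]; gcongr
          _ = Real.exp (1 + B * X 0 + B * X (j + 1) + j) := by simp only [Real.exp_add]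
          _ ≤ Real.exp (D * X j) := by
              refine Real.exp_le_exp.2 ?_
              have h6 := mul_le_mul_of_nonneg_left (hXs j) hB.le
              have h7 := mul_le_mul_of_nonneg_left (hX0 j) hB.le
              rw [hD]
              nlinarith only [h6, h7, hX1 j, hXk j]
      have h4 : C₀ / 2 ^ n ≤ C₀ / 2 ^ n * (Real.exp (B * X (j + 1)) * v p) :=
        le_mul_of_one_le_right (by positivity) h2
      have h5 : M₀ + 2 - 2 / 2 ^ (j + 1) = M + 1 / 2 ^ j := by
        rw [hM, pow_succ]
        field_simp
        ring
      rw [h5, add_mul]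
      linarith
  intro p hp
  have hp0 : 0 < hGamma g p := sub_pos.2 hp.2.2.2.1
  have hpC : p ∈ Cyl g 1 :=
    ⟨by linarith [hp.1], by linarith [hp.2.1], by linarith [hp.2.2.1], hp.2.2.2.1,
      by linarith [hp.2.2.2.2]⟩
  obtain ⟨j, hj⟩ := exists_pow_lt_of_lt_one (div_pos hp0 hh₀) (by norm_num : (1 / 2 : ℝ) < 1)
  have hj' : h j ≤ hGamma g p := by
    rw [lt_div_iff₀ hh₀, one_div, inv_pow, inv_mul_eq_div] at hj
    exact hj.le
  have hpw : p ∈ window g (ρ ^ j / 16) := by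
    have h1 := hρk j
    refine ⟨by linarith [hp.1], abs_le.2 ⟨by linarith [hp.2.1], by linarith [hp.2.2.1]⟩, ?_⟩
    have h2 : hGamma g p = xlast p.1 - g (xprime p.1) p.2 := rfl
    linarith [hp.2.2.2.2]
  refine (hmain j p hpw hj').trans (mul_le_mul_of_nonneg_right ?_ (hv.2.2 p hpC))
  have : (0 : ℝ) < 2 / 2 ^ j := by positivity
  linarith

end BoundaryHarnack

/-- **Boundary Harnack principle in `C^{α,β}` Hölder domains, `α > 1/2`, `β > 1/3`**
(Theorem 1.2). -/
theorem boundary_harnack_holder (m : ℕ) (hm : 1 ≤ m) (lam Lam K α β : ℝ)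
    (hlam : 0 < lam) (hlamLam : lam ≤ Lam) (hK : 0 < K)
    (hα : 1 / 2 < α) (hα1 : α ≤ 1) (hβ : 1 / 3 < β) (hβ1 : β ≤ 1) :
    ∃ C : ℝ, 0 < C ∧
      ∀ (A : Spc m → Matrix (Fin (m + 1)) (Fin (m + 1)) ℝ), IsElliptic lam Lam A →
      ∀ g : Spc' m → ℝ → ℝ,
        Continuous (fun q : Spc' m × ℝ => g q.1 q.2) → g 0 0 = 0 →
        HolderSemi α β K g →
      ∀ u v : Spc m × ℝ → ℝ,
        SolvesL A u (Cyl g 1) → SolvesL A v (Cyl g 1) →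
        (∀ p ∈ Cyl g 1, 0 < u p) → (∀ p ∈ Cyl g 1, 0 < v p) →
        VanishesOn u (Cyl g 1) (graphSet g) →
        ∀ p ∈ Cyl g (1 / 2), u p / v p ≤ C * (u (Ebar g) / v (Eund g)) := by
  have hLam : 0 ≤ Lam := by linarith
  obtain ⟨C, hC, H⟩ := harnack_normalized m hlam hLam hα hβ hK
  refine ⟨C, hC, fun A hA g hgc _ hg u v hu hv hu0 hv0 huΓ p hp => ?_⟩
  have e1 : refPt g 1 = Ebar g := rfl
  have e2 : refPt g (-1) = Eund g := by
    unfold refPt Eund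
    norm_num
  have hU : 0 < u (Ebar g) := e1 ▸ hu0 _ (refPt_mem_Cyl g (by simp))
  have hV : 0 < v (Eund g) := e2 ▸ hv0 _ (refPt_mem_Cyl g (by simp))
  have hnn : ∀ w : Spc m × ℝ → ℝ, SolvesL A w (Cyl g 1) → (∀ p ∈ Cyl g 1, 0 < w p) →
      NNSol A w (Cyl g 1) := fun w hw hw0 =>
    ⟨continuousOn_of_solAt hlam hLam hA (isOpen_Cyl hgc 1) hw fun q hq => (hw0 q hq).le, hw,
      fun q hq => (hw0 q hq).le⟩
  have h1 := H A hA g hgc hg _ _ ((hnn u hu hu0).const_mul (inv_nonneg.2 hU.le))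
    ((hnn v hv hv0).const_mul (inv_nonneg.2 hV.le))
    (fun P hP => by simpa using (huΓ P hP).const_mul (u (Ebar g))⁻¹)
    (by rw [e1]; exact inv_mul_cancel₀ hU.ne') (by rw [e2]; exact inv_mul_cancel₀ hV.ne') p hp
  have hpC : p ∈ Cyl g 1 :=
    ⟨by linarith [hp.1], by linarith [hp.2.1], by linarith [hp.2.2.1], hp.2.2.2.1,
      by linarith [hp.2.2.2.2]⟩
  rw [div_le_iff₀ (hv0 p hpC)]
  have h2 := mul_le_mul_of_nonneg_left h1 hU.le
  rw [mul_inv_cancel_left₀ hU.ne'] at h2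
  refine h2.trans (le_of_eq ?_)
  field_simp
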